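/- Let R be a principal ideal domain, P a finitely generated abelian group, and let A = R[x_1,…,x_n, y_1^{±1},…,y_r^{±1}] be a mixed polynomial–Laurent polynomial R-algebra made into a P-graded R-algebra by declaring each x_i homogeneous of degree λ_i ∈ P, each y_j homogeneous of degree γ_j ∈ P, and R of degree 0 (a linear action of G = Spec R[P]). Then every finitely generated P-graded A-module that is projective as an A-module is isomorphic, as a P-graded A-module, to F ⊗_R A for some P-graded R-module F that is finitely generated projective over R. -/

import Mathlib

open scoped TensorProduct

universe u

/-! ### Properties of commutative (additive) monoids -/

/-- `Q` is cancellative: `a + x = a + y → x = y`. -/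
def IsCancellativeAddMonoid (Q : Type*) [AddCommMonoid Q] : Prop :=
  ∀ a x y : Q, a + x = a + y → x = y

/-- `Q` is torsion-free: `n • x = n • y` for some `n > 0` implies `x = y`. -/
def IsTorsionFreeAddMonoid (Q : Type*) [AddCommMonoid Q] : Prop :=
  ∀ n : ℕ, 0 < n → ∀ x y : Q, n • x = n • y → x = y

/-- `Q` is seminormal: an element `x = a - b` of the Grothendieck group with
`2x, 3x ∈ Q` lies in `Q` (stated elementwise via representatives). -/
def IsSeminormalAddMonoid (Q : Type*) [AddCommMonoid Q] : Prop :=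
  ∀ a b : Q, (∃ y : Q, a + a = b + b + y) → (∃ z : Q, a + a + a = b + b + b + z) →
    ∃ w : Q, a = b + w

/-- `Q` is normal: an element `x = a - b` of the Grothendieck group with
`n • x ∈ Q` for some `n > 0` lies in `Q` (stated elementwise via representatives). -/
def IsNormalAddMonoid (Q : Type*) [AddCommMonoid Q] : Prop :=
  ∀ a b : Q, (∃ n : ℕ, 0 < n ∧ ∃ y : Q, n • a = n • b + y) → ∃ w : Q, a = b + w

/-- `Q` has no nontrivial unit: `x + y = 0 → x = 0`. -/
def HasNoNontrivialAddUnits (Q : Type*) [AddCommMonoid Q] : Prop :=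
  ∀ x y : Q, x + y = 0 → x = 0

/-! ### Freeness/extension conditions on rings -/

/-- Every (not necessarily finitely generated) projective `R`-module is free. -/
def AllProjectiveFree (R : Type u) [CommRing R] : Prop :=
  ∀ (M : Type u) [AddCommGroup M] [Module R M], Module.Projective R M → Module.Free R M

/-- Every finitely generated projective `B`-module is free. -/
def AllFGProjectiveFree (B : Type u) [CommRing B] : Prop :=
  ∀ (M : Type u) [AddCommGroup M] [Module B M],
    Module.Finite B M → Module.Projective B M → Module.Free B M

/-- Every finitely generated projective `B`-module is extended from `R`, i.e. of the form
`B ⊗_R F` for a finitely generated projective `R`-module `F`. -/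
def AllFGProjectiveExtended (R B : Type u) [CommRing R] [CommRing B] [Algebra R B] : Prop :=
  ∀ (M : Type u) [AddCommGroup M] [Module B M],
    Module.Finite B M → Module.Projective B M →
    ∃ (F : Type u) (_ : AddCommGroup F) (_ : Module R F),
      Module.Finite R F ∧ Module.Projective R F ∧ Nonempty (M ≃ₗ[B] B ⊗[R] F)

/-- Condition (†): every projective `R`-module is free and every finitely generated
projective module over the group algebra `R[Q]` of a torsion-free abelian group `Q`
is extended from `R`. -/
def CondDagger (R : Type u) [CommRing R] : Prop :=
  AllProjectiveFree R ∧
  ∀ (Q : Type u) [AddCommGroup Q], IsTorsionFreeAddMonoid Q →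
    AllFGProjectiveExtended R (AddMonoidAlgebra R Q)

/-- Condition (††): every projective `R`-module is free and every finitely generated
projective module over `R[Q × ℤ^n]` is extended from `R`, whenever `Q` is torsion-free,
seminormal, cancellative and has no nontrivial unit. -/
def CondDaggerDagger (R : Type u) [CommRing R] : Prop :=
  AllProjectiveFree R ∧
  ∀ (n : ℕ) (Q : Type u) [AddCommMonoid Q],
    IsCancellativeAddMonoid Q → IsTorsionFreeAddMonoid Q → IsSeminormalAddMonoid Q →
    HasNoNontrivialAddUnits Q →
    AllFGProjectiveExtended R (AddMonoidAlgebra R (Q × (Fin n → ℤ)))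

/-! ### Gradings -/

/-- A map `f` is degree-preserving for the gradings `ℳ`, `𝒩`. -/
def MapsGraded {P M N : Type*} {R : Type*} [Semiring R] [AddCommMonoid M] [AddCommMonoid N]
    [Module R M] [Module R N] (f : M → N)
    (ℳ : P → Submodule R M) (𝒩 : P → Submodule R N) : Prop :=
  ∀ c : P, ∀ m ∈ ℳ c, f m ∈ 𝒩 c

/-- `𝒜` is a `P`-grading of the `R`-algebra `A`:
`A = ⊕_{a ∈ P} A_a`, `A_a · A_b ⊆ A_{a+b}`, `1 ∈ A_0`. -/
structure IsGradedRing {R A P : Type*} [CommRing R] [Ring A] [Algebra R A]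
    [AddCommGroup P] [DecidableEq P] (𝒜 : P → Submodule R A) : Prop where
  is_internal : DirectSum.IsInternal 𝒜
  one_mem : (1 : A) ∈ 𝒜 0
  mul_mem : ∀ {a b : P} {x y : A}, x ∈ 𝒜 a → y ∈ 𝒜 b → x * y ∈ 𝒜 (a + b)

/-- `ℳ` is a `P`-grading of the `A`-module `M`, compatible with the grading `𝒜` of `A`:
`M = ⊕_{a ∈ P} M_a` and `A_a • M_b ⊆ M_{a+b}`. -/
structure IsGradedModule {R A P M : Type*} [CommRing R] [Ring A] [Algebra R A]
    [AddCommGroup P] [DecidableEq P] [AddCommGroup M] [Module R M] [Module A M]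
    [IsScalarTower R A M] (𝒜 : P → Submodule R A) (ℳ : P → Submodule R M) : Prop where
  is_internal : DirectSum.IsInternal ℳ
  smul_mem : ∀ {a b : P} {x : A} {m : M}, x ∈ 𝒜 a → m ∈ ℳ b → x • m ∈ ℳ (a + b)

/-- The natural `P`-grading on `B ⊗[R] F`: `(B ⊗ F)_c = ⊕_{a+b=c} B_a ⊗ F_b`. -/
noncomputable def tensorGrading {R B F P : Type*} [CommRing R] [CommRing B] [Algebra R B]
    [AddCommGroup P] [AddCommGroup F] [Module R F]
    (ℬ : P → Submodule R B) (ℱ : P → Submodule R F) : P → Submodule R (B ⊗[R] F) :=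
  fun c => Submodule.span R
    {z | ∃ a b : P, a + b = c ∧ ∃ x ∈ ℬ a, ∃ f ∈ ℱ b, z = x ⊗ₜ[R] f}

/-- A `P`-graded `A`-module `(M, ℳ)` is (equivariantly) extended from `R`, i.e. trivial:
it is isomorphic, as a `P`-graded `A`-module, to `A ⊗_R F` for some `P`-graded `R`-module
`F` which is finitely generated and projective over `R`. -/
def IsGradedExtendedFrom (R : Type u) {A P : Type u} [CommRing R] [CommRing A]
    [Algebra R A] [AddCommGroup P] [DecidableEq P] (𝒜 : P → Submodule R A)
    (M : Type u) [AddCommGroup M] [Module R M] [Module A M] [IsScalarTower R A M]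
    (ℳ : P → Submodule R M) : Prop :=
  ∃ (F : Type u) (_ : AddCommGroup F) (_ : Module R F) (ℱ : P → Submodule R F),
    DirectSum.IsInternal ℱ ∧ Module.Finite R F ∧ Module.Projective R F ∧
    ∃ e : M ≃ₗ[A] A ⊗[R] F,
      MapsGraded (⇑e) ℳ (tensorGrading 𝒜 ℱ) ∧ MapsGraded (⇑e.symm) (tensorGrading 𝒜 ℱ) ℳ

/-! ### Monoid algebras, cones and faces -/

/-- The grading of a monoid algebra `R[Λ]` induced by a degree function `deg : Λ → P`:
the piece of degree `p` is spanned by the monomials `e_s` with `deg s = p`. -/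
noncomputable def monAlgGrading (R : Type*) [CommRing R] {Λ P : Type*} [AddCommMonoid Λ]
    (deg : Λ → P) : P → Submodule R (AddMonoidAlgebra R Λ) :=
  fun p => Submodule.span R {x | ∃ s : Λ, deg s = p ∧ x = AddMonoidAlgebra.single s 1}

/-- The lattice points `σ ∩ L` of the rational polyhedral cone
`σ = ⋂ᵢ (l i)⁻¹(ℚ≥0)` in `L ⊗ ℚ`. -/
def coneLatticePoints {L : Type*} [AddCommGroup L] {q : ℕ} (l : Fin q → L →+ ℚ) :
    AddSubmonoid L where
  carrier := {m | ∀ i, 0 ≤ l i m}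
  zero_mem' := fun i => by simp
  add_mem' := by
    intro a b ha hb i
    rw [map_add]
    exact add_nonneg (ha i) (hb i)

/-- The lattice points `τ ∩ L` of the face `τ = σ ∩ l'⁻¹(0)` of the cone `σ`. -/
def faceLatticePoints {L : Type*} [AddCommGroup L] {q : ℕ} (l : Fin q → L →+ ℚ)
    (l' : L →+ ℚ) : AddSubmonoid L where
  carrier := {m | (∀ i, 0 ≤ l i m) ∧ l' m = 0}
  zero_mem' := ⟨fun i => by simp, by simp⟩
  add_mem' := by
    intro a b ha hb
    refine ⟨fun i => ?_, ?_⟩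
    · rw [map_add]; exact add_nonneg (ha.1 i) (hb.1 i)
    · rw [map_add, ha.2, hb.2, add_zero]

/-- The submonoid of elements of a submonoid `S ⊆ L` killed by `ψ : L →+ P`
(the "invariant" part of `S`). -/
def kerSubmonoidIn {L P : Type*} [AddCommMonoid L] [AddCommMonoid P]
    (S : AddSubmonoid L) (ψ : L →+ P) : AddSubmonoid L where
  carrier := {m | m ∈ S ∧ ψ m = 0}
  zero_mem' := ⟨S.zero_mem, map_zero ψ⟩
  add_mem' := by
    intro a b ha hb
    exact ⟨S.add_mem ha.1 hb.1, by rw [map_add, ha.2, hb.2, add_zero]⟩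

/-- The kernel submonoid `{q ∈ Q | u q = 0}` of a monoid homomorphism `u : Q →+ P`. -/
def kerSubmonoid {Q P : Type*} [AddCommMonoid Q] [AddCommMonoid P] (u : Q →+ P) :
    AddSubmonoid Q where
  carrier := {q | u q = 0}
  zero_mem' := map_zero u
  add_mem' := by
    intro a b ha hb
    simp only [Set.mem_setOf_eq] at *
    rw [map_add, ha, hb, add_zero]

/-- `S` spans `L ⊗ ℚ`: a positive multiple of every lattice element is a difference of
elements of `S` (this expresses that the cone is "strongly convex", i.e. spans `L_ℚ`). -/
def SpansLattice {L : Type*} [AddCommGroup L] (S : AddSubmonoid L) : Prop :=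
  ∀ m : L, ∃ n : ℕ, 0 < n ∧ ∃ x ∈ S, ∃ y ∈ S, (n : ℤ) • m = x - y

namespace GradedProj

set_option linter.unusedSectionVars false

open Polynomial

section Basic

variable {P : Type*} [AddCommGroup P] {A : Type*} [CommRing A]

/-- The matrix `X` is homogeneous of degree zero, as a map between the graded free modules with
basis degrees `b` and `a`. -/
def HomMat (𝒜 : P → AddSubgroup A) {ι κ : Type*} (a : ι → P) (b : κ → P)
    (X : Matrix ι κ A) : Prop :=
  ∀ i j, X i j ∈ 𝒜 (a i - b j)

/-- The graded modules defined by the idempotent matrices `E` and `F` are isomorphic. -/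
def GrIso (𝒜 : P → AddSubgroup A) {ι κ : Type*} [Fintype ι] [Fintype κ] (a : ι → P)
    (E : Matrix ι ι A) (b : κ → P) (F : Matrix κ κ A) : Prop :=
  ∃ (X : Matrix ι κ A) (Y : Matrix κ ι A),
    HomMat 𝒜 a b X ∧ HomMat 𝒜 b a Y ∧ X * Y = E ∧ Y * X = F

/-- The graded module defined by the idempotent matrix `E` is graded free. -/
def GrFree (𝒜 : P → AddSubgroup A) {ι : Type*} [Fintype ι] (a : ι → P)
    (E : Matrix ι ι A) : Prop :=
  ∃ (k : ℕ) (b : Fin k → P), GrIso 𝒜 a E b (1 : Matrix (Fin k) (Fin k) A)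

/-- Every finitely generated graded projective module is graded free. -/
def AllFree (𝒜 : P → AddSubgroup A) : Prop :=
  ∀ (m : ℕ) (a : Fin m → P) (E : Matrix (Fin m) (Fin m) A),
    HomMat 𝒜 a a E → E * E = E → GrFree 𝒜 a E

variable {𝒜 : P → AddSubgroup A} {ι κ μ : Type*}
  {a : ι → P} {b : κ → P} {c : μ → P}

theorem mem_congr {x : A} {d e : P} (hx : x ∈ 𝒜 d) (h : d = e) : x ∈ 𝒜 e := h ▸ hx

theorem HomMat.add {X Y : Matrix ι κ A} (hX : HomMat 𝒜 a b X) (hY : HomMat 𝒜 a b Y) :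
    HomMat 𝒜 a b (X + Y) := fun i j => add_mem (hX i j) (hY i j)

theorem HomMat.sub {X Y : Matrix ι κ A} (hX : HomMat 𝒜 a b X) (hY : HomMat 𝒜 a b Y) :
    HomMat 𝒜 a b (X - Y) := fun i j => sub_mem (hX i j) (hY i j)

theorem HomMat.zero : HomMat 𝒜 a b (0 : Matrix ι κ A) := fun _ _ => zero_mem _

theorem HomMat.submatrix {ι' κ' : Type*} {X : Matrix ι κ A} (hX : HomMat 𝒜 a b X)
    (f : ι' → ι) (g : κ' → κ) : HomMat 𝒜 (a ∘ f) (b ∘ g) (X.submatrix f g) :=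
  fun i j => hX (f i) (g j)

theorem HomMat.map {B : Type*} [CommRing B] {ℬ : P → AddSubgroup B} (φ : A →+* B)
    (hφ : ∀ d, ∀ x ∈ 𝒜 d, φ x ∈ ℬ d) {X : Matrix ι κ A} (hX : HomMat 𝒜 a b X) :
    HomMat ℬ a b (X.map φ) := fun i j => hφ _ _ (hX i j)

variable [SetLike.GradedMonoid 𝒜]

theorem mul_mem_of_eq {x y : A} {d e f : P} (hx : x ∈ 𝒜 d) (hy : y ∈ 𝒜 e) (h : d + e = f) :
    x * y ∈ 𝒜 f := h ▸ SetLike.mul_mem_graded hx hy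

theorem one_mem_zero : (1 : A) ∈ 𝒜 0 := SetLike.one_mem_graded 𝒜

theorem HomMat.mul [Fintype κ] {X : Matrix ι κ A} {Y : Matrix κ μ A}
    (hX : HomMat 𝒜 a b X) (hY : HomMat 𝒜 b c Y) : HomMat 𝒜 a c (X * Y) := fun i j => by
  rw [Matrix.mul_apply]
  exact sum_mem fun k _ => mul_mem_of_eq (hX i k) (hY k j) (by abel)

theorem HomMat.one [DecidableEq ι] : HomMat 𝒜 a a (1 : Matrix ι ι A) := fun i j => by
  by_cases h : i = j
  · subst h; simpa using one_mem_zero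
  · simp [Matrix.one_apply_ne h]

section

variable [Fintype ι] [Fintype κ] [Fintype μ]

theorem GrIso.symm {E : Matrix ι ι A} {F : Matrix κ κ A} (h : GrIso 𝒜 a E b F) :
    GrIso 𝒜 b F a E := by
  obtain ⟨X, Y, hX, hY, h1, h2⟩ := h
  exact ⟨Y, X, hY, hX, h2, h1⟩

theorem GrIso.refl {E : Matrix ι ι A} (hE : HomMat 𝒜 a a E) (h : E * E = E) :
    GrIso 𝒜 a E a E := ⟨E, E, hE, hE, h, h⟩

theorem GrIso.trans {E : Matrix ι ι A} {F : Matrix κ κ A} {G : Matrix μ μ A}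
    (h : GrIso 𝒜 a E b F) (h' : GrIso 𝒜 b F c G) (hE : E * E = E) (hG : G * G = G) :
    GrIso 𝒜 a E c G := by
  obtain ⟨X, Y, hX, hY, rfl, rfl⟩ := h
  obtain ⟨Z, W, hZ, hW, h1, rfl⟩ := h'
  refine ⟨X * Z, W * Y, hX.mul hZ, hW.mul hY, ?_, ?_⟩
  · calc X * Z * (W * Y) = X * (Z * W) * Y := by simp only [Matrix.mul_assoc]
      _ = X * Y := by rw [h1, ← hE]; simp only [Matrix.mul_assoc]
  · calc W * Y * (X * Z) = W * (Y * X) * Z := by simp only [Matrix.mul_assoc]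
      _ = W * Z := by rw [← h1, ← hG]; simp only [Matrix.mul_assoc]

theorem GrIso.map {B : Type*} [CommRing B] {ℬ : P → AddSubgroup B} (φ : A →+* B)
    (hφ : ∀ d, ∀ x ∈ 𝒜 d, φ x ∈ ℬ d) {E : Matrix ι ι A} {F : Matrix κ κ A}
    (h : GrIso 𝒜 a E b F) : GrIso ℬ a (E.map φ) b (F.map φ) := by
  obtain ⟨X, Y, hX, hY, rfl, rfl⟩ := h
  exact ⟨X.map φ, Y.map φ, hX.map φ hφ, hY.map φ hφ, (Matrix.map_mul ..).symm,
    (Matrix.map_mul ..).symm⟩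

theorem GrIso.reindex [DecidableEq ι] {E : Matrix ι ι A} (hE : HomMat 𝒜 a a E)
    (h : E * E = E) (e : κ ≃ ι) : GrIso 𝒜 (a ∘ e) (E.submatrix e e) a E := by
  refine ⟨E.submatrix e id, E.submatrix id e, hE.submatrix e id, hE.submatrix id e, ?_, ?_⟩
  · change E.submatrix e (Equiv.refl ι) * E.submatrix (Equiv.refl ι) e = _
    rw [Matrix.submatrix_mul_equiv, h]
  · rw [Matrix.submatrix_mul_equiv, h]; rfl

theorem GrFree.of_grIso {E : Matrix ι ι A} {F : Matrix κ κ A} (h : GrIso 𝒜 a E b F)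
    (hF : GrFree 𝒜 b F) (hE : E * E = E) : GrFree 𝒜 a E := by
  obtain ⟨k, c, h'⟩ := hF
  exact ⟨k, c, h.trans h' hE (by simp)⟩

theorem GrFree.of_one [DecidableEq κ] {E : Matrix ι ι A}
    (h : GrIso 𝒜 a E b (1 : Matrix κ κ A)) (hE : E * E = E) : GrFree 𝒜 a E := by
  refine ⟨Fintype.card κ, b ∘ (Fintype.equivFin κ).symm, h.trans ?_ hE (by simp)⟩
  have := (GrIso.reindex (𝒜 := 𝒜) (a := b) HomMat.one (by simp) (Fintype.equivFin κ).symm).symm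
  simpa using this

theorem GrFree.map {B : Type*} [CommRing B] {ℬ : P → AddSubgroup B} (φ : A →+* B)
    (hφ : ∀ d, ∀ x ∈ 𝒜 d, φ x ∈ ℬ d) {E : Matrix ι ι A}
    (h : GrFree 𝒜 a E) : GrFree ℬ a (E.map φ) := by
  obtain ⟨k, b, h⟩ := h
  exact ⟨k, b, by simpa using h.map φ hφ⟩

theorem AllFree.apply (h : AllFree 𝒜) [DecidableEq ι] {E : Matrix ι ι A}
    (hE : HomMat 𝒜 a a E) (hE2 : E * E = E) : GrFree 𝒜 a E := by
  have e := (Fintype.equivFin ι).symm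
  refine GrFree.of_grIso (GrIso.reindex hE hE2 e).symm
    (h _ _ _ (hE.submatrix e e) ?_) hE2
  rw [Matrix.submatrix_mul_equiv, hE2]

theorem AllFree.of_equiv {B : Type*} [CommRing B] {ℬ : P → AddSubgroup B} (φ : A ≃+* B)
    (hφ : ∀ d x, x ∈ 𝒜 d ↔ φ x ∈ ℬ d) (h : AllFree 𝒜) : AllFree ℬ := by
  intro m a E hE hE2
  have h1 : ∀ d, ∀ x ∈ ℬ d, φ.symm x ∈ 𝒜 d := fun d x hx => by rw [hφ]; simpa using hx
  have := (h m a (E.map φ.symm) (hE.map (φ.symm : B →+* A) h1)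
    (by rw [← Matrix.map_mul, hE2])).map (φ : A →+* B) (ℬ := ℬ) fun d x hx => (hφ d x).1 hx
  have hEE : (E.map φ.symm).map (φ : A →+* B) = E := by ext; simp
  rwa [hEE] at this

/-- Splitting off a homogeneous unimodular element. -/
theorem GrFree.of_rank_one {E : Matrix ι ι A} (hE : E * E = E)
    {σ : Matrix ι Unit A} {w : Matrix Unit ι A} {d : P}
    (hσ : HomMat 𝒜 a (fun _ => d) σ) (hw : HomMat 𝒜 (fun _ => d) a w)
    (h1 : E * σ = σ) (h2 : w * E = w) (h3 : w * σ = 1) (h : GrFree 𝒜 a (E - σ * w)) :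
    GrFree 𝒜 a E := by
  obtain ⟨k, b, X, Y, hX, hY, hXY, hYX⟩ := h
  have e1 : (E - σ * w) * σ = 0 := by
    rw [Matrix.sub_mul, h1, Matrix.mul_assoc, h3, Matrix.mul_one, sub_self]
  have e2 : w * (E - σ * w) = 0 := by
    rw [Matrix.mul_sub, h2, ← Matrix.mul_assoc, h3, Matrix.one_mul, sub_self]
  have e3 : Y * σ = 0 := by
    calc Y * σ = Y * X * (Y * σ) := by rw [hYX, Matrix.one_mul]
      _ = Y * ((X * Y) * σ) := by simp only [Matrix.mul_assoc]
      _ = 0 := by rw [hXY, e1, Matrix.mul_zero]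
  have e4 : w * X = 0 := by
    calc w * X = w * X * (Y * X) := by rw [hYX, Matrix.mul_one]
      _ = w * (X * Y) * X := by simp only [Matrix.mul_assoc]
      _ = 0 := by rw [hXY, e2, Matrix.zero_mul]
  refine GrFree.of_one (b := Sum.elim b fun _ => d)
    ⟨Matrix.fromCols X σ, Matrix.fromRows Y w, ?_, ?_, ?_, ?_⟩ hE
  · rintro i (j | j)
    · exact hX i j
    · exact hσ i j
  · rintro (i | i) j
    · exact hY i j
    · exact hw i j
  · rw [Matrix.fromCols_mul_fromRows, hXY, sub_add_cancel]
  · rw [Matrix.fromRows_mul_fromCols, hYX, h3, e3, e4, Matrix.fromBlocks_one]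

end

end Basic

section PolyGrading

variable {P : Type*} [AddCommGroup P] {A : Type*} [CommRing A]

/-- The grading of `A[X]` with `X` homogeneous of degree `l`. -/
def polyGrading (𝒜 : P → AddSubgroup A) (l : P) (d : P) : AddSubgroup A[X] where
  carrier := {f | ∀ i : ℕ, f.coeff i ∈ 𝒜 (d - i • l)}
  zero_mem' := fun i => by simp
  add_mem' := fun hf hg i => by rw [coeff_add]; exact add_mem (hf i) (hg i)
  neg_mem' := fun hf i => by rw [coeff_neg]; exact neg_mem (hf i)

/-- `𝒩` is a homogeneous ideal of the graded ring `𝒜`. -/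
structure IdealFam (𝒜 𝒩 : P → AddSubgroup A) : Prop where
  le : ∀ d, 𝒩 d ≤ 𝒜 d
  mul_mem : ∀ {d e f : P} {x y : A}, x ∈ 𝒜 d → y ∈ 𝒩 e → d + e = f → x * y ∈ 𝒩 f

variable {𝒜 𝒩 : P → AddSubgroup A} {l d e : P}

theorem C_mem {x : A} (hx : x ∈ 𝒜 d) : C x ∈ polyGrading 𝒜 l d := fun i => by
  rw [coeff_C]
  split_ifs with h
  · subst h; simpa using hx
  · exact zero_mem _

theorem X_pow_mul_mem {f : A[X]} (n : ℕ) (hf : f ∈ polyGrading 𝒜 l d) (h : d + n • l = e) :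
    X ^ n * f ∈ polyGrading 𝒜 l e := fun i => by
  rw [coeff_X_pow_mul']
  split_ifs with hi
  · refine mem_congr (hf _) ?_
    obtain ⟨k, rfl⟩ := Nat.exists_eq_add_of_le hi
    rw [← h, Nat.add_sub_cancel_left, add_smul]; abel
  · exact zero_mem _

theorem IdealFam.refl [SetLike.GradedMonoid 𝒜] : IdealFam 𝒜 𝒜 :=
  ⟨fun _ => le_rfl, fun hx hy h => mul_mem_of_eq hx hy h⟩

theorem IdealFam.poly (h : IdealFam 𝒜 𝒩) (l : P) :
    IdealFam (polyGrading 𝒜 l) (polyGrading 𝒩 l) where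
  le d f hf i := h.le _ (hf i)
  mul_mem {d e k f g} hf hg hk i := by
    rw [coeff_mul]
    refine sum_mem fun p hp => h.mul_mem (hf _) (hg _) ?_
    rw [← hk, ← Finset.HasAntidiagonal.mem_antidiagonal.1 hp, add_smul]; abel

theorem IdealFam.mul_mem' (h : IdealFam 𝒜 𝒩) {d e f : P} {x y : A} (hx : x ∈ 𝒩 d) (hy : y ∈ 𝒜 e)
    (hf : d + e = f) : x * y ∈ 𝒩 f := by
  rw [mul_comm]; exact h.mul_mem hy hx (by rw [add_comm, hf])

theorem IdealFam.matrix_mul (h : IdealFam 𝒜 𝒩) {ι κ μ : Type*} [Fintype κ] {a : ι → P} {b : κ → P}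
    {c : μ → P} {X : Matrix ι κ A} {Y : Matrix κ μ A}
    (hX : HomMat 𝒜 a b X) (hY : HomMat 𝒩 b c Y) : HomMat 𝒩 a c (X * Y) := fun i j => by
  rw [Matrix.mul_apply]
  exact sum_mem fun k _ => h.mul_mem (hX i k) (hY k j) (by abel)

variable [SetLike.GradedMonoid 𝒜]

instance polyGrading.gradedMonoid : SetLike.GradedMonoid (polyGrading 𝒜 l) where
  one_mem := by rw [← C_1]; exact C_mem one_mem_zero
  mul_mem _ _ _ _ hf hg := (IdealFam.refl.poly l).mul_mem hf hg rfl

theorem X_pow_mem (n : ℕ) (h : n • l = d) : (X ^ n : A[X]) ∈ polyGrading 𝒜 l d := by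
  simpa using X_pow_mul_mem (𝒜 := 𝒜) (l := l) n one_mem_zero (by rw [zero_add, h])

theorem X_mem : (X : A[X]) ∈ polyGrading 𝒜 l l := by
  simpa using X_pow_mem (𝒜 := 𝒜) (l := l) 1 (one_smul ..)

theorem pow_mem_of_eq {x : A} (hx : x ∈ 𝒜 d) (n : ℕ) (h : n • d = e) : x ^ n ∈ 𝒜 e :=
  h ▸ SetLike.pow_mem_graded n hx

theorem eval₂_mem {B : Type*} [CommRing B] {ℬ : P → AddSubgroup B} [SetLike.GradedMonoid ℬ]
    (φ : A →+* B) (hφ : ∀ d, ∀ x ∈ 𝒜 d, φ x ∈ ℬ d) {y : B} (hy : y ∈ ℬ l) {f : A[X]}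
    (hf : f ∈ polyGrading 𝒜 l d) : f.eval₂ φ y ∈ ℬ d := by
  rw [eval₂_eq_sum_range]
  exact sum_mem fun i _ => mul_mem_of_eq (hφ _ _ (hf i)) (pow_mem_of_eq hy i rfl) (by abel)

theorem mapRingHom_mem {B : Type*} [CommRing B] {ℬ : P → AddSubgroup B}
    (φ : A →+* B) (hφ : ∀ d, ∀ x ∈ 𝒜 d, φ x ∈ ℬ d) {f : A[X]}
    (hf : f ∈ polyGrading 𝒜 l d) : f.map φ ∈ polyGrading ℬ l d := fun i => by
  rw [coeff_map]; exact hφ _ _ (hf i)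

/-- Division by a monic matrix of polynomials. -/
theorem exists_matrix_div {κ : Type*} [Fintype κ] [DecidableEq κ] (h𝒩 : IdealFam 𝒜 𝒩)
    {b : κ → P} {c : P} {D : ℕ} {S : Matrix κ κ A[X]}
    (hS : HomMat (polyGrading 𝒜 l) b (fun j => b j - D • l) S)
    (hS1 : ∀ n, D ≤ n → ∀ i j, (S i j).coeff n = if n = D ∧ i = j then 1 else 0)
    {V : κ → A[X]} (hV : ∀ i, ∀ n, D ≤ n → (V i).coeff n ∈ 𝒩 (b i - c - n • l)) :
    ∃ Q : κ → A[X], (∀ i, Q i ∈ polyGrading 𝒩 l (b i - c - D • l)) ∧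
      ∀ i n, D ≤ n → (V i - S.mulVec Q i).coeff n = 0 := by
  have key : ∀ (L : ℕ) (V : κ → A[X]),
      (∀ i, ∀ n, D ≤ n → (V i).coeff n ∈ 𝒩 (b i - c - n • l)) →
      (∀ i n, D + L ≤ n → (V i).coeff n = 0) →
      ∃ Q : κ → A[X], (∀ i, Q i ∈ polyGrading 𝒩 l (b i - c - D • l)) ∧
      ∀ i n, D ≤ n → (V i - S.mulVec Q i).coeff n = 0 := by
    intro L
    induction L with
    | zero => 
      intro V _ h0
      exact ⟨0, fun i => zero_mem _, fun i n hn => by simpa using h0 i n hn⟩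
    | succ L ih =>
      intro V hV h0
      let q : κ → A[X] := fun j => X ^ L * C ((V j).coeff (D + L))
      have hq : ∀ i, q i ∈ polyGrading 𝒩 l (b i - c - D • l) := fun i =>
        X_pow_mul_mem L (C_mem (hV i (D + L) (by omega))) (by rw [add_smul]; abel)
      have hSq : ∀ i n, (S.mulVec q i).coeff n =
          if L ≤ n then ∑ j, (S i j).coeff (n - L) * (V j).coeff (D + L) else 0 := by
        intro i n
        simp only [Matrix.mulVec, dotProduct, finsetSum_coeff, q]
        have : ∀ j, (S i j * (X ^ L * C ((V j).coeff (D + L)))).coeff n =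
            if L ≤ n then (S i j).coeff (n - L) * (V j).coeff (D + L) else 0 := by
          intro j
          rw [mul_left_comm, coeff_X_pow_mul']
          simp
        simp only [this]
        split_ifs <;> simp
      have main := ih (fun i => V i - S.mulVec q i) ?_ ?_
      · obtain ⟨Q, hQ, hQ'⟩ := main
        refine ⟨q + Q, fun i => add_mem (hq i) (hQ i), fun i n hn => ?_⟩
        rw [Matrix.mulVec_add, Pi.add_apply, ← sub_sub]
        exact hQ' i n hn
      · intro i n hn
        rw [coeff_sub, hSq]
        refine sub_mem (hV i n hn) ?_
        split_ifs with h
        · refine sum_mem fun j _ => h𝒩.mul_mem (hS i j _) (hV j _ (by omega)) ?_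
          obtain ⟨k, rfl⟩ := Nat.exists_eq_add_of_le h
          rw [Nat.add_sub_cancel_left, add_smul, add_smul]; dsimp only; abel
        · exact zero_mem _
      · intro i n hn
        have h1 : ∀ j, (S i j).coeff (n - L) = if n = D + L ∧ i = j then 1 else 0 := fun j => by
          rw [hS1 _ (by omega)]
          congr 1
          grind
        rw [coeff_sub, hSq, if_pos (by omega)]
        simp only [h1]
        rcases eq_or_lt_of_le hn with rfl | hn
        · simp
        · rw [h0 i n (by omega), Finset.sum_eq_zero, sub_zero]
          intro j _
          rw [if_neg (by omega), zero_mul]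
  refine key (Finset.univ.sup fun i => (V i).natDegree + 1) V hV fun i n hn => ?_
  refine coeff_eq_zero_of_natDegree_lt ?_
  have := Finset.le_sup (f := fun i => (V i).natDegree + 1) (Finset.mem_univ i)
  omega

/-- Division by a monic homogeneous polynomial. -/
theorem exists_div (h𝒩 : IdealFam 𝒜 𝒩) {s : A[X]} (hs : s.Monic)
    (hs1 : s ∈ polyGrading 𝒜 l (s.natDegree • l))
    {f : A[X]} (hf : ∀ n, s.natDegree ≤ n → f.coeff n ∈ 𝒩 (d - n • l)) :
    ∃ q ∈ polyGrading 𝒩 l (d - s.natDegree • l),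
      ∀ n, s.natDegree ≤ n → (f - s * q).coeff n = 0 := by
  have main := exists_matrix_div (κ := Unit) (l := l) (b := fun _ => d) (c := 0)
    (D := s.natDegree) (S := fun _ _ => s) (V := fun _ => f) h𝒩
    (fun _ _ => mem_congr hs1 (by dsimp only; abel)) ?_
    (fun _ n hn => mem_congr (hf n hn) (by rw [sub_zero]))
  · obtain ⟨Q, hQ, hQ'⟩ := main
    refine ⟨Q (), mem_congr (hQ ()) (by rw [sub_zero]), fun n hn => ?_⟩
    have := hQ' () n hn
    simpa [Matrix.mulVec, dotProduct] using this
  · intro n hn i j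
    rcases eq_or_lt_of_le hn with rfl | hn
    · simp [hs.leadingCoeff]
    · rw [coeff_eq_zero_of_natDegree_lt hn, if_neg (by omega)]

end PolyGrading

section GrLocal

variable {P : Type*} [AddCommGroup P] {B : Type*} [CommRing B] {ℬ : P → AddSubgroup B}

/-- The graded ring `ℬ` has a unique maximal homogeneous ideal. -/
def GrLocal (ℬ : P → AddSubgroup B) : Prop :=
  (1 : B) ≠ 0 ∧ ∀ u ∈ ℬ 0, (∃ v ∈ ℬ 0, u * v = 1) ∨ ∃ v ∈ ℬ 0, (1 - u) * v = 1

variable [SetLike.GradedMonoid ℬ]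

/-- The homogeneous ideal of non-units of a graded local ring. -/
def GrLocal.nonunits (h : GrLocal ℬ) (d : P) : AddSubgroup B where
  carrier := {x | x ∈ ℬ d ∧ ¬ ∃ y ∈ ℬ (-d), x * y = 1}
  zero_mem' := ⟨zero_mem _, fun ⟨y, _, hy⟩ => h.1 (by rw [← hy, zero_mul])⟩
  add_mem' := by
    rintro x y ⟨hx, hx'⟩ ⟨hy, hy'⟩
    refine ⟨add_mem hx hy, ?_⟩
    rintro ⟨z, hz, h1⟩
    rcases h.2 (x * z) (mul_mem_of_eq hx hz (by abel)) with ⟨v, hv, h2⟩ | ⟨v, hv, h2⟩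
    · exact hx' ⟨z * v, mul_mem_of_eq hz hv (by abel), by rw [← mul_assoc, h2]⟩
    · refine hy' ⟨z * v, mul_mem_of_eq hz hv (by abel), ?_⟩
      rw [← h2, ← h1]; ring
  neg_mem' := by
    rintro x ⟨hx, hx'⟩
    refine ⟨neg_mem hx, ?_⟩
    rintro ⟨z, hz, h1⟩
    exact hx' ⟨-z, neg_mem hz, by rw [← h1]; ring⟩

theorem GrLocal.idealFam (h : GrLocal ℬ) : IdealFam ℬ h.nonunits where
  le d x hx := hx.1
  mul_mem := by
    rintro d e f x y hx ⟨hy, hy'⟩ rfl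
    refine ⟨mul_mem_of_eq hx hy rfl, ?_⟩
    rintro ⟨z, hz, h1⟩
    exact hy' ⟨x * z, mul_mem_of_eq hx hz (by abel), by rw [← h1]; ring⟩

theorem GrLocal.mem_nonunits_or (h : GrLocal ℬ) {d : P} {x : B} (hx : x ∈ ℬ d) :
    x ∈ h.nonunits d ∨ ∃ y ∈ ℬ (-d), x * y = 1 := by
  by_cases h' : ∃ y ∈ ℬ (-d), x * y = 1
  · exact Or.inr h'
  · exact Or.inl ⟨hx, h'⟩

theorem GrLocal.one_notMem (h : GrLocal ℬ) : (1 : B) ∉ h.nonunits 0 := fun h1 =>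
  h1.2 ⟨1, by simpa using one_mem_zero, mul_one 1⟩

theorem GrLocal.exists_inv_one_add (h : GrLocal ℬ) {x : B} (hx : x ∈ h.nonunits 0) :
    ∃ v ∈ ℬ 0, (1 + x) * v = 1 := by
  rcases h.2 (-x) (neg_mem hx.1) with ⟨v, hv, h2⟩ | ⟨v, hv, h2⟩
  · exact absurd ⟨-v, by simpa using hv, by rw [← h2]; ring⟩ hx.2
  · exact ⟨v, hv, by rwa [sub_neg_eq_add] at h2⟩

theorem prod_mem_of_eq {ι : Type*} (s : Finset ι) {d : ι → P} {x : ι → B} {e : P}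
    (hx : ∀ i ∈ s, x i ∈ ℬ (d i)) (he : ∑ i ∈ s, d i = e) : ∏ i ∈ s, x i ∈ ℬ e := by
  classical
  induction s using Finset.induction_on generalizing e with
  | empty => simpa [← he] using one_mem_zero
  | insert i s hi ih =>
    rw [Finset.sum_insert hi] at he
    rw [Finset.prod_insert hi]
    exact mul_mem_of_eq (hx i (by simp)) (ih (fun j hj => hx j (by simp [hj])) rfl) he

theorem IdealFam.prod_mem {𝒩 : P → AddSubgroup B} (h : IdealFam ℬ 𝒩) {ι : Type*} (s : Finset ι)
    {d : ι → P} {x : ι → B} {e : P} (hx : ∀ i ∈ s, x i ∈ ℬ (d i)) (he : ∑ i ∈ s, d i = e)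
    {i : ι} (hi : i ∈ s) (hi' : x i ∈ 𝒩 (d i)) : ∏ i ∈ s, x i ∈ 𝒩 e := by
  classical
  rw [← Finset.mul_prod_erase s x hi]
  rw [← Finset.add_sum_erase s d hi] at he
  exact h.mul_mem' hi' (prod_mem_of_eq _ (fun j hj => hx j (Finset.mem_of_mem_erase hj)) rfl) he

theorem IdealFam.prod_one_add {𝒩 : P → AddSubgroup B} (h : IdealFam ℬ 𝒩) {ι : Type*}
    (s : Finset ι) {x : ι → B} (hx : ∀ i ∈ s, x i ∈ 𝒩 0) : ∏ i ∈ s, (1 + x i) - 1 ∈ 𝒩 0 := by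
  classical
  induction s using Finset.induction_on with
  | empty => simp
  | insert i s hi ih =>
    rw [Finset.prod_insert hi]
    have h1 := ih fun j hj => hx j (by simp [hj])
    have h2 := hx i (by simp)
    have : (1 + x i) * ∏ i ∈ s, (1 + x i) - 1 =
        (∏ i ∈ s, (1 + x i) - 1) + x i * (∏ i ∈ s, (1 + x i) - 1) + x i := by ring
    rw [this]
    exact add_mem (add_mem h1 (h.mul_mem (h.le _ h2) h1 (by simp))) h2

theorem HomMat.det_mem {κ : Type*} [Fintype κ] [DecidableEq κ] {a b : κ → P} {M : Matrix κ κ B}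
    (hM : HomMat ℬ a b M) {e : P} (he : ∑ i, a i - ∑ i, b i = e) : M.det ∈ ℬ e := by
  rw [Matrix.det_apply]
  refine sum_mem fun σ _ => ?_
  rw [Units.smul_def]
  refine zsmul_mem (prod_mem_of_eq _ (fun i _ => hM (σ i) i) ?_) _
  rw [Finset.sum_sub_distrib, Equiv.sum_comp σ a, he]

theorem GrLocal.exists_inv_one_add_matrix (h : GrLocal ℬ) {κ : Type*} [Fintype κ] [DecidableEq κ]
    {c : κ → P} {M : Matrix κ κ B} (hM : HomMat h.nonunits c c M) :
    ∃ V : Matrix κ κ B, HomMat ℬ c c V ∧ V * (1 + M) = 1 ∧ (1 + M) * V = 1 := by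
  have hG : HomMat ℬ c c (1 + M) := HomMat.one.add fun i j => h.idealFam.le _ (hM i j)
  have hdet : (1 + M).det - 1 ∈ h.nonunits 0 := by
    rw [Matrix.det_apply, ← Finset.add_sum_erase _ _ (Finset.mem_univ (1 : Equiv.Perm κ)),
      add_sub_right_comm]
    refine add_mem ?_ (sum_mem fun σ hσ => ?_)
    · simpa using h.idealFam.prod_one_add Finset.univ (x := fun i => M i i)
        fun i _ => by simpa using hM i i
    · rw [Units.smul_def]
      obtain ⟨i, hi⟩ : ∃ i, σ i ≠ i := by
        by_contra! h'
        exact Finset.ne_of_mem_erase hσ (Equiv.ext h')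
      refine zsmul_mem (h.idealFam.prod_mem _ (fun i _ => hG (σ i) i) ?_ (Finset.mem_univ i) ?_) _
      · rw [Finset.sum_sub_distrib, Equiv.sum_comp σ c, sub_self]
      · simpa [Matrix.one_apply_ne hi] using hM (σ i) i
  obtain ⟨v, hv, h1⟩ := h.exists_inv_one_add hdet
  rw [add_sub_cancel] at h1
  refine ⟨v • (1 + M).adjugate, fun i j => ?_, ?_, ?_⟩
  · rw [Matrix.smul_apply, smul_eq_mul, Matrix.adjugate_apply]
    refine mul_mem_of_eq hv (HomMat.det_mem (a := Function.update c j (c i)) (b := c)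
      (e := c i - c j) ?_ ?_) (by abel)
    · intro k m
      by_cases hk : k = j
      · subst hk
        rw [Matrix.updateRow_self, Function.update_self]
        by_cases hm : m = i
        · subst hm; simpa using one_mem_zero
        · simp [hm]
      · rw [Matrix.updateRow_ne hk, Function.update_of_ne hk]
        exact hG k m
    · rw [← Finset.add_sum_erase _ c (Finset.mem_univ j),
        ← Finset.add_sum_erase _ (Function.update c j (c i)) (Finset.mem_univ j),
        Function.update_self, Finset.sum_congr rfl fun k hk =>
          Function.update_of_ne (Finset.ne_of_mem_erase hk) (c i) c]
      abel
  · rw [Matrix.smul_mul, Matrix.adjugate_mul, smul_smul, mul_comm, h1, one_smul]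
  · rw [Matrix.mul_smul, Matrix.mul_adjugate, smul_smul, mul_comm, h1, one_smul]

variable {l d e : P}

theorem coeff_mem_of_mul {𝒩 : P → AddSubgroup B} (h𝒩 : IdealFam ℬ 𝒩) {f u : B[X]}
    (hf : f ∈ polyGrading ℬ l d)
    (hc : ∀ k y, f.leadingCoeff * y ∈ 𝒩 (d - f.natDegree • l + k) → y ∈ 𝒩 k) {D : ℕ}
    (hfu : ∀ n, D + f.natDegree ≤ n → (f * u).coeff n ∈ 𝒩 (d + e - n • l)) :
    ∀ n, D ≤ n → u.coeff n ∈ 𝒩 (e - n • l) := by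
  have key : ∀ k n, D ≤ n → u.natDegree < n + k → u.coeff n ∈ 𝒩 (e - n • l) := by
    intro k
    induction k with
    | zero =>
      intro n _ h1
      rw [coeff_eq_zero_of_natDegree_lt (by omega)]
      exact zero_mem _
    | succ k ih =>
      intro n hn h1
      refine hc _ _ ?_
      have h2 := hfu (f.natDegree + n) (by omega)
      rw [coeff_mul, ← Finset.add_sum_erase _ _
        (Finset.HasAntidiagonal.mem_antidiagonal.2 rfl :
          (f.natDegree, n) ∈ Finset.HasAntidiagonal.antidiagonal (f.natDegree + n))] at h2
      refine mem_congr ((add_mem_cancel_right (sum_mem fun p hp => ?_)).1 h2)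
        (by rw [add_smul]; abel)
      obtain ⟨hp, hp'⟩ := Finset.mem_erase.1 hp
      rw [Finset.HasAntidiagonal.mem_antidiagonal] at hp'
      rcases lt_or_ge f.natDegree p.1 with h3 | h3
      · rw [coeff_eq_zero_of_natDegree_lt h3, zero_mul]; exact zero_mem _
      · have h4 : n < p.2 := by
          rcases eq_or_lt_of_le h3 with h5 | h5
          · exact absurd (Prod.ext h5 (by omega)) hp
          · omega
        refine h𝒩.mul_mem (hf _) (ih p.2 (by omega) (by omega)) ?_
        rw [← hp', add_smul]; abel
  exact fun n hn => key (u.natDegree + 1) n hn (by omega)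

theorem GrLocal.exists_monic (h : GrLocal ℬ) {ρ : B[X]} (hρ : ρ ∈ polyGrading ℬ l e)
    (hρ' : ρ ∉ polyGrading h.nonunits l e) :
    ∃ g : B[X], g.Monic ∧ g.natDegree ≤ ρ.natDegree ∧ g ∈ polyGrading ℬ l (g.natDegree • l) ∧
      ∃ v ∈ ℬ (g.natDegree • l - e), C v * ρ - g ∈ polyGrading h.nonunits l (g.natDegree • l) := by
  have := nontrivial_of_ne _ _ h.1
  induction hn : ρ.support.card using Nat.strong_induction_on generalizing ρ with
  | _ n ih =>
    subst hn
    rcases h.mem_nonunits_or (hρ ρ.natDegree) with hc | ⟨v, hv, hcv⟩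
    · have h1 : monomial ρ.natDegree ρ.leadingCoeff ∈ polyGrading h.nonunits l e := by
        rw [← C_mul_X_pow_eq_monomial, mul_comm]
        exact X_pow_mul_mem _ (C_mem hc) (by abel)
      have h2 : ρ.eraseLead = ρ - monomial ρ.natDegree ρ.leadingCoeff :=
        (self_sub_monomial_natDegree_leadingCoeff ρ).symm
      have h3 : ρ.eraseLead ∈ polyGrading ℬ l e := by
        rw [h2]; exact sub_mem hρ ((h.idealFam.poly l).le _ h1)
      have h4 : ρ.eraseLead ∉ polyGrading h.nonunits l e := by
        rw [h2]; exact fun h' => hρ' (by simpa using add_mem h' h1)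
      obtain ⟨g, hg, hgd, hgm, v, hv, hvg⟩ := ih _
        (eraseLead_support_card_lt fun h0 => hρ' (h0 ▸ zero_mem _)) h3 h4 rfl
      refine ⟨g, hg, hgd.trans (eraseLead_natDegree_le_aux), hgm, v, hv, ?_⟩
      rw [h2] at hvg
      have := add_mem hvg ((h.idealFam.poly l).mul_mem (C_mem hv) h1 (sub_add_cancel _ _))
      convert this using 1; ring
    · have h1 : (C v * ρ).natDegree ≤ ρ.natDegree := natDegree_C_mul_le v ρ
      have h2 : (C v * ρ).coeff ρ.natDegree = 1 := by rw [coeff_C_mul, mul_comm, hcv]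
      have h3 : (C v * ρ).natDegree = ρ.natDegree :=
        natDegree_eq_of_le_of_coeff_ne_zero h1 (by rw [h2]; exact one_ne_zero)
      refine ⟨C v * ρ, monic_of_natDegree_le_of_coeff_eq_one _ h1 h2, h1, ?_, v, ?_, ?_⟩
      · rw [h3]; exact mul_mem_of_eq (C_mem hv) hρ (by abel)
      · rw [h3]; exact mem_congr hv (by abel)
      · rw [sub_self]; exact zero_mem _

end GrLocal

section Horrocks

variable {P : Type*} [AddCommGroup P] {B : Type*} [CommRing B] {ℬ : P → AddSubgroup B}
  [SetLike.GradedMonoid ℬ] {l : P} {ι : Type*} [Fintype ι] {a : ι → P} {d : P}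

/-- Over the residue graded field, the entries of a column have a monic greatest common divisor. -/
theorem GrLocal.exists_bezout (h : GrLocal ℬ) {σ : ι → B[X]}
    (hσ : ∀ i, σ i ∈ polyGrading ℬ l (a i - d)) :
    (∀ i, σ i ∈ polyGrading h.nonunits l (a i - d)) ∨
    ∃ (g : B[X]) (r τ : ι → B[X]), g.Monic ∧ g ∈ polyGrading ℬ l (g.natDegree • l) ∧
      (∀ i, r i ∈ polyGrading ℬ l (g.natDegree • l + d - a i)) ∧
      (∀ i, τ i ∈ polyGrading ℬ l (a i - d - g.natDegree • l)) ∧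
      (∑ i, r i * σ i - g ∈ polyGrading h.nonunits l (g.natDegree • l)) ∧
      ∀ i, σ i - g * τ i ∈ polyGrading h.nonunits l (a i - d) := by
  classical
  have hI := h.idealFam.poly l
  let S : ℕ → Prop := fun q => ∃ (g : B[X]) (r : ι → B[X]), g.natDegree = q ∧ g.Monic ∧
    g ∈ polyGrading ℬ l (g.natDegree • l) ∧
    (∀ i, r i ∈ polyGrading ℬ l (g.natDegree • l + d - a i)) ∧
    (∑ i, r i * σ i - g ∈ polyGrading h.nonunits l (g.natDegree • l))
  by_cases hall : ∀ i, σ i ∈ polyGrading h.nonunits l (a i - d)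
  · exact Or.inl hall
  right
  have hS : ∃ q, S q := by
    push Not at hall
    obtain ⟨i, hi⟩ := hall
    obtain ⟨g, hg, -, hgm, v, hv, hvg⟩ := h.exists_monic (hσ i) hi
    refine ⟨_, g, Pi.single i (C v), rfl, hg, hgm, fun k => ?_, ?_⟩
    · by_cases hk : k = i
      · subst hk
        rw [Pi.single_eq_same]
        exact C_mem (mem_congr hv (by abel))
      · rw [Pi.single_eq_of_ne hk]; exact zero_mem _
    · rwa [Finset.sum_eq_single i, Pi.single_eq_same]
      · intro k _ hk
        rw [Pi.single_eq_of_ne hk, zero_mul]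
      · simp
  obtain ⟨g, r, hq, hg, hgm, hr, hrg⟩ := Nat.find_spec hS
  have hdiv := fun i => exists_div (d := a i - d) IdealFam.refl hg hgm (fun n _ => hσ i n)
  choose τ hτ hτ' using hdiv
  refine ⟨g, r, τ, hg, hgm, hr, hτ, hrg, fun i => ?_⟩
  by_contra hi
  have hρ : σ i - g * τ i ∈ polyGrading ℬ l (a i - d) :=
    sub_mem (hσ i) (mul_mem_of_eq hgm (hτ i) (by abel))
  obtain ⟨g', hg', hgd', hgm', v, hv, hvg⟩ := h.exists_monic hρ hi
  have hne : σ i - g * τ i ≠ 0 := fun h0 => hi (h0 ▸ zero_mem _)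
  have hlt : (σ i - g * τ i).natDegree < g.natDegree := by
    by_contra! hle
    exact hne (leadingCoeff_eq_zero.1 (hτ' i _ hle))
  refine Nat.find_min hS (m := g'.natDegree) (by omega)
    ⟨g', fun k => (Pi.single i (C v) : ι → B[X]) k - C v * τ i * r k, rfl, hg', hgm',
      fun k => sub_mem ?_ ?_, ?_⟩
  · by_cases hk : k = i
    · subst hk
      rw [Pi.single_eq_same]
      exact C_mem (mem_congr hv (by abel))
    · rw [Pi.single_eq_of_ne hk]; exact zero_mem _
  · exact mul_mem_of_eq (mul_mem_of_eq (C_mem hv) (hτ i) rfl) (hr k) (by abel)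
  · have h1 : ∑ k, ((Pi.single i (C v) : ι → B[X]) k - C v * τ i * r k) * σ k =
        C v * σ i - C v * τ i * ∑ k, r k * σ k := by
      simp only [sub_mul, Finset.sum_sub_distrib, mul_assoc, Finset.mul_sum]
      congr 1
      rw [Finset.sum_eq_single i, Pi.single_eq_same]
      · intro k _ hk
        rw [Pi.single_eq_of_ne hk, zero_mul]
      · simp
    have h2 := sub_mem hvg (hI.mul_mem (mul_mem_of_eq (C_mem hv) (hτ i) rfl) hrg
      (f := g'.natDegree • l) (by abel))
    rw [h1]
    convert h2 using 1
    ring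

/-- A column which is unimodular modulo the maximal homogeneous ideal, and whose entries
generate an ideal containing a monic polynomial, is unimodular. -/
theorem GrLocal.exists_unimodular (h : GrLocal ℬ) {σ r y : ι → B[X]} {D : ℕ}
    (hσ : ∀ i, σ i ∈ polyGrading ℬ l (a i - d))
    (hr : ∀ i, r i ∈ polyGrading ℬ l (d - a i))
    (hy : ∀ i, y i ∈ polyGrading ℬ l (d - a i + D • l))
    (hD : (∑ i, y i * σ i).natDegree = D) (hm : (∑ i, y i * σ i).Monic)
    (hrσ : ∑ i, r i * σ i - 1 ∈ polyGrading h.nonunits l 0) :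
    ∃ w : ι → B[X], (∀ i, w i ∈ polyGrading ℬ l (d - a i)) ∧ ∑ i, w i * σ i = 1 := by
  have hI := h.idealFam.poly l
  set g := ∑ i, y i * σ i with hg
  set μ := ∑ i, r i * σ i - 1 with hμ
  rcases Nat.eq_zero_or_pos D with h0 | h0
  · subst h0
    exact ⟨y, fun i => mem_congr (hy i) (by simp), hm.natDegree_eq_zero.1 hD⟩
  have hgm : g ∈ polyGrading ℬ l (g.natDegree • l) := by
    rw [hD]; exact sum_mem fun i _ => mul_mem_of_eq (hy i) (hσ i) (by abel)
  have hdiv : ∀ i : Fin D, ∃ q ∈ polyGrading h.nonunits l ((i : ℕ) • l - D • l),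
      ∀ n, D ≤ n → (X ^ (i : ℕ) * μ - g * q).coeff n = 0 := by
    intro i
    have := exists_div (d := (i : ℕ) • l) h.idealFam hm hgm
      (f := X ^ (i : ℕ) * μ) fun n _ => X_pow_mul_mem _ hrσ (zero_add _) n
    rwa [hD] at this
  choose Q hQ hQ' using hdiv
  obtain ⟨V, hV, hVM, -⟩ := h.exists_inv_one_add_matrix (c := fun i : Fin D => (i : ℕ) • l)
    (M := Matrix.of fun i k => (X ^ (i : ℕ) * μ - g * Q i).coeff k) (by
      intro i k
      exact (sub_mem (X_pow_mul_mem _ hrσ (zero_add _))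
        (hI.mul_mem hgm (hQ i) (by rw [hD]; abel)) :
          (X ^ (i : ℕ) * μ - g * Q i) ∈ polyGrading h.nonunits l ((i : ℕ) • l)) k)
  set M : Matrix (Fin D) (Fin D) B := Matrix.of fun i k => (X ^ (i : ℕ) * μ - g * Q i).coeff k with hM
  have hMX : ∀ i : Fin D, ∑ k : Fin D, C ((1 + M) i k) * X ^ (k : ℕ) =
      X ^ (i : ℕ) * ∑ i, r i * σ i - g * Q i := by
    intro i
    have h1 : X ^ (i : ℕ) * μ - g * Q i = ∑ k : Fin D, C (M i k) * X ^ (k : ℕ) := by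
      simp only [hM, Matrix.of_apply]
      refine Eq.trans ?_ (Fin.sum_univ_eq_sum_range
        (fun k => C ((X ^ (i : ℕ) * μ - g * Q i).coeff k) * X ^ k) D).symm
      refine as_sum_range_C_mul_X_pow' _ ?_
      by_contra! hle
      have h2 : X ^ (i : ℕ) * μ - g * Q i = 0 := leadingCoeff_eq_zero.1 (hQ' i _ hle)
      rw [h2, natDegree_zero] at hle
      omega
    simp only [Matrix.add_apply, C_add, add_mul, Finset.sum_add_distrib, ← h1, hμ]
    rw [Finset.sum_eq_single i (by
      intro k _ hk; rw [Matrix.one_apply_ne hk.symm]; simp) (by simp), Matrix.one_apply_eq]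
    rw [C_1]
    ring
  let z : Fin D := ⟨0, h0⟩
  refine ⟨fun k => ∑ i, C (V z i) * (X ^ (i : ℕ) * r k - Q i * y k), fun k => ?_, ?_⟩
  · refine sum_mem fun i _ => mul_mem_of_eq (C_mem (hV z i)) (sub_mem (X_pow_mul_mem _ (hr k) rfl)
      (mul_mem_of_eq (hI.le _ (hQ i)) (hy k) ?_)) ?_
    · abel
    · simp [z]
  · calc ∑ k, (∑ i, C (V z i) * (X ^ (i : ℕ) * r k - Q i * y k)) * σ k
        = ∑ i, C (V z i) * (X ^ (i : ℕ) * ∑ k, r k * σ k - g * Q i) := by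
          simp only [Finset.sum_mul]
          rw [Finset.sum_comm]
          refine Finset.sum_congr rfl fun i _ => ?_
          simp only [hg, Finset.sum_mul, Finset.mul_sum, ← Finset.sum_sub_distrib]
          exact Finset.sum_congr rfl fun k _ => by ring
      _ = ∑ k : Fin D, C ((V * (1 + M)) z k) * X ^ (k : ℕ) := by
          simp only [← hMX]
          simp only [Matrix.mul_apply, map_sum, Finset.mul_sum, Finset.sum_mul, C_mul]
          rw [Finset.sum_comm]
          exact Finset.sum_congr rfl fun i _ => Finset.sum_congr rfl fun k _ => by ring
      _ = 1 := by
          rw [hVM, Finset.sum_eq_single z (by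
            intro k _ hk; rw [Matrix.one_apply_ne hk.symm]; simp) (by simp), Matrix.one_apply_eq]
          simp [z]

end Horrocks

section Horrocks

variable {P : Type*} [AddCommGroup P]

/-- The graded module defined by `E` is graded free up to multiplication by the element `f`,
which is homogeneous of degree `d`. -/
def FreeUpTo {A : Type*} [CommRing A] (𝒜 : P → AddSubgroup A) {ι : Type*} [Fintype ι] (a : ι → P)
    (E : Matrix ι ι A) (f : A) (d : P) : Prop :=
  ∃ (k : ℕ) (b : Fin k → P) (X : Matrix ι (Fin k) A) (Y : Matrix (Fin k) ι A),
    HomMat 𝒜 (fun i => a i + d) b X ∧ HomMat 𝒜 b a Y ∧ X * Y = f • E ∧ Y * X = f • 1 ∧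
    E * X = X ∧ Y * E = Y

variable {B : Type*} [CommRing B] {ℬ : P → AddSubgroup B}
  [SetLike.GradedMonoid ℬ] {l : P} {ι κ : Type*} [Fintype ι] [Fintype κ] [DecidableEq κ]
  {a : ι → P} {b : κ → P}

theorem coeff_mul_map_C {μ : Type*} (N : Matrix μ κ B[X]) (V : Matrix κ κ B) (i : μ) (j : κ) (n : ℕ) :
    ((N * V.map C) i j).coeff n = ∑ k, (N i k).coeff n * V k j := by
  simp [Matrix.mul_apply, finsetSum_coeff]

/-- If `Y * Z` is a monic matrix of degree `D + 1`, and a monic matrix of degree `D` exists modulo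
the maximal homogeneous ideal, then one exists. -/
theorem GrLocal.exists_lift_monic (h : GrLocal ℬ) {E : Matrix ι ι B[X]} {Y : Matrix κ ι B[X]}
    {D : ℕ} {Z₁ Z' : Matrix ι κ B[X]} (hY : HomMat (polyGrading ℬ l) b a Y)
    (hZ₁ : HomMat (polyGrading ℬ l) a (fun j => b j - (D + 1) • l) Z₁) (hE₁ : E * Z₁ = Z₁)
    (hYZ₁ : ∀ n, D + 1 ≤ n → ∀ i j,
      ((Y * Z₁) i j).coeff n = if n = D + 1 ∧ i = j then 1 else 0)
    (hZ' : HomMat (polyGrading ℬ l) a (fun j => b j - D • l) Z') (hE' : E * Z' = Z')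
    (hYZ' : ∀ n, D ≤ n → ∀ i j, ((Y * Z') i j).coeff n - (if n = D ∧ i = j then 1 else 0) ∈
      h.nonunits (b i - (b j - D • l) - n • l)) :
    ∃ Z : Matrix ι κ B[X], HomMat (polyGrading ℬ l) a (fun j => b j - D • l) Z ∧ E * Z = Z ∧
      ∀ n, D ≤ n → ∀ i j, ((Y * Z) i j).coeff n = if n = D ∧ i = j then 1 else 0 := by
  have hI := h.idealFam.poly l
  have hdiv : ∀ j : κ, ∃ Q : κ → B[X],
      (∀ i, Q i ∈ polyGrading h.nonunits l (b i - (b j - D • l) - (D + 1) • l)) ∧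
      ∀ i n, D + 1 ≤ n → ((Y * Z') i j - (Y * Z₁).mulVec Q i).coeff n = 0 := fun j =>
    exists_matrix_div (V := fun i => (Y * Z') i j) h.idealFam (hY.mul hZ₁) hYZ₁ fun i n hn => by
      have := hYZ' n (by omega) i j
      rwa [if_neg (by omega), sub_zero] at this
  choose Q hQ hQ' using hdiv
  let q : Matrix κ κ B[X] := Matrix.of fun i j => Q j i
  have hq : HomMat (polyGrading h.nonunits l) (fun j => b j - (D + 1) • l) (fun j => b j - D • l) q :=
    fun i j => mem_congr (hQ j i) (by dsimp only; abel)
  have hSq : HomMat (polyGrading h.nonunits l) b (fun j => b j - D • l) (Y * Z₁ * q) :=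
    hI.matrix_mul (hY.mul hZ₁) hq
  have hYW : Y * (Z' - Z₁ * q) = Y * Z' - Y * Z₁ * q := by rw [Matrix.mul_sub, Matrix.mul_assoc]
  have hYW0 : ∀ n, D + 1 ≤ n → ∀ i j, ((Y * (Z' - Z₁ * q)) i j).coeff n = 0 := by
    intro n hn i j
    rw [hYW]
    exact hQ' j i n hn
  let M : Matrix κ κ B := Matrix.of fun i j => ((Y * (Z' - Z₁ * q)) i j).coeff D - (1 : Matrix κ κ B) i j
  obtain ⟨V, hV, -, hV1⟩ := h.exists_inv_one_add_matrix (c := b) (M := M) (by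
    intro i j
    have h1 := sub_mem (hYZ' D le_rfl i j) (hSq i j D)
    refine mem_congr (x := M i j) ?_ (by abel : b i - (b j - D • l) - D • l = b i - b j)
    convert h1 using 1
    simp only [M, Matrix.of_apply, hYW, Matrix.sub_apply, coeff_sub, Matrix.one_apply, true_and]
    ring)
  have hVC : HomMat (polyGrading ℬ l) (fun j => b j - D • l) (fun j => b j - D • l) (V.map C) :=
    fun i j => C_mem (mem_congr (hV i j) (by dsimp only; abel))
  refine ⟨(Z' - Z₁ * q) * V.map C, HomMat.mul (hZ'.sub (hZ₁.mul fun i j => hI.le _ (hq i j))) hVC,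
    ?_, ?_⟩
  · rw [← Matrix.mul_assoc, Matrix.mul_sub, hE', ← Matrix.mul_assoc, hE₁]
  · intro n hn i j
    rw [← Matrix.mul_assoc, coeff_mul_map_C]
    rcases eq_or_lt_of_le hn with rfl | hn
    · have h1 : ∀ k, ((Y * (Z' - Z₁ * q)) i k).coeff D = (1 + M) i k := by
        intro k; simp [M]
      simp only [h1, ← Matrix.mul_apply, hV1, Matrix.one_apply, true_and]
    · rw [Finset.sum_eq_zero fun k _ => by rw [hYW0 n hn, zero_mul], if_neg (by omega)]

/-- Dividing the columns of `Z` by homogeneous monic polynomials of positive degree yields a monic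
matrix of smaller degree, modulo the maximal homogeneous ideal. -/
theorem GrLocal.exists_monic_mod (h : GrLocal ℬ) {E : Matrix ι ι B[X]} {Y : Matrix κ ι B[X]}
    {D : ℕ} {Z : Matrix ι κ B[X]} (hE : HomMat (polyGrading ℬ l) a a E) (hE2 : E * E = E)
    (hY : HomMat (polyGrading ℬ l) b a Y) (hYE : Y * E = Y)
    (hYZ : ∀ n, D + 1 ≤ n → ∀ i j,
      ((Y * Z) i j).coeff n = if n = D + 1 ∧ i = j then 1 else 0)
    (hg : ∀ j, ∃ (g : B[X]) (τ : ι → B[X]), g.Monic ∧ 0 < g.natDegree ∧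
      g ∈ polyGrading ℬ l (g.natDegree • l) ∧
      (∀ i, τ i ∈ polyGrading ℬ l (a i - (b j - (D + 1) • l) - g.natDegree • l)) ∧
      ∀ i, Z i j - g * τ i ∈ polyGrading h.nonunits l (a i - (b j - (D + 1) • l))) :
    ∃ Z' : Matrix ι κ B[X], HomMat (polyGrading ℬ l) a (fun j => b j - D • l) Z' ∧ E * Z' = Z' ∧
      ∀ n, D ≤ n → ∀ i j, ((Y * Z') i j).coeff n - (if n = D ∧ i = j then 1 else 0) ∈
      h.nonunits (b i - (b j - D • l) - n • l) := by
  have hI := h.idealFam.poly l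
  choose g τ hg hg0 hgm hτ hτ' using hg
  let Z₀ : Matrix ι κ B[X] := Matrix.of fun i j => X ^ ((g j).natDegree - 1) * τ j i
  have hdeg : ∀ j, (g j).natDegree • l = ((g j).natDegree - 1) • l + l := fun j => by
    rw [← succ_nsmul, Nat.sub_add_cancel (hg0 j)]
  have hZ₀ : HomMat (polyGrading ℬ l) a (fun j => b j - D • l) Z₀ := fun i j =>
    X_pow_mul_mem _ (hτ j i) (by rw [hdeg, add_smul]; simp only [one_smul]; abel)
  refine ⟨E * Z₀, hE.mul hZ₀, by rw [← Matrix.mul_assoc, hE2], fun n hn i j => ?_⟩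
  rw [← Matrix.mul_assoc, hYE]
  have h1 : g j * (Y * Z₀) i j - X ^ ((g j).natDegree - 1) * (Y * Z) i j ∈
      polyGrading h.nonunits l (b i - (b j - D • l) + (g j).natDegree • l) := by
    have : g j * (Y * Z₀) i j - X ^ ((g j).natDegree - 1) * (Y * Z) i j =
        ∑ k, X ^ ((g j).natDegree - 1) * (Y i k * -(Z k j - g j * τ j k)) := by
      simp only [Matrix.mul_apply, Finset.mul_sum, ← Finset.sum_sub_distrib, Z₀, Matrix.of_apply]
      exact Finset.sum_congr rfl fun k _ => by ring
    rw [this]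
    refine sum_mem fun k _ => X_pow_mul_mem _ (hI.mul_mem (hY i k) (neg_mem (hτ' j k)) rfl) ?_
    rw [hdeg, add_smul]; simp only [one_smul]; abel
  have h2 : (if n = D ∧ i = j then 1 else 0 : B) = (if i = j then X ^ D else 0 : B[X]).coeff n := by
    split_ifs <;> simp_all
  rw [h2, ← coeff_sub]
  refine coeff_mem_of_mul (D := D) h.idealFam (hgm j)
    (fun k y hy => by simpa [(hg j).leadingCoeff] using hy)
    (fun n hn => ?_) n hn
  have h3 : (g j * ((Y * Z₀) i j - if i = j then X ^ D else 0)).coeff n =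
      (g j * (Y * Z₀) i j - X ^ ((g j).natDegree - 1) * (Y * Z) i j).coeff n := by
    rw [mul_sub, coeff_sub, coeff_sub]
    congr 1
    obtain ⟨m, rfl⟩ := Nat.exists_eq_add_of_le hn
    rw [(by have := hg0 j; omega : D + (g j).natDegree + m = (m + D + 1) + ((g j).natDegree - 1)),
      mul_comm (X ^ ((g j).natDegree - 1)), coeff_mul_X_pow, hYZ _ (by omega)]
    have := hg0 j
    rw [mul_ite, mul_zero]
    by_cases hij : i = j
    · rw [if_pos hij, (by omega : (m + D + 1) + ((g j).natDegree - 1) = (g j).natDegree + m + D),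
        coeff_mul_X_pow]
      rcases Nat.eq_zero_or_pos m with rfl | hm
      · simp [(hg j).leadingCoeff, hij]
      · rw [coeff_eq_zero_of_natDegree_lt (by omega), if_neg (by omega)]
    · simp [hij]
  rw [h3]
  exact mem_congr (h1 n) (by abel)

theorem _root_.Polynomial.Monic.smul_matrix_injective {μ ν : Type*} {f : B[X]} (hf : f.Monic)
    {X Y : Matrix μ ν B[X]} (h : f • X = f • Y) : X = Y := by
  ext1 i j
  exact hf.isRegular.left (congrFun (congrFun h i) j)

end Horrocks

section Horrocks

variable {P : Type*} [AddCommGroup P] {B : Type*} [CommRing B] {ℬ : P → AddSubgroup B}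
  [SetLike.GradedMonoid ℬ] {l : P} {ι κ : Type*} [Fintype ι] [Fintype κ] [DecidableEq κ]
  {a : ι → P} {b : κ → P}

/-- If the monic matrix `Y * Z` has minimal degree, then some column of `Z` is unimodular. -/
theorem GrLocal.exists_unimodular_column (h : GrLocal ℬ) {E : Matrix ι ι B[X]}
    {Y : Matrix κ ι B[X]} {D : ℕ} {Z : Matrix ι κ B[X]}
    (hE : HomMat (polyGrading ℬ l) a a E) (hE2 : E * E = E)
    (hY : HomMat (polyGrading ℬ l) b a Y) (hYE : Y * E = Y)
    (hZ : HomMat (polyGrading ℬ l) a (fun j => b j - (D + 1) • l) Z) (hEZ : E * Z = Z)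
    (hYZ : ∀ n, D + 1 ≤ n → ∀ i j,
      ((Y * Z) i j).coeff n = if n = D + 1 ∧ i = j then 1 else 0)
    (hmin : ¬ ∃ Z : Matrix ι κ B[X], HomMat (polyGrading ℬ l) a (fun j => b j - D • l) Z ∧
      E * Z = Z ∧ ∀ n, D ≤ n → ∀ i j, ((Y * Z) i j).coeff n = if n = D ∧ i = j then 1 else 0) :
    ∃ (j : κ) (w : ι → B[X]), (∀ i, w i ∈ polyGrading ℬ l (b j - (D + 1) • l - a i)) ∧
      ∑ i, w i * Z i j = 1 := by
  have := nontrivial_of_ne _ _ h.1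
  have hI := h.idealFam.poly l
  have hmon : ∀ j, ((Y * Z) j j).natDegree = D + 1 ∧ ((Y * Z) j j).Monic := by
    intro j
    have h1 : ((Y * Z) j j).natDegree ≤ D + 1 := natDegree_le_iff_coeff_eq_zero.2 fun n hn => by
      rw [hYZ n hn.le, if_neg (by omega)]
    have h2 : ((Y * Z) j j).coeff (D + 1) = 1 := by simp [hYZ _ le_rfl]
    exact ⟨natDegree_eq_of_le_of_coeff_ne_zero h1 (by rw [h2]; exact one_ne_zero),
      monic_of_natDegree_le_of_coeff_eq_one _ h1 h2⟩
  have hbez := fun j => h.exists_bezout (d := b j - (D + 1) • l) (fun i => hZ i j)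
  have hnot : ∀ j, ¬ ∀ i, Z i j ∈ polyGrading h.nonunits l (a i - (b j - (D + 1) • l)) := by
    intro j hj
    have h1 : (Y * Z) j j ∈ polyGrading h.nonunits l (b j - (b j - (D + 1) • l)) := by
      rw [Matrix.mul_apply]
      exact sum_mem fun i _ => hI.mul_mem (hY j i) (hj i) (by abel)
    have h2 := h1 (D + 1)
    rw [hYZ _ le_rfl, if_pos ⟨rfl, rfl⟩] at h2
    exact h.one_notMem (mem_congr h2 (by abel))
  by_contra hcon
  refine hmin ?_
  have hmod := h.exists_monic_mod hE hE2 hY hYE hYZ ?_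
  · obtain ⟨Z', hZ', hE', hYZ'⟩ := hmod
    exact h.exists_lift_monic hY hZ hEZ hYZ hZ' hE' hYZ'
  intro j
  obtain ⟨g, r, τ, hg, hgm, hr, hτ, hrg, hτ'⟩ := (hbez j).resolve_left (hnot j)
  refine ⟨g, τ, hg, Nat.pos_of_ne_zero fun h0 => hcon ⟨j, ?_⟩, hgm, hτ, hτ'⟩
  rw [h0] at hr hrg
  rw [hg.natDegree_eq_zero.1 h0] at hrg
  refine h.exists_unimodular (y := fun i => Y j i) (D := D + 1) (fun i => hZ i j)
    (fun i => mem_congr (hr i) (by rw [zero_smul, zero_add])) (fun i => mem_congr (hY j i) (by abel))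
    ?_ ?_ (mem_congr hrg (zero_smul ..))
  · rw [← Matrix.mul_apply]; exact (hmon j).1
  · rw [← Matrix.mul_apply]; exact (hmon j).2

theorem GrLocal.horrocks_aux (h : GrLocal ℬ) {ι : Type*} [Fintype ι] [DecidableEq ι] {a : ι → P}
    {E : Matrix ι ι B[X]}  (k : ℕ) {b : Fin k → P} {f : B[X]} {X : Matrix ι (Fin k) B[X]}
    {Y : Matrix (Fin k) ι B[X]} (hE : HomMat (polyGrading ℬ l) a a E) (hE2 : E * E = E)
    (hf : f.Monic) (hfm : f ∈ polyGrading ℬ l (f.natDegree • l))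
    (hX : HomMat (polyGrading ℬ l) (fun i => a i + f.natDegree • l) b X)
    (hY : HomMat (polyGrading ℬ l) b a Y) (hXY : X * Y = f • E) (hYX : Y * X = f • 1)
    (hEX : E * X = X) (hYE : Y * E = Y) : GrFree (polyGrading ℬ l) a E := by
  have := nontrivial_of_ne _ _ h.1
  induction k generalizing E f with
  | zero =>
    refine ⟨0, b, 0, 0, HomMat.zero, HomMat.zero, ?_, Subsingleton.elim _ _⟩
    refine hf.smul_matrix_injective ?_
    rw [← hXY]
    ext1 i j
    simp [Matrix.mul_apply]
  | succ k ih =>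
    have hP : ∃ D, ∃ Z : Matrix ι (Fin (k + 1)) B[X],
        HomMat (polyGrading ℬ l) a (fun j => b j - D • l) Z ∧ E * Z = Z ∧
        ∀ n, D ≤ n → ∀ i j, ((Y * Z) i j).coeff n = if n = D ∧ i = j then 1 else 0 := by
      refine ⟨f.natDegree, X, fun i j => mem_congr (hX i j) (by dsimp only; abel), hEX, fun n hn i j => ?_⟩
      rw [hYX, Matrix.smul_apply, Matrix.one_apply]
      rcases eq_or_lt_of_le hn with rfl | hn
      · by_cases hij : i = j <;> simp [hij, hf.leadingCoeff]
      · rw [if_neg (by omega : ¬ (n = f.natDegree ∧ i = j)), smul_eq_mul]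
        by_cases hij : i = j <;> simp [hij, coeff_eq_zero_of_natDegree_lt hn]
    classical
    obtain ⟨Z, hZ, hEZ, hYZ⟩ := Nat.find_spec hP
    rcases hD : Nat.find hP with _ | D
    · rw [hD] at hZ hYZ
      have h1 : Y * Z = 1 := by
        ext i j n
        rw [hYZ n (by omega)]
        by_cases hij : i = j
        · subst hij; simp [coeff_one]
        · simp [hij]
      refine ⟨k + 1, b, Z, Y, fun i j => mem_congr (hZ i j) (by simp), hY, ?_, h1⟩
      refine hf.smul_matrix_injective ?_
      calc f • (Z * Y) = (f • E) * Z * Y := by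
            rw [Matrix.smul_mul, hEZ, Matrix.smul_mul]
        _ = X * (Y * Z) * Y := by rw [← hXY]; simp only [Matrix.mul_assoc]
        _ = f • E := by rw [h1, Matrix.mul_one, hXY]
    · have hmin := Nat.find_min hP (m := D) (by omega)
      rw [hD] at hZ hYZ
      obtain ⟨j, w, hw, hwZ⟩ := h.exists_unimodular_column hE hE2 hY hYE hZ hEZ hYZ hmin
      let σ : Matrix ι Unit B[X] := Z.submatrix id fun _ => j
      let v : Matrix Unit ι B[X] := Matrix.of (fun _ => w) * E
      have hσ : HomMat (polyGrading ℬ l) a (fun _ => b j - (D + 1) • l) σ := fun i _ => hZ i j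
      have hv : HomMat (polyGrading ℬ l) (fun _ => b j - (D + 1) • l) a v :=
        HomMat.mul (fun _ i => hw i) hE
      have hEσ : E * σ = σ := by
        conv_rhs => rw [show σ = (E * Z).submatrix id fun _ => j by rw [hEZ]]
        rfl
      have hvE : v * E = v := by simp only [v, Matrix.mul_assoc, hE2]
      have hvσ : v * σ = 1 := by
        simp only [v, Matrix.mul_assoc, hEσ]
        ext i j
        simpa [Matrix.mul_apply, σ] using congrArg (fun p => coeff p _) hwZ
      clear_value v
      refine GrFree.of_rank_one hE2 hσ hv hEσ hvE hvσ ?_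
      have hgdeg : ((Y * Z) j j).natDegree ≤ D + 1 := natDegree_le_iff_coeff_eq_zero.2 fun n hn => by
        rw [hYZ n hn.le, if_neg (by omega)]
      have hgc : ((Y * Z) j j).coeff (D + 1) = 1 := by simp [hYZ _ le_rfl]
      have hg := monic_of_natDegree_le_of_coeff_eq_one _ hgdeg hgc
      replace hgdeg : ((Y * Z) j j).natDegree = D + 1 :=
        natDegree_eq_of_le_of_coeff_ne_zero hgdeg (by rw [hgc]; exact one_ne_zero)
      have hgm : (Y * Z) j j ∈ polyGrading ℬ l ((D + 1) • l) :=
        mem_congr ((hY.mul hZ) j j) (by abel)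
      set g := (Y * Z) j j with hgdef
      let Yj : Matrix Unit ι B[X] := Y.submatrix (fun _ => j) id
      have hYjσ : Yj * σ = g • 1 := by
        ext1 i k
        simp only [Matrix.smul_apply, Matrix.one_apply_eq, smul_eq_mul, mul_one]
        rfl
      have hYjX : Yj * X = (f • 1 : Matrix (Fin (k + 1)) (Fin (k + 1)) B[X]).submatrix
          (fun _ => j) id := by rw [← hYX]; rfl
      let Y₁ : Matrix (Fin (k + 1)) ι B[X] := g • Y - (Y * σ) * Yj
      have hY₁j : ∀ i, Y₁ j i = 0 := fun i => by
        have : ((Y * σ) * Yj) j i = (Y * Z) j j * Y j i := by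
          rw [Matrix.mul_apply, Fintype.sum_unique]; rfl
        change (g • Y - (Y * σ) * Yj) j i = 0
        rw [Matrix.sub_apply, this, Matrix.smul_apply, smul_eq_mul, sub_self]
      have hE'σ : (E - σ * v) * σ = 0 := by
        rw [Matrix.sub_mul, hEσ, Matrix.mul_assoc, hvσ, Matrix.mul_one, sub_self]
      have hE'E : (E - σ * v) * E = E - σ * v := by
        rw [Matrix.sub_mul, hE2, Matrix.mul_assoc, hvE]
      have hEE' : E * (E - σ * v) = E - σ * v := by
        rw [Matrix.mul_sub, hE2, ← Matrix.mul_assoc, hEσ]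
      have hE'2 : (E - σ * v) * (E - σ * v) = E - σ * v := by
        rw [Matrix.mul_sub, hE'E, ← Matrix.mul_assoc, hE'σ, Matrix.zero_mul, sub_zero]
      have hE' : HomMat (polyGrading ℬ l) a a (E - σ * v) := hE.sub (hσ.mul hv)
      have hY₁σ : Y₁ * σ = 0 := by
        rw [Matrix.sub_mul, Matrix.mul_assoc, hYjσ, Matrix.smul_mul, Matrix.mul_smul,
          Matrix.mul_one, sub_self]
      have hY₁E : Y₁ * E = Y₁ := by
        rw [Matrix.sub_mul, Matrix.smul_mul, hYE, Matrix.mul_assoc]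
        congr 2
        change (Y * E).submatrix (fun _ => j) id = _
        rw [hYE]
      have hY₁E' : Y₁ * (E - σ * v) = Y₁ := by
        rw [Matrix.mul_sub, hY₁E, ← Matrix.mul_assoc, hY₁σ, Matrix.zero_mul, sub_zero]
      have hE'XY₁ : (E - σ * v) * X * Y₁ = (f * g) • (E - σ * v) := by
        have h1 : X * Y₁ = (f * g) • E - f • (σ * Yj) := by
          rw [Matrix.mul_sub, Matrix.mul_smul, hXY, ← Matrix.mul_assoc, ← Matrix.mul_assoc, hXY,
            Matrix.smul_mul, hEσ, Matrix.smul_mul, smul_smul, mul_comm]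
        rw [Matrix.mul_assoc, h1, Matrix.mul_sub, Matrix.mul_smul, hE'E, Matrix.mul_smul,
          ← Matrix.mul_assoc, hE'σ, Matrix.zero_mul, smul_zero, sub_zero]
      have hfg : (f * g).natDegree = f.natDegree + (D + 1) := by
        rw [hf.natDegree_mul hg, hgdeg]
      refine ih (f := f * g) (b := fun i => b (j.succAbove i) + (D + 1) • l)
        (X := ((E - σ * v) * X).submatrix id j.succAbove) (Y := Y₁.submatrix j.succAbove id)
        hE' hE'2 (hf.mul hg) ?_ ?_ ?_ ?_ ?_ ?_ ?_
      · rw [hfg]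
        exact mul_mem_of_eq hfm hgm (add_smul ..).symm
      · intro i m
        rw [hfg]
        have hX' : HomMat (polyGrading ℬ l) a (fun i => b i - f.natDegree • l) X := fun i j =>
          mem_congr (hX i j) (by dsimp only; abel)
        exact mem_congr ((hE'.mul hX') i (j.succAbove m)) (by
          simp only [add_smul]; abel)
      · intro i m
        refine sub_mem (mul_mem_of_eq hgm (hY _ m) (by dsimp only; abel)) ?_
        have hYj : HomMat (polyGrading ℬ l) (fun _ => b j) a Yj := fun _ m => hY j m
        have hσ' : HomMat (polyGrading ℬ l) (fun i => a i + (D + 1) • l) (fun _ => b j) σ :=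
          fun i m => mem_congr (hσ i m) (by dsimp only; abel)
        have hY' : HomMat (polyGrading ℬ l) (fun i => b i + (D + 1) • l)
          (fun i => a i + (D + 1) • l) Y := fun i m => mem_congr (hY i m) (by dsimp only; abel)
        exact ((hY'.mul hσ').mul hYj) (j.succAbove i) m
      · rw [← hE'XY₁]
        ext1 i m
        simp only [Matrix.mul_apply (M := (E - σ * v) * X), Fin.sum_univ_succAbove _ j, hY₁j,
          mul_zero, zero_add]
        rfl
      · change (Y₁ * ((E - σ * v) * X)).submatrix j.succAbove j.succAbove = _
        rw [← Matrix.mul_assoc, hY₁E']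
        ext1 i m
        have h1 : Y₁ * X = (f * g) • 1 - Y * σ * (Yj * X) := by
          rw [Matrix.sub_mul, Matrix.smul_mul, hYX, smul_smul, mul_comm, Matrix.mul_assoc (Y * σ)]
        have h2 : (Y * σ * (Yj * X)) (j.succAbove i) (j.succAbove m) = 0 := by
          rw [hYjX, Matrix.mul_apply, Fintype.sum_unique, Matrix.submatrix_apply, Matrix.smul_apply,
            id, Matrix.one_apply_ne (Fin.succAbove_ne j m).symm, smul_zero, mul_zero]
        rw [Matrix.submatrix_apply, h1, Matrix.sub_apply, h2, sub_zero, Matrix.smul_apply,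
          Matrix.smul_apply, Matrix.one_apply, Matrix.one_apply]
        simp
      · change ((E - σ * v) * ((E - σ * v) * X)).submatrix id j.succAbove = _
        rw [← Matrix.mul_assoc, hE'2]
      · change (Y₁ * (E - σ * v)).submatrix j.succAbove id = _
        rw [hY₁E']

/-- Horrocks' theorem over a graded local ring. -/
theorem GrLocal.horrocks (h : GrLocal ℬ) {ι : Type*} [Fintype ι] [DecidableEq ι] {a : ι → P}
    {E : Matrix ι ι B[X]} (hE : HomMat (polyGrading ℬ l) a a E) (hE2 : E * E = E) {f : B[X]}
    (hf : f.Monic) (hfm : f ∈ polyGrading ℬ l (f.natDegree • l))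
    (hfree : FreeUpTo (polyGrading ℬ l) a E f (f.natDegree • l)) :
    GrFree (polyGrading ℬ l) a E := by
  obtain ⟨k, b, X, Y, hX, hY, hXY, hYX, hEX, hYE⟩ := hfree
  exact h.horrocks_aux k hE hE2 hf hfm hX hY hXY hYX hEX hYE

end Horrocks

section Denominators

variable {P : Type*} [AddCommGroup P] {A : Type*} [CommRing A]

/-- `S` is a multiplicative set of homogeneous elements, with degrees given by `δ`. -/
structure GrDenom (𝒜 : P → AddSubgroup A) (S : Submonoid A) (δ : A → P) : Prop where
  mem : ∀ s ∈ S, s ∈ 𝒜 (δ s)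
  mul : ∀ s ∈ S, ∀ t ∈ S, δ (s * t) = δ s + δ t

variable {𝒜 : P → AddSubgroup A} {S : Submonoid A} {δ : A → P}

theorem GrDenom.one (h : GrDenom 𝒜 S δ) : δ 1 = 0 := by
  simpa using h.mul 1 S.one_mem 1 S.one_mem

/-- Every homogeneous element of `D` becomes, after multiplication by a denominator in `S`, the
image of a homogeneous element of `C`. -/
structure HasDenom {C D : Type*} [CommRing C] [CommRing D] (S : Submonoid A) (δ : A → P)
    (j : A →+* C) (ψ : C →+* D) (𝒞 : P → AddSubgroup C) (𝒟 : P → AddSubgroup D) : Prop where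
  exists_mul : ∀ d, ∀ z ∈ 𝒟 d, ∃ s ∈ S, ∃ c ∈ 𝒞 (d + δ s), ψ (j s) * z = ψ c

variable {C' D : Type*} [CommRing C'] [CommRing D] {j : A →+* C'} {ψ : C' →+* D}
  {𝒞 : P → AddSubgroup C'} {𝒟 : P → AddSubgroup D}

theorem HasDenom.exists_family [SetLike.GradedMonoid 𝒞] (h : HasDenom S δ j ψ 𝒞 𝒟)
    (hS : GrDenom 𝒜 S δ) (hj : ∀ d, ∀ x ∈ 𝒜 d, j x ∈ 𝒞 d) {ι : Type*} (T : Finset ι) {d : ι → P}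
    {z : ι → D} (hz : ∀ i ∈ T, z i ∈ 𝒟 (d i)) :
    ∃ s ∈ S, ∃ c : ι → C', (∀ i ∈ T, c i ∈ 𝒞 (d i + δ s)) ∧ ∀ i ∈ T, ψ (j s) * z i = ψ (c i) := by
  classical
  have : ∀ i, ∃ s ∈ S, ∃ c, i ∈ T → c ∈ 𝒞 (d i + δ s) ∧ ψ (j s) * z i = ψ c := fun i => by
    by_cases hi : i ∈ T
    · obtain ⟨s, hs, c, hc, e⟩ := h.exists_mul _ _ (hz i hi)
      exact ⟨s, hs, c, fun _ => ⟨hc, e⟩⟩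
    · exact ⟨1, S.one_mem, 0, fun h => absurd h hi⟩
  choose s hs c hc using this
  refine ⟨∏ i ∈ T, s i, S.prod_mem fun i _ => hs i,
    fun i => j (∏ k ∈ T.erase i, s k) * c i, fun i hi => ?_, fun i hi => ?_⟩
  · refine mul_mem_of_eq (hj _ _ (hS.mem _ (S.prod_mem fun i _ => hs i))) (hc i hi).1 ?_
    rw [← Finset.mul_prod_erase T s hi, hS.mul _ (hs i) _ (S.prod_mem fun i _ => hs i)]
    abel
  · rw [← Finset.mul_prod_erase T s hi, map_mul, map_mul, map_mul, ← (hc i hi).2]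
    ring

theorem HasDenom.exists_matrix [SetLike.GradedMonoid 𝒞] (h : HasDenom S δ j ψ 𝒞 𝒟)
    (hS : GrDenom 𝒜 S δ) (hj : ∀ d, ∀ x ∈ 𝒜 d, j x ∈ 𝒞 d) {ι κ : Type*} [Fintype ι] [Fintype κ]
    {a : ι → P} {b : κ → P} {X : Matrix ι κ D} (hX : HomMat 𝒟 a b X) :
    ∃ s ∈ S, ∃ X' : Matrix ι κ C', HomMat 𝒞 (fun i => a i + δ s) b X' ∧
      ψ (j s) • X = X'.map ψ := by
  obtain ⟨s, hs, c, hc, e⟩ := h.exists_family hS hj (Finset.univ : Finset (ι × κ))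
    (d := fun p => a p.1 - b p.2) (z := fun p => X p.1 p.2) (fun p _ => hX p.1 p.2)
  refine ⟨s, hs, Matrix.of fun i k => c (i, k), fun i k => ?_, ?_⟩
  · exact mem_congr (hc (i, k) (Finset.mem_univ _)) (by dsimp only; abel)
  · ext i k
    exact e (i, k) (Finset.mem_univ _)

theorem HasDenom.polynomial [SetLike.GradedMonoid 𝒞] (h : HasDenom S δ j ψ 𝒞 𝒟)
    (hS : GrDenom 𝒜 S δ) (hj : ∀ d, ∀ x ∈ 𝒜 d, j x ∈ 𝒞 d) (l : P) :
    HasDenom S δ (C.comp j) (mapRingHom ψ) (polyGrading 𝒞 l) (polyGrading 𝒟 l) where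
  exists_mul d z hz := by
    obtain ⟨s, hs, c, hc, e⟩ := h.exists_family hS hj z.support
      (d := fun i => d - i • l) (z := z.coeff) (fun i _ => hz i)
    have hco : ∀ i, (∑ i ∈ z.support, monomial i (c i)).coeff i =
        if i ∈ z.support then c i else 0 := fun i => by
      simp [finsetSum_coeff, coeff_monomial]
    refine ⟨s, hs, ∑ i ∈ z.support, monomial i (c i), fun i => ?_, ?_⟩
    · rw [hco]
      split_ifs with hi
      · exact mem_congr (hc i hi) (by abel)
      · exact zero_mem _
    · ext i
      rw [coe_mapRingHom, coeff_map, hco, RingHom.comp_apply, Polynomial.map_C, coeff_C_mul]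
      split_ifs with hi
      · exact e i hi
      · rw [notMem_support_iff.1 hi, mul_zero, map_zero]

variable [SetLike.GradedMonoid 𝒜]

/-- The grading of the localization of `A` at `S`. -/
def locGrading (B : Type*) [CommRing B] [Algebra A B] (h : GrDenom 𝒜 S δ) (d : P) :
    AddSubgroup B where
  carrier := {x | ∃ s ∈ S, ∃ a ∈ 𝒜 (d + δ s), algebraMap A B s * x = algebraMap A B a}
  zero_mem' := ⟨1, S.one_mem, 0, zero_mem _, by simp⟩
  add_mem' := by
    rintro x y ⟨s, hs, a, ha, e⟩ ⟨t, ht, b, hb, e'⟩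
    refine ⟨s * t, S.mul_mem hs ht, t * a + s * b, ?_, ?_⟩
    · rw [h.mul _ hs _ ht]
      exact add_mem (mul_mem_of_eq (h.mem _ ht) ha (by abel)) (mul_mem_of_eq (h.mem _ hs) hb (by abel))
    · rw [map_add, map_mul, map_mul, map_mul, ← e, ← e']
      ring
  neg_mem' := by
    rintro x ⟨s, hs, a, ha, e⟩
    exact ⟨s, hs, -a, neg_mem ha, by rw [mul_neg, e, map_neg]⟩

variable {B : Type*} [CommRing B] [Algebra A B]

instance locGrading.gradedMonoid (h : GrDenom 𝒜 S δ) : SetLike.GradedMonoid (locGrading B h) where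
  one_mem := ⟨1, S.one_mem, 1, mem_congr one_mem_zero (by rw [h.one, add_zero]), by simp⟩
  mul_mem := by
    rintro d e x y ⟨s, hs, a, ha, e1⟩ ⟨t, ht, b, hb, e2⟩
    refine ⟨s * t, S.mul_mem hs ht, a * b, ?_, ?_⟩
    · rw [h.mul _ hs _ ht]
      exact mul_mem_of_eq ha hb (by abel)
    · rw [map_mul, map_mul, ← e1, ← e2]
      ring

theorem algebraMap_mem_locGrading (h : GrDenom 𝒜 S δ) (d : P) :
    ∀ x ∈ 𝒜 d, algebraMap A B x ∈ locGrading B h d := fun x hx =>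
  ⟨1, S.one_mem, x, mem_congr hx (by rw [h.one, add_zero]), by simp⟩

theorem exists_inv_mem_locGrading [IsLocalization S B] (h : GrDenom 𝒜 S δ) {s : A} (hs : s ∈ S) :
    ∃ y ∈ locGrading B h (-δ s), algebraMap A B s * y = 1 := by
  obtain ⟨y, hy⟩ := (IsLocalization.map_units B (⟨s, hs⟩ : S)).exists_right_inv
  exact ⟨y, ⟨s, hs, 1, mem_congr one_mem_zero (by abel), by rw [map_one]; exact hy⟩, hy⟩

theorem hasDenom_locGrading (h : GrDenom 𝒜 S δ) :
    HasDenom S δ (RingHom.id A) (algebraMap A B) 𝒜 (locGrading B h) where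
  exists_mul _ _ hz := hz

end Denominators

section FreeUpTo

variable {P : Type*} [AddCommGroup P] {A : Type*} [CommRing A] {𝒜 : P → AddSubgroup A}
  {ι : Type*} [Fintype ι] {a : ι → P}

theorem FreeUpTo.map {B : Type*} [CommRing B] {ℬ : P → AddSubgroup B} (φ : A →+* B)
    (hφ : ∀ d, ∀ x ∈ 𝒜 d, φ x ∈ ℬ d) {E : Matrix ι ι A} {f : A} {d : P}
    (h : FreeUpTo 𝒜 a E f d) : FreeUpTo ℬ a (E.map φ) (φ f) d := by
  obtain ⟨k, b, X, Y, hX, hY, hXY, hYX, hEX, hYE⟩ := h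
  refine ⟨k, b, X.map φ, Y.map φ, hX.map φ hφ, hY.map φ hφ, ?_, ?_, ?_, ?_⟩
  · rw [← Matrix.map_mul, hXY]; ext; simp
  · rw [← Matrix.map_mul, hYX]; ext i j; by_cases h : i = j <;> simp [h]
  · rw [← Matrix.map_mul, hEX]
  · rw [← Matrix.map_mul, hYE]

/-- A graded projective module over `C` which becomes free over a ring of fractions is free up to
multiplication by a denominator. -/
theorem FreeUpTo.of_hasDenom [SetLike.GradedMonoid 𝒜] {C D : Type*} [CommRing C] [CommRing D]
    {S : Submonoid A} {δ : A → P} {j : A →+* C} {ψ : C →+* D} {𝒞 : P → AddSubgroup C}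
    {𝒟 : P → AddSubgroup D} [SetLike.GradedMonoid 𝒞] (h : HasDenom S δ j ψ 𝒞 𝒟)
    (hS : GrDenom 𝒜 S δ) (hj : ∀ d, ∀ x ∈ 𝒜 d, j x ∈ 𝒞 d) (hψ : Function.Injective ψ)
    {E : Matrix ι ι C} (hE2 : E * E = E) (hfree : GrFree 𝒟 a (E.map ψ)) :
    ∃ s ∈ S, FreeUpTo 𝒞 a E (j s) (δ s) := by
  obtain ⟨k, b, X, Y, hX, hY, hXY, hYX⟩ := hfree
  obtain ⟨s, hs, X', hX', eX⟩ := h.exists_matrix hS hj hX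
  obtain ⟨t, ht, Y', hY', eY⟩ := h.exists_matrix hS hj hY
  have hE2' : E.map ψ * E.map ψ = E.map ψ := by rw [← Matrix.map_mul, hE2]
  have hEX : E.map ψ * X = X := by rw [← hXY, Matrix.mul_assoc, hYX, Matrix.mul_one]
  have hYE : Y * E.map ψ = Y := by rw [← hXY, ← Matrix.mul_assoc, hYX, Matrix.one_mul]
  refine ⟨s * t, S.mul_mem hs ht, k, fun i => b i + δ t, X', Y', ?_, hY', ?_, ?_, ?_, ?_⟩
  · rw [hS.mul _ hs _ ht]
    exact fun i l => mem_congr (hX' i l) (by dsimp only; abel)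
  · apply Matrix.map_injective hψ; dsimp only
    rw [Matrix.map_mul, ← eX, ← eY, Matrix.smul_mul, Matrix.mul_smul, hXY, smul_smul]
    ext; simp
  · apply Matrix.map_injective hψ; dsimp only
    rw [Matrix.map_mul, ← eX, ← eY, Matrix.smul_mul, Matrix.mul_smul, hYX, smul_smul]
    ext i j; by_cases h : i = j <;> simp [h, mul_comm]
  · apply Matrix.map_injective hψ; dsimp only
    rw [Matrix.map_mul, ← eX, Matrix.mul_smul, hEX]
  · apply Matrix.map_injective hψ; dsimp only
    rw [Matrix.map_mul, ← eY, Matrix.smul_mul, hYE]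

end FreeUpTo

section Patching

variable {P : Type*} [AddCommGroup P] {A : Type*} [CommRing A] {𝒜 : P → AddSubgroup A}
  [SetLike.GradedMonoid 𝒜] {l : P}

/-- The substitution `X ↦ X + y * Z`, where `Z` is a new variable. -/
noncomputable def shift (y : A) : A[X] →+* A[X][X] :=
  eval₂RingHom (C.comp C) (C X + C (C y) * X)

theorem shift_zero : shift (0 : A) = C := by
  ext <;> simp [shift]

theorem shift_mem {y : A} (hy : y ∈ 𝒜 0) (d : P) : ∀ f ∈ polyGrading 𝒜 l d,
    shift y f ∈ polyGrading (polyGrading 𝒜 l) l d := fun _ hf =>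
  eval₂_mem (C.comp C) (fun _ _ hx => C_mem (C_mem hx))
    (add_mem (C_mem X_mem) (mul_mem_of_eq (C_mem (C_mem hy)) X_mem (zero_add l))) hf

theorem shift_map {B : Type*} [CommRing B] (φ : A →+* B) (y : A) :
    (mapRingHom (mapRingHom φ)).comp (shift y) = (shift (φ y)).comp (mapRingHom φ) := by
  ext <;> simp [shift]

/-- The ring endomorphism of `A[X][Z]` scaling the second variable. -/
noncomputable def scaleSnd (y : A) : A[X][X] →+* A[X][X] :=
  eval₂RingHom C (C (C y) * X)

theorem scaleSnd_mem {y : A} (hy : y ∈ 𝒜 0) (d : P) : ∀ f ∈ polyGrading (polyGrading 𝒜 l) l d,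
    scaleSnd y f ∈ polyGrading (polyGrading 𝒜 l) l d := fun _ hf =>
  eval₂_mem C (fun _ _ hx => C_mem hx) (mul_mem_of_eq (C_mem (C_mem hy)) X_mem (zero_add l)) hf

theorem scaleSnd_map {B : Type*} [CommRing B] (φ : A →+* B) (y : A) :
    (mapRingHom (mapRingHom φ)).comp (scaleSnd y) =
      (scaleSnd (φ y)).comp (mapRingHom (mapRingHom φ)) := by
  ext <;> simp [scaleSnd]

theorem scaleSnd_comp_shift (y z : A) : (scaleSnd y).comp (shift z) = shift (y * z) := by
  refine Polynomial.ringHom_ext (fun x => by simp [scaleSnd, shift]) ?_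
  simp only [scaleSnd, shift, RingHom.comp_apply, coe_eval₂RingHom, eval₂_X, eval₂_add, eval₂_mul,
    eval₂_C, map_mul]
  ring

theorem scaleSnd_comp_C (y : A) : (scaleSnd y).comp C = C := by
  ext <;> simp [scaleSnd]

/-- The substitution `X ↦ X + y * Z`, `Z ↦ Z`. -/
noncomputable def shiftFst (y : A) : A[X][X] →+* A[X][X] := eval₂RingHom (shift y) X

theorem shiftFst_mem {y : A} (hy : y ∈ 𝒜 0) (d : P) : ∀ f ∈ polyGrading (polyGrading 𝒜 l) l d,
    shiftFst y f ∈ polyGrading (polyGrading 𝒜 l) l d := fun _ hf =>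
  eval₂_mem _ (shift_mem hy) X_mem hf

theorem shiftFst_comp_shift (y z : A) : (shiftFst y).comp (shift z) = shift (z + y) := by
  refine Polynomial.ringHom_ext (fun x => by simp [shiftFst, shift]) ?_
  simp only [shiftFst, shift, RingHom.comp_apply, coe_eval₂RingHom, eval₂_X, eval₂_mul,
    eval₂_C, map_add]
  ring

theorem shiftFst_comp_C (y : A) : (shiftFst y).comp C = shift y := by
  ext <;> simp [shiftFst, shift]

theorem _root_.Matrix.map_ringHom_comp {A B D μ ν : Type*} [CommRing A] [CommRing B] [CommRing D]
    (φ : B →+* D) (ψ : A →+* B) (M : Matrix μ ν A) : (M.map ψ).map φ = M.map (φ.comp ψ) := rfl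

variable {ι : Type*} [Fintype ι] [DecidableEq ι] {a : ι → P}

/-- The ideal of those `y` for which `E(X + y * Z)` is isomorphic to `E(X)`. -/
noncomputable def patchIdeal {E : Matrix ι ι A[X]} (hE : HomMat (polyGrading 𝒜 l) a a E)
    (hE2 : E * E = E) : Ideal (SetLike.GradeZero.subring 𝒜) where
  carrier := {y | GrIso (polyGrading (polyGrading 𝒜 l) l) a (E.map (shift (y : A))) a
    (E.map (C : A[X] →+* A[X][X]))}
  zero_mem' := by
    change GrIso _ _ _ _ _
    rw [ZeroMemClass.coe_zero, shift_zero]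
    exact GrIso.refl (hE.map C fun _ _ hx => C_mem hx) (by rw [← Matrix.map_mul, hE2])
  add_mem' := by
    intro y z hy hz
    have h1 := hy.map (shiftFst (z : A)) (shiftFst_mem z.2)
    rw [Matrix.map_ringHom_comp, Matrix.map_ringHom_comp, shiftFst_comp_shift,
      shiftFst_comp_C] at h1
    exact h1.trans hz (by rw [← Matrix.map_mul, hE2]) (by rw [← Matrix.map_mul, hE2])
  smul_mem' := by
    intro r y hy
    have h1 := hy.map (scaleSnd (r : A)) (scaleSnd_mem r.2)
    rw [Matrix.map_ringHom_comp, Matrix.map_ringHom_comp, scaleSnd_comp_shift,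
      scaleSnd_comp_C] at h1
    exact h1

theorem grLocal_locGrading {𝔪 : Ideal (SetLike.GradeZero.subring 𝒜)}
    {S : Submonoid A} (hS : ∀ s, s ∈ S ↔ ∃ y ∉ 𝔪, (y : A) = s) {B : Type*} [CommRing B] [Algebra A B]
    [IsLocalization S B] [Nontrivial B] (h : GrDenom 𝒜 S 0) : GrLocal (locGrading B h) := by
  refine ⟨one_ne_zero, ?_⟩
  rintro u ⟨s, hs, x, hx, e⟩
  replace hx : x ∈ 𝒜 0 := mem_congr hx (add_zero _)
  obtain ⟨y, hy, rfl⟩ := (hS s).1 hs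
  by_cases hx' : (⟨x, hx⟩ : SetLike.GradeZero.subring 𝒜) ∈ 𝔪
  · right
    have h1 : (y : A) - x ∈ S := (hS _).2 ⟨y - ⟨x, hx⟩, fun h1 => hy (by
      simpa using 𝔪.add_mem h1 hx'), rfl⟩
    obtain ⟨v, hv, hv1⟩ := exists_inv_mem_locGrading (B := B) h h1
    refine ⟨algebraMap A B y * v, mul_mem_of_eq (algebraMap_mem_locGrading h 0 _ y.2) hv
      (by simp), ?_⟩
    rw [map_sub] at hv1
    linear_combination hv1 - v * e
  · left
    have h1 : x ∈ S := (hS _).2 ⟨_, hx', rfl⟩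
    obtain ⟨v, hv, hv1⟩ := exists_inv_mem_locGrading (B := B) h h1
    refine ⟨algebraMap A B y * v, mul_mem_of_eq (algebraMap_mem_locGrading h 0 _ y.2) hv
      (by simp), ?_⟩
    linear_combination hv1 + v * e

theorem exists_eq_add_X_mul {B : Type*} [CommRing B] {ℬ : P → AddSubgroup B} {G : Matrix ι ι B[X]}
    (hG : HomMat (polyGrading ℬ l) a a G) :
    ∃ G₁ : Matrix ι ι B[X], HomMat (polyGrading ℬ l) (fun i => a i - l) a G₁ ∧
      G = (G.map (eval 0)).map C + (X : B[X]) • G₁ := by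
  refine ⟨Matrix.of fun i j => (G i j).divX, fun i j n => ?_, ?_⟩
  · rw [Matrix.of_apply, coeff_divX]
    exact mem_congr (hG i j (n + 1)) (by rw [succ_nsmul]; dsimp only; abel)
  · ext1 i j
    conv_lhs => rw [← X_mul_divX_add (G i j)]
    simp [coeff_zero_eq_eval_zero, add_comm]

theorem map_scaleSnd_eq {B : Type*} [CommRing B] (φ : A →+* B) {E : Matrix ι ι A[X]} {s : A}
    {G G₁ : Matrix ι ι B[X][X]} {G₁' : Matrix ι ι A[X][X]}
    (hG : G = (E.map (mapRingHom φ)).map C + (X : B[X][X]) • G₁)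
    (h : ∀ i j, C (C (φ s)) * G₁ i j = mapRingHom (mapRingHom φ) (G₁' i j)) :
    (E.map C + (X : A[X][X]) • G₁'.map (scaleSnd s)).map (mapRingHom (mapRingHom φ)) =
      G.map (scaleSnd (φ s)) := by
  ext1 i j
  have h1 : mapRingHom (mapRingHom φ) (scaleSnd s (G₁' i j)) =
      scaleSnd (φ s) (mapRingHom (mapRingHom φ) (G₁' i j)) :=
    RingHom.congr_fun (scaleSnd_map φ s) _
  have h2 : scaleSnd (φ s) (C (C (φ s))) = C (C (φ s)) := by simp [scaleSnd]
  have h3 : scaleSnd (φ s) X = C (C (φ s)) * X := by simp [scaleSnd]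
  have h4 : scaleSnd (φ s) (C (mapRingHom φ (E i j))) = C (mapRingHom φ (E i j)) := by
    simp [scaleSnd]
  have h5 : mapRingHom (mapRingHom φ) (C (E i j)) = C (mapRingHom φ (E i j)) := by simp
  have h6 : mapRingHom (mapRingHom φ) (X : A[X][X]) = X := by simp
  simp only [hG, Matrix.map_apply, Matrix.add_apply, Matrix.smul_apply, smul_eq_mul, map_add, map_mul,
    h1, ← h, h2, h3, h4, h5, h6]
  ring

/-- Quillen patching, combined with Horrocks' theorem. -/
theorem GrIso.of_freeUpTo [IsDomain A] {E : Matrix ι ι A[X]}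
    (hE : HomMat (polyGrading 𝒜 l) a a E) (hE2 : E * E = E) {f : A[X]} (hf : f.Monic)
    (hfm : f ∈ polyGrading 𝒜 l (f.natDegree • l))
    (hfree : FreeUpTo (polyGrading 𝒜 l) a E f (f.natDegree • l)) :
    GrIso (polyGrading 𝒜 l) a E a ((E.map (evalRingHom 0)).map C) := by
  suffices h : patchIdeal hE hE2 = ⊤ by
    have h1 : GrIso (polyGrading (polyGrading 𝒜 l) l) a (E.map (shift 1)) a
      (E.map (C : A[X] →+* A[X][X])) := (Ideal.eq_top_iff_one _).1 h
    have h2 := h1.map (𝒜 := polyGrading (polyGrading 𝒜 l) l) (ℬ := polyGrading 𝒜 l)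
      (eval₂RingHom (C.comp (evalRingHom 0)) X) fun _ _ hx =>
      eval₂_mem (𝒜 := polyGrading 𝒜 l) (ℬ := polyGrading 𝒜 l) (C.comp (evalRingHom 0))
        (fun _ _ hy => C_mem (eval₂_mem (ℬ := 𝒜) (RingHom.id A)
        (fun _ _ h => h) (zero_mem _) hy)) X_mem hx
    have e1 : (eval₂RingHom ((C : A →+* A[X]).comp (evalRingHom 0)) X).comp (shift 1) =
      RingHom.id _ := by ext <;> simp [shift]
    have e2 : (eval₂RingHom ((C : A →+* A[X]).comp (evalRingHom 0)) X).comp C =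
      C.comp (evalRingHom 0) := by ext <;> simp
    rw [Matrix.map_ringHom_comp, Matrix.map_ringHom_comp, e1, e2] at h2
    exact h2
  by_contra hne
  obtain ⟨𝔪, hmax, hle⟩ := Ideal.exists_le_maximal _ hne
  let S : Submonoid A := Submonoid.map (SetLike.GradeZero.subring 𝒜).subtype 𝔪.primeCompl
  have hS : ∀ s, s ∈ S ↔ ∃ y ∉ 𝔪, (y : A) = s := fun s => Iff.rfl
  have hS0 : S ≤ nonZeroDivisors A := by
    rintro _ ⟨y, hy, rfl⟩
    refine mem_nonZeroDivisors_of_ne_zero fun h0 => hy ?_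
    rw [show y = 0 from Subtype.ext h0]
    exact zero_mem _
  have hden : GrDenom 𝒜 S 0 := ⟨by rintro _ ⟨y, -, rfl⟩; exact y.2, fun _ _ _ _ => by simp⟩
  let B := Localization S
  have : Nontrivial B := (IsLocalization.injective B hS0).nontrivial
  let φ : A →+* B := algebraMap A B
  have hφ : Function.Injective φ := IsLocalization.injective B hS0
  have hφm := algebraMap_mem_locGrading (B := B) hden
  have hloc : GrLocal (locGrading B hden) := grLocal_locGrading hS hden
  have hmon := hf.map φ
  have hdeg : (f.map φ).natDegree = f.natDegree := hf.natDegree_map φ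
  obtain ⟨k, b, U, V, hU, hV, hUV, hVU⟩ := hloc.horrocks (l := l) (a := a) (E := E.map (mapRingHom φ))
    (hE.map _ fun d x hx => mapRingHom_mem φ hφm hx)
    (by rw [← Matrix.map_mul, hE2]) hmon (by rw [hdeg]; exact mapRingHom_mem φ hφm hfm)
    (by rw [hdeg]; exact hfree.map (mapRingHom φ) fun d x hx => mapRingHom_mem φ hφm hx)
  have hs1 := shift_mem (𝒜 := locGrading B hden) (l := l) one_mem_zero
  have hC : ∀ d, ∀ x ∈ polyGrading (locGrading B hden) l d,
      C x ∈ polyGrading (polyGrading (locGrading B hden) l) l d := fun _ _ hx => C_mem hx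
  have hev : ∀ x : B[X], eval 0 (shift 1 x) = x := fun x => by
    have : (evalRingHom 0).comp (shift (1 : B)) = RingHom.id _ := by ext <;> simp [shift]
    exact RingHom.congr_fun this x
  obtain ⟨G₁, hG₁, eG⟩ := exists_eq_add_X_mul ((hU.map _ hs1).mul (hV.map _ hC))
  obtain ⟨H₁, hH₁, eH⟩ := exists_eq_add_X_mul ((hU.map _ hC).mul (hV.map _ hs1))
  have hev1 : ∀ M N : B[X] →+* B[X][X], (∀ x, eval 0 (M x) = x) → (∀ x, eval 0 (N x) = x) →
      (U.map M * V.map N).map (eval 0) = E.map (mapRingHom φ) := fun M N hM hN => by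
    change (U.map M * V.map N).map (evalRingHom 0) = _
    rw [Matrix.map_mul, ← hUV]
    congr 1 <;> · ext1 i j; simp [hM, hN]
  rw [hev1 _ _ hev (by simp)] at eG
  rw [hev1 _ _ (by simp) hev] at eH
  have hjm : ∀ d, ∀ x ∈ 𝒜 d, ((C : A[X] →+* A[X][X]).comp ((C : A →+* A[X]).comp (RingHom.id A))) x ∈
    polyGrading (polyGrading 𝒜 l) l d := fun _ _ hx => C_mem (C_mem hx)
  obtain ⟨_, ⟨y, hy, rfl⟩, K, hK, eK⟩ := (((hasDenom_locGrading (B := B) hden).polynomial hden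
    (fun _ _ h => h) l).polynomial hden (fun _ _ hx => C_mem hx) l).exists_matrix hden hjm
    (a := fun i => Sum.elim a a i - l) (b := a) (X := Matrix.fromRows G₁ H₁)
    (by rintro (i | i) j; exacts [hG₁ i j, hH₁ i j])
  refine hy (hle ?_)
  change GrIso _ _ _ _ _
  let s : A := y
  have hGs := map_scaleSnd_eq (s := s) φ (G₁' := K.toRows₁) eG (fun i j => by
    have := congrFun (congrFun eK (Sum.inl i)) j
    simpa using this)
  have hHs := map_scaleSnd_eq (s := s) φ (G₁' := K.toRows₂) eH (fun i j => by
    have := congrFun (congrFun eK (Sum.inr i)) j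
    simpa using this)
  have hhom : ∀ L : Matrix ι ι A[X][X], (∀ i j, L i j ∈ polyGrading (polyGrading 𝒜 l) l (a i - l - a j)) →
      HomMat (polyGrading (polyGrading 𝒜 l) l) a a
        (E.map C + (X : A[X][X]) • L.map (scaleSnd s)) := fun L hL =>
    (hE.map C fun _ _ hx => C_mem hx).add fun i j =>
      mul_mem_of_eq X_mem (scaleSnd_mem y.2 _ _ (hL i j)) (by abel)
  have hinj : Function.Injective (mapRingHom (mapRingHom φ)) :=
    map_injective _ (map_injective _ hφ)
  refine ⟨_, _, hhom K.toRows₁ fun i j => mem_congr (hK (Sum.inl i) j) (by simp),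
    hhom K.toRows₂ fun i j => mem_congr (hK (Sum.inr i) j) (by simp), ?_, ?_⟩
  · apply Matrix.map_injective hinj
    dsimp only
    rw [Matrix.map_mul, hGs, hHs, ← Matrix.map_mul]
    have : U.map (shift 1) * V.map C * (U.map C * V.map (shift 1)) =
        (E.map (mapRingHom φ)).map (shift 1) := by
      rw [Matrix.mul_assoc, ← Matrix.mul_assoc (V.map C), ← Matrix.map_mul, hVU, ← hUV, Matrix.map_mul]
      simp
    rw [this, Matrix.map_ringHom_comp, Matrix.map_ringHom_comp, scaleSnd_comp_shift, mul_one, ← shift_map]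
    rfl
  · apply Matrix.map_injective hinj
    dsimp only
    rw [Matrix.map_mul, hGs, hHs, ← Matrix.map_mul]
    have : U.map C * V.map (shift 1) * (U.map (shift 1) * V.map C) =
        (E.map (mapRingHom φ)).map C := by
      rw [Matrix.mul_assoc, ← Matrix.mul_assoc (V.map (shift 1)), ← Matrix.map_mul, hVU, ← hUV,
        Matrix.map_mul]
      simp
    rw [this, Matrix.map_ringHom_comp, scaleSnd_comp_C]
    ext1 i j
    simp

/-- If all graded projectives over the base are free, then so are those over the polynomial ring
which become free after multiplication by a monic polynomial. -/
theorem AllFree.of_freeUpTo [IsDomain A] (h : AllFree 𝒜) {E : Matrix ι ι A[X]}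
    (hE : HomMat (polyGrading 𝒜 l) a a E) (hE2 : E * E = E) {f : A[X]} (hf : f.Monic)
    (hfm : f ∈ polyGrading 𝒜 l (f.natDegree • l))
    (hfree : FreeUpTo (polyGrading 𝒜 l) a E f (f.natDegree • l)) :
    GrFree (polyGrading 𝒜 l) a E := by
  refine GrFree.of_grIso (GrIso.of_freeUpTo hE hE2 hf hfm hfree) ?_ hE2
  refine GrFree.map C (fun _ _ hx => C_mem hx) (h.apply (hE.map (evalRingHom 0) fun d x hx => ?_) ?_)
  · exact eval₂_mem (ℬ := 𝒜) (RingHom.id A) (fun _ _ h => h) (zero_mem _) hx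
  · rw [← Matrix.map_mul, hE2]

end Patching

section GrPID

variable {P : Type*} [AddCommGroup P] {R : Type*} [CommRing R]

/-- The homogeneous element `p` of degree `e` generates a maximal homogeneous ideal. -/
structure GrMax (ℛ : P → AddSubgroup R) (p : R) (e : P) : Prop where
  mem : p ∈ ℛ e
  ne_zero : p ≠ 0
  not_unit : ¬ IsUnit p
  dvd_or : ∀ d, ∀ a ∈ ℛ d, p ∣ a ∨ ∃ x ∈ ℛ (-d), ∃ y ∈ ℛ (-e), x * a + y * p = 1

/-- Products of a unit and of generators of maximal homogeneous ideals. -/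
inductive GrProd (ℛ : P → AddSubgroup R) : R → Prop
  | of_isUnit {a : R} (h : IsUnit a) : GrProd ℛ a
  | mul {p a : R} {e : P} (hp : GrMax ℛ p e) (ha : GrProd ℛ a) : GrProd ℛ (p * a)

/-- A graded analogue of the notion of a principal ideal domain. -/
structure GrPID (ℛ : P → AddSubgroup R) : Prop where
  cancel : ∀ d e f a b, a ≠ 0 → a ∈ ℛ d → a * b ∈ ℛ f → d + e = f → b ∈ ℛ e
  factor : ∀ d, ∀ a ∈ ℛ d, a ≠ 0 → GrProd ℛ a

variable {ℛ : P → AddSubgroup R}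

theorem GrProd.unit_mul {u a : R} (hu : IsUnit u) (ha : GrProd ℛ a) : GrProd ℛ (u * a) := by
  induction ha generalizing u with
  | of_isUnit h => exact .of_isUnit (hu.mul h)
  | mul hp _ ih => rw [mul_left_comm]; exact .mul hp (ih hu)

theorem GrProd.mul_mul {a b : R} (ha : GrProd ℛ a) (hb : GrProd ℛ b) : GrProd ℛ (a * b) := by
  induction ha with
  | of_isUnit h => exact hb.unit_mul h
  | mul hp _ ih => rw [mul_assoc]; exact .mul hp ih

variable [SetLike.GradedMonoid ℛ]

theorem GrPID.exists_inv [Nontrivial R] (h : GrPID ℛ) {a : R} {d : P} (ha : a ∈ ℛ d)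
    (hu : IsUnit a) : ∃ x ∈ ℛ (-d), x * a = 1 := by
  obtain ⟨x, hx⟩ := hu.exists_left_inv
  exact ⟨x, h.cancel _ _ _ a x hu.ne_zero ha (by rw [mul_comm, hx]; exact one_mem_zero)
    (add_neg_cancel d), hx⟩

theorem GrPID.exists_gcd_of_grProd [Nontrivial R] (h : GrPID ℛ) {b : R} (hb : GrProd ℛ b)
    {d e : P} {a : R} (ha : a ∈ ℛ d) (hbe : b ∈ ℛ e) :
    ∃ k, ∃ g ∈ ℛ k, ∃ a' ∈ ℛ (d - k), ∃ b' ∈ ℛ (e - k), ∃ x ∈ ℛ (k - d), ∃ y ∈ ℛ (k - e),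
      a = g * a' ∧ b = g * b' ∧ x * a' + y * b' = 1 := by
  induction hb generalizing a d e with
  | of_isUnit hu =>
    obtain ⟨x, hx, hx1⟩ := h.exists_inv hbe hu
    exact ⟨0, 1, one_mem_zero, a, mem_congr ha (by abel), _, mem_congr hbe (by abel), 0,
      zero_mem _, x, mem_congr hx (by abel), by ring, by ring, by rw [hx1]; ring⟩
  | @mul p b c hp hb ih =>
    have hb' : b ∈ ℛ (e - c) := h.cancel _ _ _ p b hp.ne_zero hp.mem hbe (by abel)
    rcases hp.dvd_or d a ha with ⟨a₁, rfl⟩ | ⟨x, hx, y, hy, hxy⟩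
    · have ha₁ : a₁ ∈ ℛ (d - c) := h.cancel _ _ _ p a₁ hp.ne_zero hp.mem ha (by abel)
      obtain ⟨k, g, hg, a', ha', b', hb', x, hx, y, hy, e1, e2, e3⟩ := ih ha₁ hb'
      exact ⟨c + k, p * g, mul_mem_of_eq hp.mem hg rfl, a', mem_congr ha' (by abel), b',
        mem_congr hb' (by abel), x, mem_congr hx (by abel), y, mem_congr hy (by abel),
        by rw [e1]; ring, by rw [e2]; ring, e3⟩
    · obtain ⟨k, g, hg, a', ha', b', hb', u, hu, v, hv, e1, e2, e3⟩ := ih ha hb'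
      refine ⟨k, g, hg, a', ha', p * b', mul_mem_of_eq hp.mem hb' (by abel),
        u + v * b' * x * g, add_mem hu ?_, v * y, mul_mem_of_eq hv hy (by abel), e1,
        by rw [e2]; ring, ?_⟩
      · exact mul_mem_of_eq (mul_mem_of_eq (mul_mem_of_eq hv hb' rfl) hx rfl) hg (by abel)
      · rw [e1] at hxy
        linear_combination (v * b') * hxy + e3 + 0 * e2

theorem GrPID.exists_gcd [Nontrivial R] (h : GrPID ℛ) {ι : Type*} (T : Finset ι) {d : ι → P}
    {σ : ι → R} (hσ : ∀ i, σ i ∈ ℛ (d i)) :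
    (∀ i ∈ T, σ i = 0) ∨ ∃ (k : P) (g : R) (τ w : ι → R), g ∈ ℛ k ∧ (∀ i, τ i ∈ ℛ (d i - k)) ∧
      (∀ i, w i ∈ ℛ (k - d i)) ∧ (∀ i ∈ T, σ i = g * τ i) ∧ ∑ i ∈ T, w i * τ i = 1 := by
  classical
  induction T using Finset.induction_on with
  | empty => simp
  | insert j T hj ih =>
    have hne : ∀ i ∈ T, i ≠ j := fun i hi hij => hj (hij ▸ hi)
    have hup : ∀ {c : ι → P} {f : ι → R} {x : R}, (∀ i, f i ∈ ℛ (c i)) → x ∈ ℛ (c j) →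
        ∀ i, Function.update f j x i ∈ ℛ (c i) := by
      intro c f x hf hx i
      by_cases hi : i = j
      · subst hi; simpa using hx
      · simpa [hi] using hf i
    have hsum : ∀ (f g : ι → R) (x y : R), ∑ i ∈ insert j T,
        Function.update f j x i * Function.update g j y i = x * y + ∑ i ∈ T, f i * g i := by
      intro f g x y
      rw [Finset.sum_insert hj, Function.update_self, Function.update_self]
      congr 1
      refine Finset.sum_congr rfl fun i hi => ?_
      rw [Function.update_of_ne (hne i hi), Function.update_of_ne (hne i hi)]
    by_cases hz : σ j = 0
    · rcases ih with ih | ⟨k, g, τ, w, hg, hτ, hw, e1, e2⟩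
      · left
        intro i hi
        rcases Finset.mem_insert.1 hi with rfl | hi
        exacts [hz, ih i hi]
      · right
        refine ⟨k, g, Function.update τ j 0, Function.update w j 0, hg, hup hτ (zero_mem _),
          hup hw (zero_mem _), fun i hi => ?_, by rw [hsum, e2]; ring⟩
        rcases Finset.mem_insert.1 hi with rfl | hi
        · simp [hz]
        · rw [Function.update_of_ne (hne i hi), e1 i hi]
    · right
      rcases ih with ih | ⟨k, g, τ, w, hg, hτ, hw, e1, e2⟩
      · refine ⟨d j, σ j, Function.update 0 j 1, Function.update 0 j 1, hσ j,
          hup (fun _ => zero_mem _) (mem_congr one_mem_zero (by abel)),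
          hup (fun _ => zero_mem _) (mem_congr one_mem_zero (by abel)), fun i hi => ?_,
          by rw [hsum]; simp⟩
        rcases Finset.mem_insert.1 hi with rfl | hi
        · simp
        · rw [Function.update_of_ne (hne i hi), ih i hi]; simp
      · obtain ⟨c, f, hf, g', hg', s, hs, x, hx, y, hy, e3, e4, e5⟩ :=
          h.exists_gcd_of_grProd (h.factor _ _ (hσ j) hz) hg (hσ j)
        refine ⟨c, f, Function.update (fun i => g' * τ i) j s, Function.update (fun i => x * w i) j y,
          hf, hup (fun i => mul_mem_of_eq hg' (hτ i) (by abel)) hs,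
          hup (fun i => mul_mem_of_eq hx (hw i) (by abel)) hy, fun i hi => ?_, ?_⟩
        · rcases Finset.mem_insert.1 hi with rfl | hi
          · simpa using e4
          · rw [Function.update_of_ne (hne i hi), e1 i hi, e3, mul_assoc]
        · rw [hsum]
          have : ∑ i ∈ T, x * w i * (g' * τ i) = x * g' * ∑ i ∈ T, w i * τ i := by
            rw [Finset.mul_sum]
            exact Finset.sum_congr rfl fun i _ => by ring
          rw [this, e2]
          linear_combination e5

theorem GrPID.allFree [IsDomain R] (h : GrPID ℛ) : AllFree ℛ := by
  intro m a E hE hE2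
  let K := FractionRing R
  induction hn : Module.finrank K (LinearMap.range (E.map (algebraMap R K)).mulVecLin)
    using Nat.strong_induction_on generalizing E with
  | _ n ih =>
    by_cases hz : E = 0
    · subst hz
      exact ⟨0, Fin.elim0, 0, 0, HomMat.zero, HomMat.zero, by simp, Subsingleton.elim _ _⟩
    obtain ⟨j, hj⟩ : ∃ j, ¬ ∀ i, E i j = 0 := by
      by_contra! hcon
      exact hz (by ext i j; exact hcon j i)
    obtain ⟨k, g, τ, w, hg, hτ, hw, e1, e2⟩ := (h.exists_gcd Finset.univ (fun i => hE i j)).resolve_left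
      (by simpa using hj)
    have hg0 : g ≠ 0 := by
      rintro rfl
      exact hj fun i => by rw [e1 i (Finset.mem_univ i), zero_mul]
    let T : Matrix (Fin m) Unit R := Matrix.of fun i _ => τ i
    have hEj : E * E.submatrix id (fun _ : Unit => j) = E.submatrix id fun _ => j := by
      conv_rhs => rw [← hE2]
      rfl
    have hgT : E.submatrix id (fun _ : Unit => j) = g • T := by
      ext i; exact e1 i (Finset.mem_univ i)
    have hET : E * T = T := by
      rw [hgT, Matrix.mul_smul] at hEj
      ext i l
      exact mul_left_cancel₀ hg0 (congrFun (congrFun hEj i) l)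
    obtain ⟨W, hW, hWE, hWT⟩ : ∃ W : Matrix Unit (Fin m) R,
        HomMat ℛ (fun _ => a j + k) a W ∧ W * E = W ∧ W * T = 1 := by
      refine ⟨Matrix.of (fun _ => w) * E, HomMat.mul (b := a)
        (fun _ i => mem_congr (hw i) (by abel)) hE, by rw [Matrix.mul_assoc, hE2], ?_⟩
      rw [Matrix.mul_assoc, hET]
      ext
      simpa [Matrix.mul_apply, T] using e2
    have hT : HomMat ℛ a (fun _ => a j + k) T := fun i _ => mem_congr (hτ i) (by dsimp only; abel)
    refine GrFree.of_rank_one hE2 hT hW hET hWE hWT ?_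
    have e3 : (E - T * W) * (E - T * W) = E - T * W := by
      rw [Matrix.mul_sub, Matrix.sub_mul, Matrix.sub_mul, hE2, Matrix.mul_assoc T W E, hWE,
        ← Matrix.mul_assoc E T W, hET, Matrix.mul_assoc T W (T * W), ← Matrix.mul_assoc W T W, hWT,
        Matrix.one_mul, sub_self, sub_zero]
    refine ih _ ?_ (E - T * W) (hE.sub (hT.mul hW)) e3 rfl
    rw [← hn]
    apply Submodule.finrank_lt_finrank_of_lt
    have e4 : (E - T * W) * T = 0 := by
      rw [Matrix.sub_mul, hET, Matrix.mul_assoc, hWT, Matrix.mul_one, sub_self]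
    have e5 : E * (E - T * W) = E - T * W := by
      rw [Matrix.mul_sub, hE2, ← Matrix.mul_assoc, hET]
    let φ := algebraMap R K
    have hcol : ∀ M : Matrix (Fin m) (Fin m) R, (M.map φ).mulVec (fun i => φ (τ i)) =
        fun i => φ ((M * T) i ()) := by
      intro M
      ext i
      simp [Matrix.mulVec, dotProduct, Matrix.mul_apply, T]
    refine lt_of_le_of_ne ?_ fun heq => ?_
    · rintro _ ⟨v, rfl⟩
      refine ⟨((E - T * W).map φ).mulVec v, ?_⟩
      rw [Matrix.mulVecLin_apply, Matrix.mulVec_mulVec, ← Matrix.map_mul, e5]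
      rfl
    · have h1 : (fun i => φ (τ i)) ∈ LinearMap.range (E.map φ).mulVecLin := by
        refine ⟨fun i => φ (τ i), ?_⟩
        rw [Matrix.mulVecLin_apply, hcol, hET]
        rfl
      rw [← heq] at h1
      obtain ⟨v, hv⟩ := h1
      have h2 := hcol (E - T * W)
      rw [e4, ← hv, Matrix.mulVecLin_apply, Matrix.mulVec_mulVec, ← Matrix.map_mul, e3] at h2
      rw [Matrix.mulVecLin_apply, h2] at hv
      have h3 : ∀ i, τ i = 0 := fun i => by
        have := congrFun hv i
        rw [Matrix.zero_apply, map_zero, eq_comm] at this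
        exact (map_eq_zero_iff φ (IsFractionRing.injective R K)).1 this
      simp [h3] at e2

/-- The trivial grading, concentrated in degree zero. -/
noncomputable def trivGrading (R : Type*) [CommRing R] (P : Type*) [AddCommGroup P] (d : P) :
    AddSubgroup R :=
  open Classical in if d = 0 then ⊤ else ⊥

theorem mem_trivGrading_zero (x : R) : x ∈ trivGrading R P 0 := by simp [trivGrading]

theorem mem_trivGrading {x : R} {d : P} : x ∈ trivGrading R P d ↔ (d = 0 ∨ x = 0) := by
  unfold trivGrading
  split_ifs with h <;> simp [h]

instance trivGrading.gradedMonoid : SetLike.GradedMonoid (trivGrading R P) where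
  one_mem := mem_trivGrading_zero 1
  mul_mem := by
    intro d e x y hx hy
    rw [mem_trivGrading] at *
    rcases hx with rfl | rfl
    · rcases hy with rfl | rfl <;> simp
    · simp

theorem grPID_trivGrading [IsDomain R] [IsPrincipalIdealRing R] : GrPID (trivGrading R P) where
  cancel := by
    intro d e f a b ha had hab h
    rw [mem_trivGrading] at *
    obtain rfl := had.resolve_right ha
    rw [zero_add] at h
    subst h
    exact hab.imp_right fun h => (mul_eq_zero.1 h).resolve_left ha
  factor := by
    intro d a had ha
    clear had d
    induction a using WfDvdMonoid.induction_on_irreducible with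
    | zero => exact absurd rfl ha
    | unit u hu => exact .of_isUnit hu
    | mul a p ha0 hp ih =>
      refine .mul (e := 0) ⟨mem_trivGrading_zero p, hp.ne_zero, hp.not_isUnit, fun d a ha => ?_⟩ (ih ha0)
      rw [mem_trivGrading] at ha
      rcases ha with rfl | rfl
      · refine or_iff_not_imp_left.2 fun h => ?_
        obtain ⟨y, x, hxy⟩ := (hp.coprime_iff_not_dvd.2 h)
        exact ⟨x, by rw [neg_zero]; exact mem_trivGrading_zero x, y,
          by rw [neg_zero]; exact mem_trivGrading_zero y, by rw [add_comm, hxy]⟩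
      · exact Or.inl (dvd_zero p)

end GrPID

section MonicLocalization

variable {P : Type*} [AddCommGroup P] {R : Type*} [CommRing R] {ℛ : P → AddSubgroup R}
  [SetLike.GradedMonoid ℛ] {l : P}

/-- The multiplicative set of homogeneous monic polynomials. -/
def monicSubmonoid [Nontrivial R] (ℛ : P → AddSubgroup R) [SetLike.GradedMonoid ℛ] (l : P) :
    Submonoid R[X] where
  carrier := {s | s.Monic ∧ s ∈ polyGrading ℛ l (s.natDegree • l)}
  one_mem' := ⟨monic_one, mem_congr one_mem_zero (by simp)⟩
  mul_mem' := fun {s t} hs ht => ⟨hs.1.mul ht.1, by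
    rw [hs.1.natDegree_mul ht.1]
    exact mul_mem_of_eq hs.2 ht.2 (by rw [add_smul])⟩

variable (l) in
/-- The homogeneous ideal generated by `f` and `g` contains a monic polynomial. -/
def Comax (ℛ : P → AddSubgroup R) (d : P) (f : R[X]) (e : P) (g : R[X]) : Prop :=
  ∃ s : R[X], s.Monic ∧ s ∈ polyGrading ℛ l (s.natDegree • l) ∧
    ∃ α ∈ polyGrading ℛ l (s.natDegree • l - d), ∃ β ∈ polyGrading ℛ l (s.natDegree • l - e),
      s = α * f + β * g

variable [IsDomain R]

theorem grDenom_monicSubmonoid :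
    GrDenom (polyGrading ℛ l) (monicSubmonoid ℛ l) fun s => s.natDegree • l where
  mem _ hs := hs.2
  mul s hs t ht := by rw [hs.1.natDegree_mul ht.1, add_smul]

theorem GrPID.polyGrading_cancel (h : GrPID ℛ) {d e k : P} {f g : R[X]} (hf0 : f ≠ 0)
    (hf : f ∈ polyGrading ℛ l d) (hfg : f * g ∈ polyGrading ℛ l k) (hk : d + e = k) :
    g ∈ polyGrading ℛ l e := fun n => by
  subst hk
  exact coeff_mem_of_mul (D := 0) IdealFam.refl hf
    (fun k y hy => h.cancel _ _ _ _ y (leadingCoeff_ne_zero.2 hf0) (hf _) hy rfl)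
    (fun n _ => hfg n) n (Nat.zero_le n)

theorem GrPID.comax_C (h : GrPID ℛ) {p : R} {e : P} (hp : GrMax ℛ p e) {d : P} {f : R[X]}
    (hf : f ∈ polyGrading ℛ l d) (hpf : ¬ C p ∣ f) : Comax l ℛ d f e (C p) := by
  induction hN : f.support.card using Nat.strong_induction_on generalizing f with
  | _ N ih =>
    have hf0 : f ≠ 0 := fun h0 => hpf (h0 ▸ dvd_zero _)
    rcases hp.dvd_or _ _ (hf f.natDegree) with ⟨b, hb⟩ | ⟨x, hx, y, hy, hxy⟩
    · have hbm : b ∈ ℛ (d - f.natDegree • l - e) :=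
        h.cancel _ _ _ p b hp.ne_zero hp.mem (hb ▸ hf f.natDegree) (by abel)
      have hlead : f = f.eraseLead + C p * (X ^ f.natDegree * C b) := by
        conv_lhs => rw [← f.eraseLead_add_C_mul_X_pow]
        rw [leadingCoeff, hb, C_mul]; ring
      have hm : X ^ f.natDegree * C b ∈ polyGrading ℛ l (d - e) :=
        X_pow_mul_mem _ (C_mem hbm) (by abel)
      have he : f.eraseLead ∈ polyGrading ℛ l d := by
        rw [eq_sub_of_add_eq hlead.symm]
        exact sub_mem hf (mul_mem_of_eq (C_mem hp.mem) hm (by abel))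
      obtain ⟨s, hs, hsm, α, hα, β, hβ, e1⟩ := ih _ (hN ▸ eraseLead_support_card_lt hf0) he
        (fun hdvd => hpf (by rw [hlead]; exact dvd_add hdvd (dvd_mul_right _ _))) rfl
      refine ⟨s, hs, hsm, α, hα, β - α * (X ^ f.natDegree * C b),
        sub_mem hβ (mul_mem_of_eq hα hm (by abel)), ?_⟩
      rw [e1, eq_sub_of_add_eq hlead.symm]
      ring
    · have hdeg : (C x * f + C y * X ^ f.natDegree * C p).natDegree ≤ f.natDegree := by
        refine natDegree_add_le_of_degree_le (natDegree_C_mul_le x f) ?_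
        rw [mul_right_comm, ← C_mul]
        exact natDegree_C_mul_X_pow_le _ _
      have hco : (C x * f + C y * X ^ f.natDegree * C p).coeff f.natDegree = 1 := by
        rw [coeff_add, mul_right_comm, ← C_mul, coeff_C_mul, coeff_C_mul_X_pow, if_pos rfl, hxy]
      have hn := natDegree_eq_of_le_of_coeff_ne_zero hdeg (by rw [hco]; exact one_ne_zero)
      have h1 : C x ∈ polyGrading ℛ l (f.natDegree • l - d) := C_mem (mem_congr hx (by abel))
      have h2 : C y * X ^ f.natDegree ∈ polyGrading ℛ l (f.natDegree • l - e) :=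
        mul_mem_of_eq (C_mem hy) (X_pow_mem _ rfl) (by abel)
      refine ⟨_, monic_of_natDegree_le_of_coeff_eq_one _ hdeg hco, ?_, C x, hn.symm ▸ h1,
        C y * X ^ f.natDegree, hn.symm ▸ h2, rfl⟩
      rw [hn]
      exact add_mem (mul_mem_of_eq h1 hf (by abel)) (mul_mem_of_eq h2 (C_mem hp.mem) (by abel))

theorem C_dvd_of_C_dvd_monic_mul {p : R} {s q : R[X]} (hs : s.Monic) (h : C p ∣ s * q) :
    C p ∣ q := by
  have key : ∀ f : R[X], C p ∣ f ↔ f.map (Ideal.Quotient.mk (Ideal.span {p})) = 0 := fun f => by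
    simp only [C_dvd_iff_dvd_coeff, Polynomial.ext_iff, coeff_map, coeff_zero,
      Ideal.Quotient.eq_zero_iff_mem, Ideal.mem_span_singleton]
  rw [key] at *
  rw [Polynomial.map_mul] at h
  exact (hs.map _).mul_right_eq_zero_iff.1 h

variable (ℛ) in
/-- The polynomial `f` has no constant homogeneous prime factor. -/
def GrPrimitive (f : R[X]) : Prop := ∀ p e, GrMax ℛ p e → ¬ C p ∣ f

theorem GrPID.C_dvd_of_C_dvd_mul (h : GrPID ℛ) {c : R} (hc : GrProd ℛ c) {q g : R[X]} {d : P}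
    (hg : g ∈ polyGrading ℛ l d) (hg' : GrPrimitive ℛ g) (hdvd : C c ∣ q * g) : C c ∣ q := by
  induction hc generalizing q with
  | of_isUnit hu => exact (hu.map C).dvd
  | @mul p b e hp _ ih =>
    obtain ⟨s, hs, -, α, -, β, -, e1⟩ := h.comax_C hp hg (hg' p e hp)
    have h1 : C p ∣ q * g := (C_mul (a := p) (b := b) ▸ Dvd.intro _ rfl : C p ∣ C (p * b)).trans hdvd
    obtain ⟨q, rfl⟩ : C p ∣ q := by
      refine C_dvd_of_C_dvd_monic_mul hs ?_
      rw [e1, add_mul]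
      exact dvd_add (by rw [mul_assoc, mul_comm g]; exact h1.mul_left α)
        ((dvd_mul_left _ _).mul_right _)
    rw [C_mul, mul_assoc] at hdvd
    rw [C_mul]
    exact mul_dvd_mul_left _ (ih ((mul_dvd_mul_iff_left (C_ne_zero.2 hp.ne_zero)).1 hdvd))

theorem GrPID.comax_C_of_grPrimitive (h : GrPID ℛ) {c : R} (hc : GrProd ℛ c) {d e : P} {f : R[X]}
    (hf : f ∈ polyGrading ℛ l d) (hf' : GrPrimitive ℛ f) (hce : c ∈ ℛ e) :
    Comax l ℛ d f e (C c) := by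
  induction hc generalizing e with
  | of_isUnit hu =>
    obtain ⟨x, hx, e1⟩ := h.exists_inv hce hu
    exact ⟨1, monic_one, mem_congr one_mem_zero (by simp), 0, zero_mem _, C x,
      C_mem (mem_congr hx (by simp)), by rw [← C_mul, e1]; simp⟩
  | @mul p b e' hp _ ih =>
    have hb : b ∈ ℛ (e - e') := h.cancel _ _ _ p b hp.ne_zero hp.mem hce (by abel)
    obtain ⟨s, hs, hsm, α, hα, β, hβ, e1⟩ := h.comax_C hp hf (hf' p e' hp)
    obtain ⟨t, ht, htm, α', hα', β', hβ', e2⟩ := ih hb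
    refine ⟨s * t, hs.mul ht, ?_, α * t + β * C p * α', ?_, β * β', ?_, ?_⟩
    · rw [hs.natDegree_mul ht, add_smul]
      exact mul_mem_of_eq hsm htm rfl
    · rw [hs.natDegree_mul ht, add_smul]
      exact add_mem (mul_mem_of_eq hα htm (by abel))
        (mul_mem_of_eq (mul_mem_of_eq hβ (C_mem hp.mem) rfl) hα' (by abel))
    · rw [hs.natDegree_mul ht, add_smul]
      exact mul_mem_of_eq hβ hβ' (by abel)
    · rw [C_mul]
      linear_combination t * e1 + β * C p * e2

theorem GrPID.exists_primitive (h : GrPID ℛ) {d : P} {f : R[X]} (hf : f ∈ polyGrading ℛ l d)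
    (hf0 : f ≠ 0) : ∃ k, ∃ c ∈ ℛ k, ∃ g ∈ polyGrading ℛ l (d - k), c ≠ 0 ∧ GrPrimitive ℛ g ∧
      f = C c * g := by
  rcases h.exists_gcd f.support (d := fun i => d - i • l) (σ := f.coeff) hf with
    h0 | ⟨k, c, τ, w, hc, hτ, hw, e1, e2⟩
  · exact absurd (h0 _ (natDegree_mem_support_of_nonzero hf0)) (leadingCoeff_ne_zero.2 hf0)
  have hc0 : c ≠ 0 := by
    rintro rfl
    exact leadingCoeff_ne_zero.2 hf0 (by
      rw [leadingCoeff, e1 _ (natDegree_mem_support_of_nonzero hf0), zero_mul])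
  have hco : ∀ i, (∑ i ∈ f.support, monomial i (τ i)).coeff i =
      if i ∈ f.support then τ i else 0 := fun i => by
    simp [finsetSum_coeff, coeff_monomial]
  refine ⟨k, c, hc, ∑ i ∈ f.support, monomial i (τ i), fun i => ?_, hc0, ?_, ?_⟩
  · rw [hco]
    split_ifs
    · exact mem_congr (hτ i) (by abel)
    · exact zero_mem _
  · rintro p e hp hdvd
    rw [C_dvd_iff_dvd_coeff] at hdvd
    refine hp.not_unit (isUnit_of_dvd_one ?_)
    rw [← e2]
    refine Finset.dvd_sum fun i hi => Dvd.dvd.mul_left ?_ _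
    have := hdvd i
    rwa [hco, if_pos hi] at this
  · ext i
    rw [coeff_C_mul, hco]
    split_ifs with hi
    · exact e1 i hi
    · rw [notMem_support_iff.1 hi, mul_zero]

/-- An element of minimal degree of a homogeneous ideal divides all elements, up to constants. -/
theorem GrPID.exists_dvd_C_mul {𝒩 : P → AddSubgroup R[X]}
    (h𝒩 : IdealFam (polyGrading ℛ l) 𝒩) {e : P} {q : R[X]} (hq : q ∈ 𝒩 e) (hq0 : q ≠ 0)
    (hmin : ∀ d, ∀ f ∈ 𝒩 d, f ≠ 0 → q.natDegree ≤ f.natDegree) {d : P} {f : R[X]}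
    (hf : f ∈ 𝒩 d) : ∃ k, ∃ c ∈ ℛ k, c ≠ 0 ∧ q ∣ C c * f := by
  have key : ∀ (N : ℕ) (d : P) (f : R[X]), f ∈ 𝒩 d → f.degree < (N : WithBot ℕ) →
      ∃ k, ∃ c ∈ ℛ k, c ≠ 0 ∧ q ∣ C c * f := by
    intro N
    induction N with
    | zero =>
      intro d f _ hN
      have : f = 0 := by
        rw [← degree_eq_bot]
        rwa [Nat.cast_zero, Nat.WithBot.lt_zero_iff] at hN
      exact ⟨0, 1, one_mem_zero, one_ne_zero, by simp [this]⟩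
    | succ N ih =>
      intro d f hf hN
      by_cases hf0 : f = 0
      · exact ⟨0, 1, one_mem_zero, one_ne_zero, by simp [hf0]⟩
      obtain ⟨m, hm⟩ := Nat.exists_eq_add_of_le (hmin d f hf hf0)
      have hqc := h𝒩.le _ hq q.natDegree
      have hfc := h𝒩.le _ hf f.natDegree
      have hlq := leadingCoeff_ne_zero.2 hq0
      have hlf := leadingCoeff_ne_zero.2 hf0
      have hmem : C q.leadingCoeff * f - X ^ m * C f.leadingCoeff * q ∈
          𝒩 (e - q.natDegree • l + d) :=
        sub_mem (h𝒩.mul_mem (C_mem hqc) hf rfl)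
          (h𝒩.mul_mem (X_pow_mul_mem m (C_mem hfc) rfl) hq (by rw [hm, add_smul]; abel))
      have hlt : (C q.leadingCoeff * f - X ^ m * C f.leadingCoeff * q).degree < (N : WithBot ℕ) := by
        have h1 : (C q.leadingCoeff * f).degree = f.degree := degree_C_mul hlq
        have h2 : (X ^ m * C f.leadingCoeff * q).degree = f.degree := by
          rw [degree_mul, degree_mul, degree_X_pow, degree_C hlf, degree_eq_natDegree hq0,
            degree_eq_natDegree hf0, hm, add_zero, add_comm, Nat.cast_add]
        have h3 := degree_sub_lt_left (h1.trans h2.symm) (mul_ne_zero (C_ne_zero.2 hlq) hf0)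
          (by rw [leadingCoeff_mul, leadingCoeff_mul, leadingCoeff_mul, leadingCoeff_C, leadingCoeff_C,
            leadingCoeff_X_pow, one_mul, mul_comm])
        rw [h1, degree_eq_natDegree hf0] at h3
        rw [degree_eq_natDegree hf0, Nat.cast_lt] at hN
        exact h3.trans_le (Nat.cast_le.2 (Nat.le_of_lt_succ hN))
      obtain ⟨k, c, hc, hc0, hdvd⟩ := ih _ _ hmem hlt
      refine ⟨k + (e - q.natDegree • l), c * q.leadingCoeff, mul_mem_of_eq hc hqc rfl,
        mul_ne_zero hc0 hlq, ?_⟩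
      have : C (c * q.leadingCoeff) * f = C c * (C q.leadingCoeff * f -
          X ^ m * C f.leadingCoeff * q) + C c * (X ^ m * C f.leadingCoeff) * q := by
        rw [C_mul]; ring
      rw [this]
      exact dvd_add hdvd (dvd_mul_left _ _)
  exact key (f.natDegree + 1) d f hf (degree_le_natDegree.trans_lt (by exact_mod_cast Nat.lt_succ_self _))

/-- The homogeneous ideal generated by two homogeneous elements. -/
def pairIdeal {A : Type*} [CommRing A] (𝒜 : P → AddSubgroup A) (a : P) (f : A) (b : P) (g : A)
    (d : P) : AddSubgroup A where
  carrier := {x | ∃ α ∈ 𝒜 (d - a), ∃ β ∈ 𝒜 (d - b), x = α * f + β * g}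
  zero_mem' := ⟨0, zero_mem _, 0, zero_mem _, by simp⟩
  add_mem' := by
    rintro _ _ ⟨α, hα, β, hβ, rfl⟩ ⟨α', hα', β', hβ', rfl⟩
    exact ⟨_, add_mem hα hα', _, add_mem hβ hβ', by ring⟩
  neg_mem' := by
    rintro _ ⟨α, hα, β, hβ, rfl⟩
    exact ⟨_, neg_mem hα, _, neg_mem hβ, by ring⟩

theorem pairIdeal.idealFam {A : Type*} [CommRing A] {𝒜 : P → AddSubgroup A}
    [SetLike.GradedMonoid 𝒜] {a b : P} {f g : A} (hf : f ∈ 𝒜 a) (hg : g ∈ 𝒜 b) :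
    IdealFam 𝒜 (pairIdeal 𝒜 a f b g) where
  le d := by
    rintro _ ⟨α, hα, β, hβ, rfl⟩
    exact add_mem (mul_mem_of_eq hα hf (by abel)) (mul_mem_of_eq hβ hg (by abel))
  mul_mem := by
    rintro d e _ x _ hx ⟨α, hα, β, hβ, rfl⟩ rfl
    exact ⟨x * α, mul_mem_of_eq hx hα (by abel), x * β, mul_mem_of_eq hx hβ (by abel), by ring⟩

/-- A primitive homogeneous polynomial either decomposes, or generates a homogeneous ideal that
becomes maximal after inverting monic polynomials. -/
theorem GrPID.exists_factor_or (h : GrPID ℛ) {d : P} {f : R[X]} (hf : f ∈ polyGrading ℛ l d)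
    (hf0 : f ≠ 0) (hf' : GrPrimitive ℛ f) {e : P} {g : R[X]} (hg : g ∈ polyGrading ℛ l e) :
    (∃ k, ∃ u ∈ polyGrading ℛ l k, ∃ v ∈ polyGrading ℛ l (d - k), f = u * v ∧
      u.natDegree < f.natDegree ∧ v.natDegree < f.natDegree) ∨ f ∣ g ∨ Comax l ℛ d f e g := by
  have hI := pairIdeal.idealFam hf hg
  have hfI : f ∈ pairIdeal (polyGrading ℛ l) d f e g d :=
    ⟨1, mem_congr one_mem_zero (by abel), 0, zero_mem _, by ring⟩
  have hgI : g ∈ pairIdeal (polyGrading ℛ l) d f e g e :=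
    ⟨0, zero_mem _, 1, mem_congr one_mem_zero (by abel), by ring⟩
  let S : ℕ → Prop := fun n => ∃ k, ∃ q ∈ pairIdeal (polyGrading ℛ l) d f e g k, q ≠ 0 ∧
    q.natDegree = n
  have hS : ∃ n, S n := ⟨_, d, f, hfI, hf0, rfl⟩
  classical
  obtain ⟨k, q, hq, hq0, hqn⟩ := Nat.find_spec hS
  have hmin : ∀ d', ∀ f' ∈ pairIdeal (polyGrading ℛ l) d f e g d', f' ≠ 0 →
      q.natDegree ≤ f'.natDegree := fun d' f' hf' h0 => by
    rw [hqn]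
    exact Nat.find_min' hS ⟨d', f', hf', h0, rfl⟩
  obtain ⟨b, c, hc, q', hq', hc0, hprim, rfl⟩ := h.exists_primitive (hI.le _ hq) hq0
  have hdvd : ∀ d' f', f' ∈ pairIdeal (polyGrading ℛ l) d f e g d' → q' ∣ f' := by
    intro d' f' hm
    obtain ⟨b', c', hc', hc0', r, hr⟩ := GrPID.exists_dvd_C_mul hI hq hq0 hmin hm
    have h1 : C c' ∣ C c * r := by
      refine h.C_dvd_of_C_dvd_mul (h.factor _ _ hc' hc0') hq' hprim ⟨f', ?_⟩
      rw [hr]; ring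
    obtain ⟨v, hv⟩ := h1
    refine ⟨v, mul_left_cancel₀ (C_ne_zero.2 hc0') ?_⟩
    rw [hr, mul_left_comm, ← hv]; ring
  obtain ⟨v, hv⟩ := hdvd d f hfI
  have hq'0 : q' ≠ 0 := by rintro rfl; simp at hq0
  have hv0 : v ≠ 0 := by rintro rfl; simp [hf0] at hv
  have hvm : v ∈ polyGrading ℛ l (d - (k - b)) :=
    h.polyGrading_cancel hq'0 hq' (hv ▸ hf) (by abel)
  have hdeg : f.natDegree = q'.natDegree + v.natDegree := by rw [hv, natDegree_mul hq'0 hv0]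
  rcases Nat.eq_zero_or_pos q'.natDegree with h0 | hpos
  · right; right
    obtain ⟨c', hc'⟩ : ∃ c', C c * q' = C c' := by
      rw [eq_C_of_natDegree_eq_zero h0, ← C_mul]; exact ⟨_, rfl⟩
    rw [hc'] at hq hq0
    have hck : c' ∈ ℛ k := by simpa using hI.le _ hq 0
    obtain ⟨s, hs, hsm, α, hα, β, hβ, e1⟩ :=
      h.comax_C_of_grPrimitive (h.factor _ _ hck (C_ne_zero.1 hq0)) hf hf' hck
    obtain ⟨α', hα', β', hβ', e2⟩ := hq
    refine ⟨s, hs, hsm, α + β * α', add_mem hα (mul_mem_of_eq hβ hα' (by abel)), β * β',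
      mul_mem_of_eq hβ hβ' (by abel), ?_⟩
    rw [e1, e2]; ring
  rcases Nat.eq_zero_or_pos v.natDegree with h0 | hpos'
  · right; left
    obtain ⟨c', rfl⟩ : ∃ c', v = C c' := ⟨_, eq_C_of_natDegree_eq_zero h0⟩
    have hc' : c' ∈ ℛ (d - (k - b)) := by simpa using hvm 0
    have hu : IsUnit c' := by
      rcases h.factor _ _ hc' (C_ne_zero.1 hv0) with hu | ⟨hp, _⟩
      · exact hu
      · refine absurd ?_ (hf' _ _ hp)
        rw [hv, C_mul]
        exact (dvd_mul_right _ _).mul_left _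
    rw [hv, (hu.map C).mul_right_dvd]
    exact hdvd e g hgI
  · exact Or.inl ⟨k - b, q', hq', v, hvm, hv, by omega, by omega⟩

variable {B : Type*} [CommRing B] [Algebra R[X] B] [IsLocalization (monicSubmonoid ℛ l) B]

variable (ℛ l) in
theorem monicSubmonoid_le_nonZeroDivisors : monicSubmonoid ℛ l ≤ nonZeroDivisors R[X] := fun _ hs =>
  mem_nonZeroDivisors_of_ne_zero hs.1.ne_zero

variable (B) in
theorem GrPID.grProd_of_comax {e : P} {g : R[X]} (hg : g ∈ polyGrading ℛ l e) (hg0 : g ≠ 0)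
    (hdvd : ∀ d, ∀ f ∈ polyGrading ℛ l d, g ∣ f ∨ Comax l ℛ d f e g) :
    GrProd (locGrading B (grDenom_monicSubmonoid (ℛ := ℛ) (l := l))) (algebraMap R[X] B g) := by
  have hinj := IsLocalization.injective B (monicSubmonoid_le_nonZeroDivisors ℛ l)
  by_cases hu : IsUnit (algebraMap R[X] B g)
  · exact .of_isUnit hu
  rw [← mul_one (algebraMap R[X] B g)]
  refine .mul (e := e) ⟨algebraMap_mem_locGrading _ _ _ hg, (map_ne_zero_iff _ hinj).2 hg0, hu, ?_⟩
    (.of_isUnit isUnit_one)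
  rintro d a ⟨s, hs, f, hf, e1⟩
  obtain ⟨s', hs', hss⟩ := exists_inv_mem_locGrading (B := B) grDenom_monicSubmonoid hs
  have hss' : a = s' * algebraMap R[X] B f := by rw [← e1, ← mul_assoc, mul_comm s', hss, one_mul]
  rcases hdvd _ f hf with hd | ⟨t, ht, htm, α, hα, β, hβ, e2⟩
  · left
    rw [hss']
    exact (_root_.map_dvd _ hd).mul_left _
  · right
    obtain ⟨t', ht', htt⟩ := exists_inv_mem_locGrading (B := B) grDenom_monicSubmonoid
      (show t ∈ monicSubmonoid ℛ l from ⟨ht, htm⟩)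
    refine ⟨t' * algebraMap R[X] B (α * s), mul_mem_of_eq ht' (algebraMap_mem_locGrading _ _ _
        (mul_mem_of_eq hα hs.2 rfl)) (by abel),
      t' * algebraMap R[X] B β, mul_mem_of_eq ht' (algebraMap_mem_locGrading _ _ _ hβ) (by abel), ?_⟩
    rw [← htt, e2, map_add, map_mul, map_mul, map_mul, ← e1]
    ring

variable (B) in
theorem GrPID.grProd_C (h : GrPID ℛ) {c : R} (hc : GrProd ℛ c) :
    GrProd (locGrading B (grDenom_monicSubmonoid (ℛ := ℛ) (l := l))) (algebraMap R[X] B (C c)) := by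
  induction hc with
  | of_isUnit hu => exact .of_isUnit ((hu.map C).map _)
  | mul hp _ ih =>
    rw [C_mul, map_mul]
    refine .mul_mul (GrPID.grProd_of_comax B (C_mem hp.mem) (C_ne_zero.2 hp.ne_zero)
      fun d f hf => ?_) ih
    exact or_iff_not_imp_left.2 fun hd => h.comax_C hp hf hd

variable (B) in
theorem GrPID.grProd_algebraMap (h : GrPID ℛ) {d : P} {f : R[X]} (hf : f ∈ polyGrading ℛ l d)
    (hf0 : f ≠ 0) :
    GrProd (locGrading B (grDenom_monicSubmonoid (ℛ := ℛ) (l := l))) (algebraMap R[X] B f) := by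
  induction hn : f.natDegree using Nat.strong_induction_on generalizing f d with
  | _ n ih =>
    obtain ⟨k, c, hc, g, hg, hc0, hprim, rfl⟩ := h.exists_primitive hf hf0
    have hg0 : g ≠ 0 := by rintro rfl; simp at hf0
    have hgn : g.natDegree = n := by rw [← hn, natDegree_C_mul hc0]
    rw [map_mul]
    refine (h.grProd_C B (h.factor _ _ hc hc0)).mul_mul ?_
    by_cases hfac : ∃ b, ∃ u ∈ polyGrading ℛ l b, ∃ v ∈ polyGrading ℛ l (d - k - b), g = u * v ∧
      u.natDegree < g.natDegree ∧ v.natDegree < g.natDegree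
    · obtain ⟨b, u, hu, v, hv, rfl, h1, h2⟩ := hfac
      rw [map_mul]
      exact (ih _ (hgn ▸ h1) hu (left_ne_zero_of_mul hg0) rfl).mul_mul
        (ih _ (hgn ▸ h2) hv (right_ne_zero_of_mul hg0) rfl)
    · refine GrPID.grProd_of_comax B hg hg0 fun d' f' hf' => ?_
      refine ((h.exists_factor_or hg hg0 hprim hf').resolve_left hfac).imp_right ?_
      rintro ⟨s, hs, hsm, α, hα, β, hβ, e1⟩
      exact ⟨s, hs, hsm, β, hβ, α, hα, by rw [e1, add_comm]⟩

variable (B) in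
/-- Inverting the homogeneous monic polynomials over a graded principal ideal domain yields a graded
principal ideal domain. -/
theorem GrPID.locGrading (h : GrPID ℛ) :
    GrPID (locGrading B (grDenom_monicSubmonoid (ℛ := ℛ) (l := l))) where
  cancel := by
    have hinj := IsLocalization.injective B (monicSubmonoid_le_nonZeroDivisors ℛ l)
    rintro d e _ x y hx ⟨s, hs, a, ha, e1⟩ ⟨t, ht, c, hc, e2⟩ rfl
    obtain ⟨⟨b, u⟩, hb⟩ := IsLocalization.surj (monicSubmonoid ℛ l) y
    dsimp only at hb
    have ha0 : a ≠ 0 := by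
      rintro rfl
      rw [map_zero] at e1
      exact hx ((IsLocalization.map_units B (⟨s, hs⟩ : monicSubmonoid ℛ l)).mul_right_eq_zero.1 e1)
    have key : a * t * b = s * u * c := by
      apply hinj
      simp only [map_mul]
      rw [← e1, ← e2, ← hb]
      ring
    refine ⟨u, u.2, b, ?_, by rw [mul_comm, hb]⟩
    refine h.polyGrading_cancel (mul_ne_zero ha0 ht.1.ne_zero) (mul_mem_of_eq ha ht.2 rfl)
      (k := d + e + s.natDegree • l + t.natDegree • l + (u : R[X]).natDegree • l) ?_ (by abel)
    rw [key]
    exact mul_mem_of_eq (mul_mem_of_eq hs.2 u.2.2 rfl) hc (by abel)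
  factor := by
    rintro d x ⟨s, hs, a, ha, e1⟩ hx
    obtain ⟨s', -, hss⟩ := exists_inv_mem_locGrading (B := B) grDenom_monicSubmonoid hs
    have hx' : x = s' * algebraMap R[X] B a := by rw [← e1, ← mul_assoc, mul_comm s', hss, one_mul]
    rw [hx']
    refine (h.grProd_algebraMap B ha ?_).unit_mul (IsUnit.of_mul_eq_one _ (by rw [mul_comm, hss]))
    rintro rfl
    exact hx (by rw [hx', map_zero, mul_zero])

end MonicLocalization

section Gluing

variable {P : Type*} [AddCommGroup P] {B C : Type*} [CommRing B] [CommRing C]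
  {ℬ : P → AddSubgroup B} {𝒞 : P → AddSubgroup C} [SetLike.GradedMonoid ℬ] [SetLike.GradedMonoid 𝒞]
  {ι κ : Type*} [Fintype ι] [Fintype κ] [DecidableEq ι] [DecidableEq κ] {a : ι → P} {b : κ → P}

/-- A graded projective module over `C` which becomes free after inverting `f` is defined over a
subring `B` on which `f` and the denominators `u` are comaximal. -/
theorem GrFree.of_comaximal (hB : AllFree ℬ) (θ : B →+* C) (hθ : ∀ d, ∀ x ∈ ℬ d, θ x ∈ 𝒞 d)
    (hinj : Function.Injective θ) {E : Matrix ι ι C} (hE : HomMat 𝒞 a a E) (hE2 : E * E = E)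
    {X : Matrix ι κ C} {Y : Matrix κ ι C} (hX : HomMat 𝒞 a b X) (hY : HomMat 𝒞 b a Y)
    {u f α β : B} {d : P} (hf : f ∈ ℬ 0) (hu : u ∈ ℬ d) (hα : α ∈ ℬ (-d)) (hβ : β ∈ ℬ 0)
    (h1 : α * u + β * f = 1) (hXY : X * Y = θ f • E) (hYX : Y * X = θ f • 1) (hEX : E * X = X)
    (hYE : Y * E = Y)
    {E₀ : Matrix ι ι B} (hE₀ : HomMat ℬ (fun i => a i + d) a E₀) (hE₀' : E₀.map θ = θ u • E)
    {X₀ : Matrix ι κ B} (hX₀ : HomMat ℬ a b X₀) (hX₀' : X₀.map θ = X)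
    {Y₀ : Matrix κ ι B} (hY₀ : HomMat ℬ (fun i => b i + d) a Y₀) (hY₀' : Y₀.map θ = θ u • Y) :
    GrFree 𝒞 a E := by
  let E' := Matrix.fromBlocks (α • E₀) (β • X₀) (α • Y₀) ((β * f) • (1 : Matrix κ κ B))
  let p := Matrix.fromRows E Y
  let q := Matrix.fromCols (θ (α * u) • E) (θ β • X)
  have hθ1 : θ (α * u) + θ (β * f) = 1 := by rw [← map_add, h1, map_one]
  have hpq : E'.map θ = p * q := by
    rw [Matrix.fromRows_mul_fromCols, Matrix.fromBlocks_map]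
    simp only [Matrix.mul_smul, hE2, hEX, hYE, hYX, smul_smul]
    congr 1
    · ext i j
      have := congrFun (congrFun hE₀' i) j
      simp only [Matrix.map_apply, Matrix.smul_apply, smul_eq_mul, map_mul] at this ⊢
      rw [this]; ring
    · ext i j
      have := congrFun (congrFun hX₀' i) j
      simp only [Matrix.map_apply, Matrix.smul_apply, smul_eq_mul, map_mul] at this ⊢
      rw [this]
    · ext i j
      have := congrFun (congrFun hY₀' i) j
      simp only [Matrix.map_apply, Matrix.smul_apply, smul_eq_mul, map_mul] at this ⊢
      rw [this]; ring
    · ext i j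
      by_cases h : i = j <;> simp [h]
  have hqp : q * p = E := by
    rw [Matrix.fromCols_mul_fromRows, Matrix.smul_mul, Matrix.smul_mul, hE2, hXY, smul_smul,
      ← map_mul, ← add_smul, hθ1, one_smul]
  have hpE : p * E = p := by rw [Matrix.fromRows_mul, hE2, hYE]
  have hE'2 : E' * E' = E' := by
    apply Matrix.map_injective hinj
    dsimp only
    rw [Matrix.map_mul, hpq, Matrix.mul_assoc, ← Matrix.mul_assoc q, hqp, ← Matrix.mul_assoc, hpE]
  have hE' : HomMat ℬ (Sum.elim a b) (Sum.elim a b) E' := by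
    rintro (i | i) (j | j)
    · exact mul_mem_of_eq hα (hE₀ i j) (by simp; abel)
    · exact mul_mem_of_eq hβ (hX₀ i j) (by simp)
    · exact mul_mem_of_eq hα (hY₀ i j) (by simp; abel)
    · exact mul_mem_of_eq (mul_mem_of_eq hβ hf rfl) (HomMat.one (𝒜 := ℬ) (a := b) i j) (by simp)
  refine GrFree.of_grIso (b := Sum.elim a b) (F := E'.map θ)
    ⟨q, p, ?_, ?_, hqp, hpq.symm⟩ (GrFree.map θ hθ (hB.apply hE' hE'2)) hE2
  · rintro i (j | j)
    · exact mul_mem_of_eq (hθ _ _ (mul_mem_of_eq hα hu rfl)) (hE i j) (by simp)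
    · exact mul_mem_of_eq (hθ _ _ hβ) (hX i j) (by simp)
  · rintro (i | i) j
    · exact hE i j
    · exact hY i j

end Gluing

section Laurent

variable {P : Type*} [AddCommGroup P] {A : Type*} [CommRing A] {𝒜 : P → AddSubgroup A}
  [SetLike.GradedMonoid 𝒜] {l : P}

theorem grDenom_powers_X [Nontrivial A] :
    GrDenom (polyGrading 𝒜 l) (Submonoid.powers (X : A[X])) fun s => s.natDegree • l where
  mem := by
    rintro _ ⟨n, rfl⟩
    exact X_pow_mem n (by simp)
  mul := by
    rintro _ ⟨n, rfl⟩ _ ⟨m, rfl⟩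
    simp [← pow_add, add_smul]

theorem reflect_mem {N : ℕ} {d e : P} {f : A[X]} (hf : f ∈ polyGrading 𝒜 l d)
    (hN : f.natDegree ≤ N) (h : d - N • l = e) : reflect N f ∈ polyGrading 𝒜 (-l) e := fun i => by
  rw [coeff_reflect]
  by_cases hi : i ≤ N
  · rw [revAt_le hi]
    refine mem_congr (hf _) ?_
    obtain ⟨k, rfl⟩ := Nat.exists_eq_add_of_le hi
    rw [← h, Nat.add_sub_cancel_left, add_smul, smul_neg]; abel
  · rw [revAt_eq_self_of_lt (by omega), coeff_eq_zero_of_natDegree_lt (by omega)]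
    exact zero_mem _

variable {C : Type*} [CommRing C] [Algebra A[X] C] [IsLocalization.Away (X : A[X]) C]

variable (A C) in
/-- The inclusion of `A[X]` into the Laurent polynomials sending `X` to the inverse of the
variable. -/
noncomputable def invHom : A[X] →+* C :=
  eval₂RingHom ((algebraMap A[X] C).comp Polynomial.C) (IsLocalization.Away.invSelf (X : A[X]))

theorem mul_invHom_X : algebraMap A[X] C X * invHom A C X = 1 := by
  rw [invHom, coe_eval₂RingHom, eval₂_X]
  exact IsLocalization.Away.mul_invSelf _

theorem invHom_reflect {N : ℕ} {f : A[X]} (hN : f.natDegree ≤ N) :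
    invHom A C (reflect N f) = algebraMap A[X] C f * invHom A C X ^ N := by
  let x := algebraMap A[X] C X
  let _ : Invertible x := ⟨invHom A C X, by rw [mul_comm]; exact mul_invHom_X, mul_invHom_X⟩
  have h := eval₂_reflect_mul_pow ((algebraMap A[X] C).comp Polynomial.C) x N f hN
  have h1 : eval₂ ((algebraMap A[X] C).comp Polynomial.C) x f = algebraMap A[X] C f := by
    rw [← hom_eval₂, eval₂_C_X]
  have h2 : ⅟x = IsLocalization.Away.invSelf (X : A[X]) := by
    change invHom A C X = _
    rw [invHom, coe_eval₂RingHom, eval₂_X]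
  rw [h1, h2] at h
  rw [← h]
  change invHom A C (reflect N f) = invHom A C (reflect N f) * _ * _
  rw [mul_assoc, ← mul_pow, mul_invHom_X, one_pow, mul_one]

variable [Nontrivial A]

variable (A C) in
theorem algebraMap_X_injective : Function.Injective (algebraMap A[X] C) :=
  IsLocalization.injective C (M := Submonoid.powers (X : A[X]))
    (Submonoid.powers_le.2 (X_mem_nonzeroDivisors))

variable (A C) in
theorem invHom_injective : Function.Injective (invHom A C) := by
  rw [injective_iff_map_eq_zero]
  intro f hf
  have hr : (reflect f.natDegree f).natDegree ≤ f.natDegree := by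
    refine natDegree_le_iff_coeff_eq_zero.2 fun n hn => ?_
    rw [coeff_reflect, revAt_eq_self_of_lt hn, coeff_eq_zero_of_natDegree_lt hn]
  have h1 : reflect f.natDegree (reflect f.natDegree f) = f := by
    ext i
    rw [coeff_reflect, coeff_reflect, revAt_invol]
  have h2 := invHom_reflect (C := C) hr
  rw [h1, hf] at h2
  have h3 : algebraMap A[X] C (reflect f.natDegree f) = 0 := by
    have := congrArg (· * algebraMap A[X] C X ^ f.natDegree) h2
    simpa [mul_assoc, ← mul_pow, mul_comm (invHom A C X), mul_invHom_X] using this.symm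
  rw [map_eq_zero_iff _ (algebraMap_X_injective A C)] at h3
  rwa [reflect_eq_zero_iff] at h3

variable (𝒜 l C) in
/-- The grading of the Laurent polynomials. -/
noncomputable abbrev laurentGrading : P → AddSubgroup C := locGrading C (grDenom_powers_X (𝒜 := 𝒜) (l := l))

theorem invHom_X_mem : invHom A C X ∈ laurentGrading 𝒜 l C (-l) :=
  ⟨X, ⟨1, pow_one X⟩, 1, mem_congr one_mem_zero (by simp), by rw [mul_invHom_X, map_one]⟩

theorem invHom_mem {d : P} {f : A[X]} (hf : f ∈ polyGrading 𝒜 (-l) d) :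
    invHom A C f ∈ laurentGrading 𝒜 l C d := by
  refine eval₂_mem (𝒜 := 𝒜) (l := -l) _ (fun e x hx => ?_) ?_ hf
  · exact algebraMap_mem_locGrading _ _ _ (C_mem hx)
  · have := invHom_X_mem (𝒜 := 𝒜) (l := l) (C := C)
    rwa [invHom, coe_eval₂RingHom, eval₂_X] at this

theorem hasDenom_invHom : HasDenom (Submonoid.powers (X : A[X])) (fun s => s.natDegree • (-l))
    (RingHom.id A[X]) (invHom A C) (polyGrading 𝒜 (-l)) (laurentGrading 𝒜 l C) where
  exists_mul := by
    rintro d z ⟨_, ⟨n, rfl⟩, c, hc, e⟩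
    refine ⟨X ^ c.natDegree, ⟨_, rfl⟩, reflect (c.natDegree + n) c,
      reflect_mem hc (Nat.le_add_right _ _) ?_, ?_⟩
    · simp only [natDegree_X_pow, add_smul, smul_neg]; abel
    · rw [invHom_reflect (Nat.le_add_right _ _), ← e, RingHom.id_apply, map_pow, map_pow, pow_add]
      have : algebraMap A[X] C X ^ n * invHom A C X ^ n = 1 := by
        rw [← mul_pow, mul_invHom_X, one_pow]
      linear_combination (-z * invHom A C X ^ c.natDegree) * this

theorem GrFree.laurent (hB : AllFree (polyGrading 𝒜 (-l))) {ι : Type*} [Fintype ι] [DecidableEq ι]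
    {a : ι → P} {E : Matrix ι ι C} (hE : HomMat (laurentGrading 𝒜 l C) a a E) (hE2 : E * E = E)
    {f : A[X]} (hf : f.Monic) (hfm : f ∈ polyGrading 𝒜 l (f.natDegree • l))
    (hfree : FreeUpTo (laurentGrading 𝒜 l C) a E (algebraMap A[X] C f) (f.natDegree • l)) :
    GrFree (laurentGrading 𝒜 l C) a E := by
  obtain ⟨k, b, U, Y, hU, hY, hUY, hYU, hEU, hYE⟩ := hfree
  let τ := invHom A C X
  let T := algebraMap A[X] C X
  have hTτ : T * τ = 1 := mul_invHom_X
  have hT : T ∈ laurentGrading 𝒜 l C l := algebraMap_mem_locGrading _ _ _ X_mem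
  have hτ : τ ∈ laurentGrading 𝒜 l C (-l) := invHom_X_mem
  have hpow : ∀ n, T ^ n * τ ^ n = 1 := fun n => by rw [← mul_pow, hTτ, one_pow]
  let N := f.natDegree
  let g := reflect N f
  have hg : g ∈ polyGrading 𝒜 (-l) 0 := reflect_mem hfm le_rfl (sub_self _)
  have hgθ : invHom A C g = algebraMap A[X] C f * τ ^ N := invHom_reflect le_rfl
  have hg0 : g.coeff 0 = 1 := by rw [coeff_reflect, revAt_le (Nat.zero_le _)]; exact hf
  obtain ⟨c, M₀, hM₀, hM⟩ : ∃ (c : ℕ) (M₀ : Matrix (ι ⊕ Fin k) (ι ⊕ Fin k) A[X]),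
      HomMat (polyGrading 𝒜 (-l)) (fun i => Sum.elim a b i + c • (-l)) (Sum.elim a b) M₀ ∧
      τ ^ c • Matrix.fromBlocks E (τ ^ N • U) Y 0 = M₀.map (invHom A C) := by
    have hM : HomMat (laurentGrading 𝒜 l C) (Sum.elim a b) (Sum.elim a b)
        (Matrix.fromBlocks E (τ ^ N • U) Y 0) := by
      rintro (i | i) (j | j)
      · exact hE i j
      · exact mul_mem_of_eq (pow_mem_of_eq hτ N rfl) (hU i j) (by simp [N]; abel)
      · exact hY i j
      · exact zero_mem _
    obtain ⟨_, ⟨c, rfl⟩, M₀, hM₀, e⟩ := hasDenom_invHom.exists_matrix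
      (grDenom_powers_X (𝒜 := 𝒜) (l := -l)) (fun _ _ h => h) hM
    refine ⟨c, M₀, by simpa using hM₀, ?_⟩
    rw [← e, RingHom.id_apply]
    simp [τ]
  have hM11 : ∀ i j, invHom A C (M₀ (.inl i) (.inl j)) = τ ^ c * E i j := fun i j => by
    simpa using (congrFun (congrFun hM (.inl i)) (.inl j)).symm
  have hM12 : ∀ i j, invHom A C (M₀ (.inl i) (.inr j)) = τ ^ c * (τ ^ N * U i j) := fun i j => by
    simpa using (congrFun (congrFun hM (.inl i)) (.inr j)).symm
  have hM21 : ∀ i j, invHom A C (M₀ (.inr i) (.inl j)) = τ ^ c * Y i j := fun i j => by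
    simpa using (congrFun (congrFun hM (.inr i)) (.inl j)).symm
  have hXc : ∀ n, (X ^ n : A[X]) ∈ polyGrading 𝒜 (-l) (n • (-l)) := fun n => X_pow_mem n rfl
  have hgX : g = X * g.divX + 1 := by
    conv_lhs => rw [← X_mul_divX_add g, hg0, C_1]
  have hdiv : g.divX ∈ polyGrading 𝒜 (-l) l := fun i => by
    rw [coeff_divX]
    exact mem_congr (hg (i + 1)) (by rw [add_smul, one_smul]; abel)
  refine GrFree.of_comaximal hB (invHom A C) (fun d x hx => invHom_mem hx)
    (invHom_injective A C) hE hE2 (X := (τ ^ c * τ ^ N) • U) (Y := T ^ c • Y)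
    (b := fun j => b j + c • l) (u := X ^ (2 * c)) (d := (2 * c) • (-l)) (f := g)
    (α := (-g.divX) ^ (2 * c)) (β := ∑ i ∈ Finset.range (2 * c), (1 - g) ^ i)
    ?_ ?_ hg (hXc _) (pow_mem_of_eq (neg_mem hdiv) _ (by simp))
    (sum_mem fun i _ => pow_mem_of_eq (sub_mem one_mem_zero hg) i (by simp)) ?_ ?_ ?_ ?_ ?_
    (E₀ := (X ^ c : A[X]) • M₀.submatrix Sum.inl Sum.inl) ?_ ?_
    (X₀ := M₀.submatrix Sum.inl Sum.inr) ?_ ?_ (Y₀ := M₀.submatrix Sum.inr Sum.inl) ?_ ?_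
  · intro i j
    exact mul_mem_of_eq (mul_mem_of_eq (pow_mem_of_eq hτ c rfl) (pow_mem_of_eq hτ N rfl) rfl)
      (hU i j) (by simp [N]; abel)
  · intro i j
    exact mul_mem_of_eq (pow_mem_of_eq hT c rfl) (hY i j) (by dsimp only; abel)
  · have e1 : (∑ i ∈ Finset.range (2 * c), (1 - g) ^ i) * g = 1 - (1 - g) ^ (2 * c) := by
      simpa using geom_sum_mul_neg (1 - g) (2 * c)
    rw [e1, show 1 - g = (X : A[X]) * (-g.divX) by linear_combination -hgX, mul_pow]
    ring
  · rw [Matrix.smul_mul, Matrix.mul_smul, hUY, smul_smul, smul_smul, hgθ]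
    congr 1
    linear_combination (algebraMap A[X] C f * τ ^ N) * hpow c
  · rw [Matrix.smul_mul, Matrix.mul_smul, hYU, smul_smul, smul_smul, hgθ]
    congr 1
    linear_combination (algebraMap A[X] C f * τ ^ N) * hpow c
  · rw [Matrix.mul_smul, hEU]
  · rw [Matrix.smul_mul, hYE]
  · intro i j
    exact mul_mem_of_eq (hXc c) (hM₀ (.inl i) (.inl j)) (by simp [two_mul, add_smul]; abel)
  · ext i j
    simp only [Matrix.map_apply, Matrix.smul_apply, smul_eq_mul, map_mul, Matrix.submatrix_apply,
      hM11, map_pow]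
    ring
  · intro i j
    exact mem_congr (hM₀ (.inl i) (.inr j)) (by simp; abel)
  · ext i j
    simp only [Matrix.map_apply, Matrix.smul_apply, smul_eq_mul, Matrix.submatrix_apply, hM12]
    ring
  · intro i j
    exact mem_congr (hM₀ (.inr i) (.inl j)) (by simp [two_mul, add_smul])
  · ext i j
    simp only [Matrix.map_apply, Matrix.smul_apply, smul_eq_mul, Matrix.submatrix_apply, hM21,
      map_pow]
    linear_combination (-τ ^ c * Y i j) * hpow c

end Laurent

section MonoidAlgebra

variable {P : Type*} [AddCommGroup P] {R : Type*} [CommRing R] {Λ : Type*} [AddCommMonoid Λ]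

/-- The grading of `R[Λ]` in which the monomial of exponent `m` is homogeneous of degree `deg m`. -/
def algGrading (ℛ : P → AddSubgroup R) (deg : Λ →+ P) (d : P) :
    AddSubgroup (AddMonoidAlgebra R Λ) where
  carrier := {f | ∀ m, f.coeff m ∈ ℛ (d - deg m)}
  zero_mem' := fun m => by simp
  add_mem' := fun hf hg m => add_mem (hf m) (hg m)
  neg_mem' := fun hf m => neg_mem (hf m)

variable {ℛ : P → AddSubgroup R} {deg : Λ →+ P}

theorem single_mem {d : P} {m : Λ} {x : R} (h : x ∈ ℛ (d - deg m)) :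
    AddMonoidAlgebra.single m x ∈ algGrading ℛ deg d := fun m' => by
  classical
  rw [AddMonoidAlgebra.coeff_single, Finsupp.single_apply]
  split_ifs with hm
  · subst hm; exact h
  · exact zero_mem _

theorem singleZeroRingHom_mem {d : P} : ∀ x ∈ ℛ d,
    (AddMonoidAlgebra.singleZeroRingHom x : AddMonoidAlgebra R Λ) ∈ algGrading ℛ deg d :=
  fun x hx => single_mem (by simpa using hx)

theorem eq_sum_single (f : AddMonoidAlgebra R Λ) :
    f = ∑ m ∈ f.coeff.support, AddMonoidAlgebra.single m (f.coeff m) :=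
  f.sum_coeff_single.symm

instance algGrading.gradedMonoid [SetLike.GradedMonoid ℛ] :
    SetLike.GradedMonoid (algGrading ℛ deg) where
  one_mem := single_mem (by simpa using one_mem_zero)
  mul_mem d e f g hf hg := by
    rw [eq_sum_single f, eq_sum_single g, Finset.sum_mul_sum]
    refine sum_mem fun m _ => sum_mem fun n _ => ?_
    rw [AddMonoidAlgebra.single_mul_single]
    exact single_mem (mul_mem_of_eq (hf m) (hg n) (by rw [map_add]; abel))

theorem mapRingHom_algGrading_mem {R' : Type*} [CommRing R'] {ℛ' : P → AddSubgroup R'}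
    (φ : R →+* R') (hφ : ∀ d, ∀ x ∈ ℛ d, φ x ∈ ℛ' d) {d : P} :
    ∀ f ∈ algGrading ℛ deg d, AddMonoidAlgebra.mapRingHom Λ φ f ∈ algGrading ℛ' deg d := by
  intro f hf m
  rw [AddMonoidAlgebra.coeff_mapRingHom]
  exact hφ _ _ (hf m)

theorem mapRingHom_injective {R' : Type*} [CommRing R'] {φ : R →+* R'}
    (hφ : Function.Injective φ) : Function.Injective (AddMonoidAlgebra.mapRingHom Λ φ) := by
  intro f g h
  ext m
  apply hφ
  have := congrArg (fun f => f.coeff m) h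
  simpa using this

theorem HasDenom.algebra [SetLike.GradedMonoid ℛ] {S : Submonoid R} {δ : R → P} {R' : Type*}
    [CommRing R'] {φ : R →+* R'} {ℛ' : P → AddSubgroup R'}
    (h : HasDenom S δ (RingHom.id R) φ ℛ ℛ') (hS : GrDenom ℛ S δ) :
    HasDenom S δ AddMonoidAlgebra.singleZeroRingHom (AddMonoidAlgebra.mapRingHom Λ φ)
      (algGrading ℛ deg) (algGrading ℛ' deg) where
  exists_mul d z hz := by
    obtain ⟨s, hs, c, hc, e⟩ := h.exists_family hS (fun _ _ hx => hx) z.coeff.support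
      (d := fun m => d - deg m) (z := z.coeff) (fun m _ => hz m)
    refine ⟨s, hs, ∑ m ∈ z.coeff.support, AddMonoidAlgebra.single m (c m), ?_, ?_⟩
    · exact sum_mem fun m hm => single_mem (mem_congr (hc m hm) (by abel))
    · conv_lhs => rw [eq_sum_single z]
      rw [map_sum, Finset.mul_sum]
      refine Finset.sum_congr rfl fun m hm => ?_
      rw [AddMonoidAlgebra.mapRingHom_single, ← e m hm]
      simp [AddMonoidAlgebra.singleZeroRingHom, AddMonoidAlgebra.single_mul_single]

variable (R Λ) in
/-- The canonical map `R[Λ][X] → R[X][Λ]`. -/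
noncomputable def swapHom :
    (AddMonoidAlgebra R Λ)[X] →+* AddMonoidAlgebra R[X] Λ :=
  eval₂RingHom (AddMonoidAlgebra.mapRingHom Λ C) (AddMonoidAlgebra.singleZeroRingHom X)

theorem swapHom_monomial (n : ℕ) (m : Λ) (x : R) :
    swapHom R Λ (monomial n (AddMonoidAlgebra.single m x)) =
      AddMonoidAlgebra.single m (monomial n x) := by
  simp [swapHom, eval₂_monomial, AddMonoidAlgebra.singleZeroRingHom, AddMonoidAlgebra.single_pow,
    AddMonoidAlgebra.single_mul_single, C_mul_X_pow_eq_monomial]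

theorem coeff_swapHom (F : (AddMonoidAlgebra R Λ)[X]) (m : Λ) (n : ℕ) :
    ((swapHom R Λ F).coeff m).coeff n = (F.coeff n).coeff m := by
  classical
  induction F using Polynomial.induction_on' with
  | add F G hF hG => simp [hF, hG]
  | monomial k f =>
    induction f using AddMonoidAlgebra.induction_linear with
    | zero => simp
    | add f g hf hg => rw [map_add, map_add]; simp [hf, hg]
    | single m' x =>
      rw [swapHom_monomial, AddMonoidAlgebra.coeff_single, Finsupp.single_apply, coeff_monomial]
      split_ifs with h1 h2 h2 <;> simp [h1, h2, coeff_monomial, AddMonoidAlgebra.coeff_single]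

theorem swapHom_injective : Function.Injective (swapHom R Λ) := by
  intro F G h
  ext n m
  rw [← coeff_swapHom, h, coeff_swapHom]

theorem swapHom_surjective : Function.Surjective (swapHom R Λ) := by
  intro f
  induction f using AddMonoidAlgebra.induction_linear with
  | zero => exact ⟨0, map_zero _⟩
  | add f g hf hg =>
    obtain ⟨F, rfl⟩ := hf
    obtain ⟨G, rfl⟩ := hg
    exact ⟨F + G, map_add _ _ _⟩
  | single m p =>
    induction p using Polynomial.induction_on' with
    | add p q hp hq =>
      obtain ⟨F, hF⟩ := hp
      obtain ⟨G, hG⟩ := hq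
      exact ⟨F + G, by rw [map_add, hF, hG, AddMonoidAlgebra.single_add]⟩
    | monomial n x => exact ⟨_, swapHom_monomial n m x⟩

theorem swapHom_mem_iff {l d : P} {F : (AddMonoidAlgebra R Λ)[X]} :
    swapHom R Λ F ∈ algGrading (polyGrading ℛ l) deg d ↔
      F ∈ polyGrading (algGrading ℛ deg) l d := by
  constructor
  · intro h n m
    rw [← coeff_swapHom]
    exact mem_congr (h m n) (by abel)
  · intro h m n
    rw [coeff_swapHom]
    exact mem_congr (h n m) (by abel)

theorem swapHom_comp : (swapHom R Λ).comp (mapRingHom AddMonoidAlgebra.singleZeroRingHom) =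
    AddMonoidAlgebra.singleZeroRingHom := by
  apply Polynomial.ringHom_ext
  · intro x
    simp [swapHom, AddMonoidAlgebra.singleZeroRingHom]
  · simp [swapHom, AddMonoidAlgebra.singleZeroRingHom]

theorem hasDenom_swapHom [SetLike.GradedMonoid ℛ] {l : P} {S : Submonoid R[X]} {δ : R[X] → P}
    {R' : Type*} [CommRing R'] {φ : R[X] →+* R'} {ℛ' : P → AddSubgroup R'}
    (h : HasDenom S δ (RingHom.id R[X]) φ (polyGrading ℛ l) ℛ')
    (hS : GrDenom (polyGrading ℛ l) S δ) :
    HasDenom S δ (mapRingHom AddMonoidAlgebra.singleZeroRingHom)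
      ((AddMonoidAlgebra.mapRingHom Λ φ).comp (swapHom R Λ))
      (polyGrading (algGrading ℛ deg) l) (algGrading ℛ' deg) where
  exists_mul d z hz := by
    obtain ⟨s, hs, c, hc, e⟩ := (h.algebra (deg := deg) hS).exists_mul d z hz
    obtain ⟨c, rfl⟩ := swapHom_surjective c
    refine ⟨s, hs, c, swapHom_mem_iff.1 hc, ?_⟩
    rw [RingHom.comp_apply, ← RingHom.comp_apply (swapHom R Λ), swapHom_comp, e]
    rfl

end MonoidAlgebra

section Induction

variable (P : Type*) [AddCommGroup P]

/-- Over every graded principal ideal domain `R`, finitely generated graded projective modules over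
`R[Λ]` are graded free. -/
def MonoidFree (Λ : Type*) [AddCommMonoid Λ] : Prop :=
  ∀ {R : Type u} [CommRing R] [IsDomain R] (ℛ : P → AddSubgroup R) [SetLike.GradedMonoid ℛ],
    GrPID ℛ → ∀ deg : Λ →+ P, AllFree (algGrading ℛ deg)

variable {P} {Λ : Type*} [AddCommMonoid Λ] [TwoUniqueSums Λ]

theorem mapRingHom_singleZero_mem {R : Type*} [CommRing R] {ℛ : P → AddSubgroup R} {deg : Λ →+ P}
    (l d : P) : ∀ f ∈ polyGrading ℛ l d,
      mapRingHom (AddMonoidAlgebra.singleZeroRingHom (R := R) (M := Λ)) f ∈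
        polyGrading (algGrading ℛ deg) l d := by
  intro f hf
  rw [coe_mapRingHom]
  intro i
  rw [coeff_map]
  exact singleZeroRingHom_mem _ (hf i)

theorem allFree_polyGrading (hΛ : MonoidFree.{u} P Λ) {R : Type u} [CommRing R] [IsDomain R]
    {ℛ : P → AddSubgroup R} [SetLike.GradedMonoid ℛ] (h : GrPID ℛ) (deg : Λ →+ P) (l : P) :
    AllFree (polyGrading (algGrading ℛ deg) l) := by
  intro m a E hE hE2
  let S := monicSubmonoid ℛ l
  let R' := Localization S
  have hS : GrDenom (polyGrading ℛ l) S fun s => s.natDegree • l := grDenom_monicSubmonoid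
  have : IsDomain R' := IsLocalization.isDomain_of_le_nonZeroDivisors _
    (monicSubmonoid_le_nonZeroDivisors ℛ l)
  have hinj : Function.Injective (algebraMap R[X] R') :=
    IsLocalization.injective _ (monicSubmonoid_le_nonZeroDivisors ℛ l)
  have hd := hasDenom_swapHom (deg := deg) (hasDenom_locGrading (B := R') hS) hS
  have hψ : Function.Injective ((AddMonoidAlgebra.mapRingHom Λ (algebraMap R[X] R')).comp
    (swapHom R Λ)) := (mapRingHom_injective hinj).comp swapHom_injective
  have hψm : ∀ d, ∀ f ∈ polyGrading (algGrading ℛ deg) l d,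
      (AddMonoidAlgebra.mapRingHom Λ (algebraMap R[X] R')).comp (swapHom R Λ) f ∈
        algGrading (locGrading R' hS) deg d := fun d f hf =>
    mapRingHom_algGrading_mem _ (algebraMap_mem_locGrading hS) _ (swapHom_mem_iff.2 hf)
  have hfree := hΛ (locGrading R' hS) (h.locGrading R') deg m a _ (hE.map _ hψm)
    (by rw [← Matrix.map_mul, hE2])
  obtain ⟨s, hs, hf⟩ := FreeUpTo.of_hasDenom hd hS (mapRingHom_singleZero_mem l) hψ hE2 hfree
  obtain ⟨hs1, hs2⟩ : s.Monic ∧ s ∈ polyGrading ℛ l (s.natDegree • l) := hs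
  rw [coe_mapRingHom, ← hs1.natDegree_map (AddMonoidAlgebra.singleZeroRingHom (R := R) (M := Λ))] at hf
  refine AllFree.of_freeUpTo (hΛ ℛ h deg) hE hE2 (hs1.map _) ?_ hf
  rw [hs1.natDegree_map]
  exact mapRingHom_singleZero_mem _ _ _ hs2

theorem allFree_laurentGrading (hΛ : MonoidFree.{u} P Λ) {R : Type u} [CommRing R] [IsDomain R]
    {ℛ : P → AddSubgroup R} [SetLike.GradedMonoid ℛ] (h : GrPID ℛ) (deg : Λ →+ P) (l : P)
    (C : Type*) [CommRing C] [Algebra (AddMonoidAlgebra R Λ)[X] C]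
    [IsLocalization.Away (X : (AddMonoidAlgebra R Λ)[X]) C] :
    AllFree (laurentGrading (algGrading ℛ deg) l C) := by
  intro m a E hE hE2
  let S := monicSubmonoid ℛ l
  let R' := Localization S
  have hS : GrDenom (polyGrading ℛ l) S fun s => s.natDegree • l := grDenom_monicSubmonoid
  have : IsDomain R' := IsLocalization.isDomain_of_le_nonZeroDivisors _
    (monicSubmonoid_le_nonZeroDivisors ℛ l)
  have hinj : Function.Injective (algebraMap R[X] R') :=
    IsLocalization.injective _ (monicSubmonoid_le_nonZeroDivisors ℛ l)
  have hd := hasDenom_swapHom (deg := deg) (hasDenom_locGrading (B := R') hS) hS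
  set ψ₁ := (AddMonoidAlgebra.mapRingHom Λ (algebraMap R[X] R')).comp (swapHom R Λ) with hψ₁
  have hψ : Function.Injective ψ₁ := (mapRingHom_injective hinj).comp swapHom_injective
  have hψm : ∀ d, ∀ f ∈ polyGrading (algGrading ℛ deg) l d,
      ψ₁ f ∈ algGrading (locGrading R' hS) deg d := fun d f hf =>
    mapRingHom_algGrading_mem _ (algebraMap_mem_locGrading hS) _ (swapHom_mem_iff.2 hf)
  have hX : (X : R[X]) ∈ S := ⟨monic_X, by rw [natDegree_X, one_smul]; exact X_mem⟩
  have hψX : ψ₁ X = AddMonoidAlgebra.singleZeroRingHom (algebraMap R[X] R' X) := by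
    rw [hψ₁, RingHom.comp_apply, swapHom, coe_eval₂RingHom, eval₂_X]
    simp [AddMonoidAlgebra.singleZeroRingHom]
  obtain ⟨y, hy, hXy⟩ : ∃ y ∈ algGrading (locGrading R' hS) deg (-l), ψ₁ X * y = 1 := by
    obtain ⟨y, hy, hXy⟩ := exists_inv_mem_locGrading (B := R') hS hX
    refine ⟨AddMonoidAlgebra.singleZeroRingHom y, singleZeroRingHom_mem _ (mem_congr hy ?_), ?_⟩
    · rw [natDegree_X, one_smul]
    · rw [hψX, ← map_mul, hXy, map_one]
  let ψ : C →+* AddMonoidAlgebra R' Λ :=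
    IsLocalization.Away.lift (X : (AddMonoidAlgebra R Λ)[X]) (IsUnit.of_mul_eq_one y hXy)
  have hψψ : ∀ x, ψ (algebraMap _ C x) = ψ₁ x := IsLocalization.Away.lift_eq _ _
  have hψinj : Function.Injective ψ := by
    rw [injective_iff_map_eq_zero]
    intro x hx
    obtain ⟨⟨c, s⟩, hs⟩ := IsLocalization.surj (Submonoid.powers (X : (AddMonoidAlgebra R Λ)[X])) x
    have hc : ψ₁ c = 0 := by rw [← hψψ, ← hs, map_mul, hx, zero_mul]
    rw [(injective_iff_map_eq_zero _).1 hψ _ hc, map_zero] at hs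
    exact (IsLocalization.map_units C s).mul_left_eq_zero.1 hs
  have hψgr : ∀ d, ∀ x ∈ laurentGrading (algGrading ℛ deg) l C d,
      ψ x ∈ algGrading (locGrading R' hS) deg d := by
    rintro d x ⟨_, ⟨n, rfl⟩, c, hc, e⟩
    have e' : ψ x = y ^ n * ψ₁ c := by
      rw [← hψψ, ← e, map_mul, hψψ, map_pow, ← mul_assoc, ← mul_pow, mul_comm y, hXy, one_pow,
        one_mul]
    rw [e']
    refine mul_mem_of_eq (pow_mem_of_eq hy n rfl) (hψm _ _ hc) ?_
    dsimp only
    rw [natDegree_X_pow, smul_neg]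
    abel
  have hfree := hΛ (locGrading R' hS) (h.locGrading R') deg m a _ (hE.map ψ hψgr)
    (by rw [← Matrix.map_mul, hE2])
  have hd' : HasDenom S (fun s => s.natDegree • l)
      ((algebraMap (AddMonoidAlgebra R Λ)[X] C).comp
        (mapRingHom (AddMonoidAlgebra.singleZeroRingHom (R := R) (M := Λ)))) ψ
      (laurentGrading (algGrading ℛ deg) l C) (algGrading (locGrading R' hS) deg) := ⟨by
    intro d z hz
    obtain ⟨s, hs, c, hc, e⟩ := hd.exists_mul d z hz
    refine ⟨s, hs, algebraMap _ C c, algebraMap_mem_locGrading _ _ _ hc, ?_⟩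
    rw [hψψ, ← e, RingHom.comp_apply, hψψ]⟩
  obtain ⟨s, hs, hf⟩ := FreeUpTo.of_hasDenom hd' hS (fun d x hx =>
    algebraMap_mem_locGrading _ _ _ (mapRingHom_singleZero_mem l d x hx)) hψinj hE2 hfree
  obtain ⟨hs1, hs2⟩ : s.Monic ∧ s ∈ polyGrading ℛ l (s.natDegree • l) := hs
  rw [RingHom.comp_apply, coe_mapRingHom,
    ← hs1.natDegree_map (AddMonoidAlgebra.singleZeroRingHom (R := R) (M := Λ))] at hf
  refine GrFree.laurent (allFree_polyGrading hΛ h deg (-l)) hE hE2 (hs1.map _) ?_ hf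
  rw [hs1.natDegree_map]
  exact mapRingHom_singleZero_mem _ _ _ hs2

end Induction

section Transport

variable {P : Type*} [AddCommGroup P]

theorem AllFree.of_equiv_symm {A B : Type*} [CommRing A] [CommRing B] {𝒜 : P → AddSubgroup A}
    [SetLike.GradedMonoid 𝒜] {ℬ : P → AddSubgroup B} (φ : B ≃+* A)
    (hφ : ∀ d x, x ∈ ℬ d ↔ φ x ∈ 𝒜 d) (h : AllFree 𝒜) :
    AllFree ℬ :=
  h.of_equiv φ.symm fun d x => by rw [hφ, φ.apply_symm_apply]

theorem mem_algGrading_prod {R : Type*} [CommRing R] {ℛ : P → AddSubgroup R} {Λ Λ' : Type*}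
    [AddCommMonoid Λ] [AddCommMonoid Λ'] {deg : Λ × Λ' →+ P} {d : P}
    {f : AddMonoidAlgebra R (Λ × Λ')} :
    f ∈ algGrading ℛ deg d ↔ AddMonoidAlgebra.curryRingEquiv f ∈
      algGrading (algGrading ℛ (deg.comp (AddMonoidHom.inr Λ Λ')))
        (deg.comp (AddMonoidHom.inl Λ Λ')) d := by
  have hdeg : ∀ m n, deg (m, n) = deg (m, 0) + deg (0, n) := fun m n => by
    rw [← map_add, Prod.mk_add_mk, add_zero, zero_add]
  constructor
  · intro h m n
    refine mem_congr (h (m, n)) ?_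
    rw [hdeg, ← sub_sub]
    rfl
  · rintro h ⟨m, n⟩
    refine mem_congr (h m n) ?_
    rw [hdeg, ← sub_sub]
    rfl

theorem mem_polyGrading_iff {A : Type*} [CommRing A] {𝒜 : P → AddSubgroup A} {deg : ℕ →+ P} {d : P}
    {f : AddMonoidAlgebra A ℕ} : f ∈ algGrading 𝒜 deg d ↔
      (toFinsuppIso A).symm f ∈ polyGrading 𝒜 (deg 1) d := by
  refine forall_congr' fun n => ?_
  have : deg n = n • deg 1 := by rw [← map_nsmul, smul_eq_mul, mul_one]
  rw [this]
  rfl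

theorem coeff_toLaurent {A : Type*} [CommRing A] (f : A[X]) (n : ℕ) :
    (toLaurent f).coeff (n : ℤ) = f.coeff n := by
  induction f using Polynomial.induction_on' with
  | add f g hf hg => rw [map_add, AddMonoidAlgebra.coeff_add, Finsupp.add_apply, hf, hg, coeff_add]
  | monomial k a =>
    rw [toLaurent_C_mul_T, ← LaurentPolynomial.single_eq_C_mul_T,
      AddMonoidAlgebra.coeff_single, Finsupp.single_apply, coeff_monomial]
    simp

theorem coeff_toLaurent_of_neg {A : Type*} [CommRing A] (f : A[X]) {n : ℤ} (hn : n < 0) :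
    (toLaurent f).coeff n = 0 := by
  induction f using Polynomial.induction_on' with
  | add f g hf hg => rw [map_add, AddMonoidAlgebra.coeff_add, Finsupp.add_apply, hf, hg, add_zero]
  | monomial k a =>
    rw [toLaurent_C_mul_T, ← LaurentPolynomial.single_eq_C_mul_T,
      AddMonoidAlgebra.coeff_single, Finsupp.single_apply, if_neg (by omega)]

theorem coeff_mul_T {A : Type*} [CommRing A] (f : LaurentPolynomial A) (n k : ℤ) :
    (f * LaurentPolynomial.T k).coeff n = f.coeff (n - k) := by
  rw [LaurentPolynomial.T, AddMonoidAlgebra.coeff_mul_single_eq_coeff_mul (n - k), mul_one]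
  intro m _
  omega

theorem mem_laurentGrading_iff {A : Type*} [CommRing A] [Nontrivial A] {𝒜 : P → AddSubgroup A}
    [SetLike.GradedMonoid 𝒜] {deg : ℤ →+ P} {d : P} {f : AddMonoidAlgebra A ℤ} :
    f ∈ algGrading 𝒜 deg d ↔ f ∈ laurentGrading 𝒜 (deg 1) (LaurentPolynomial A) d := by
  have hdeg : ∀ n : ℤ, deg n = n • deg 1 := fun n => by rw [← map_zsmul, smul_eq_mul, mul_one]
  constructor
  · intro h
    obtain ⟨n, f', hf⟩ := LaurentPolynomial.exists_T_pow f
    refine ⟨X ^ n, ⟨n, rfl⟩, f', fun i => ?_, ?_⟩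
    · rw [← coeff_toLaurent, hf, coeff_mul_T]
      refine mem_congr (h _) ?_
      dsimp only
      rw [natDegree_X_pow, hdeg, sub_smul, natCast_zsmul, natCast_zsmul]
      abel
    · rw [LaurentPolynomial.algebraMap_eq_toLaurent, LaurentPolynomial.algebraMap_eq_toLaurent,
      toLaurent_X_pow, hf, LaurentPolynomial.T_mul]
  · rintro ⟨_, ⟨n, rfl⟩, a, ha, e⟩ k
    dsimp only at e ha
    rw [LaurentPolynomial.algebraMap_eq_toLaurent, LaurentPolynomial.algebraMap_eq_toLaurent,
      toLaurent_X_pow, LaurentPolynomial.T_mul] at e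
    have h1 : f.coeff k = (toLaurent a).coeff (k + n) := by
      rw [← e, coeff_mul_T, add_sub_cancel_right]
    rw [h1]
    rcases lt_or_ge (k + n) 0 with hk | hk
    · rw [coeff_toLaurent_of_neg a hk]
      exact zero_mem _
    · obtain ⟨i, hi⟩ := Int.eq_ofNat_of_zero_le hk
      rw [hi, coeff_toLaurent]
      refine mem_congr (ha i) ?_
      have : k = i - n := by omega
      rw [natDegree_X_pow, this, hdeg (i - n), sub_smul, natCast_zsmul, natCast_zsmul]
      abel

variable {Λ Λ' : Type*} [AddCommMonoid Λ] [AddCommMonoid Λ']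

theorem MonoidFree.of_equiv (e : Λ ≃+ Λ') (h : MonoidFree.{u} P Λ) : MonoidFree.{u} P Λ' := by
  intro R _ _ ℛ _ hR deg
  refine (h ℛ hR (deg.comp e)).of_equiv (AddMonoidAlgebra.mapDomainRingEquiv R e) fun d f => ?_
  constructor
  · intro hf m
    rw [AddMonoidAlgebra.coeff_mapDomainRingEquiv]
    refine mem_congr (hf (e.symm m)) ?_
    simp
  · intro hf m
    have := hf (e m)
    rw [AddMonoidAlgebra.coeff_mapDomainRingEquiv] at this
    simpa using this

theorem MonoidFree.of_subsingleton [Subsingleton Λ] : MonoidFree.{u} P Λ := by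
  intro R _ _ ℛ _ hR deg
  refine hR.allFree.of_equiv_symm (AddMonoidAlgebra.uniqueRingEquiv Λ) fun d f => ?_
  have hdeg : ∀ m, deg m = 0 := fun m => by rw [Subsingleton.elim m 0, map_zero]
  constructor
  · intro h
    exact mem_congr (h 0) (by rw [hdeg, sub_zero])
  · intro h m
    rw [Subsingleton.elim m 0]
    exact mem_congr h (by rw [hdeg, sub_zero])

variable [TwoUniqueSums Λ]

theorem MonoidFree.nat_prod (h : MonoidFree.{u} P Λ) : MonoidFree.{u} P (ℕ × Λ) := by
  intro R _ _ ℛ _ hR deg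
  refine (allFree_polyGrading h hR (deg.comp (AddMonoidHom.inr ℕ Λ))
    (deg (1, 0))).of_equiv_symm (AddMonoidAlgebra.curryRingEquiv.trans (toFinsuppIso _).symm)
    fun d f => ?_
  rw [mem_algGrading_prod, mem_polyGrading_iff]
  rfl

theorem MonoidFree.int_prod (h : MonoidFree.{u} P Λ) : MonoidFree.{u} P (ℤ × Λ) := by
  intro R _ _ ℛ _ hR deg
  refine (allFree_laurentGrading h hR (deg.comp (AddMonoidHom.inr ℤ Λ))
    (deg (1, 0)) (LaurentPolynomial (AddMonoidAlgebra R Λ))).of_equiv_symm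
    AddMonoidAlgebra.curryRingEquiv fun d f => ?_
  rw [mem_algGrading_prod, mem_laurentGrading_iff]
  rfl

theorem MonoidFree.fin_int (r : ℕ) : MonoidFree.{u} P (Fin r → ℤ) := by
  induction r with
  | zero => exact MonoidFree.of_subsingleton
  | succ r ih =>
    exact MonoidFree.of_equiv (Fin.consLinearEquiv ℤ fun _ => ℤ).toAddEquiv
      (MonoidFree.int_prod ih)

theorem MonoidFree.fin_nat_prod_fin_int (n r : ℕ) :
    MonoidFree.{u} P ((Fin n → ℕ) × (Fin r → ℤ)) := by
  induction n with
  | zero => exact MonoidFree.of_equiv AddEquiv.uniqueProd.symm (MonoidFree.fin_int r)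
  | succ n ih =>
    exact MonoidFree.of_equiv (AddEquiv.prodAssoc.symm.trans
      ((Fin.consLinearEquiv ℕ fun _ => ℕ).toAddEquiv.prodCongr (AddEquiv.refl _)))
      (MonoidFree.nat_prod ih)

end Transport

section Components

variable {R P Λ : Type*} [CommRing R] [AddCommGroup P] [AddCommMonoid Λ] {deg : Λ →+ P}

theorem single_mem_monAlgGrading (m : Λ) (x : R) :
    AddMonoidAlgebra.single m x ∈ monAlgGrading R deg (deg m) := by
  have : AddMonoidAlgebra.single m x = x • AddMonoidAlgebra.single m (1 : R) := by
    rw [AddMonoidAlgebra.smul_single, smul_eq_mul, mul_one]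
  rw [this]
  exact Submodule.smul_mem _ _ (Submodule.subset_span ⟨m, rfl, rfl⟩)

theorem mem_monAlgGrading_iff {d : P} {f : AddMonoidAlgebra R Λ} :
    f ∈ monAlgGrading R deg d ↔ f ∈ algGrading (trivGrading R P) deg d := by
  constructor
  · intro h
    induction h using Submodule.span_induction with
    | mem x hx =>
      obtain ⟨s, rfl, rfl⟩ := hx
      exact single_mem (mem_trivGrading.2 (Or.inl (sub_self _)))
    | zero => exact zero_mem _
    | add x y _ _ hx hy => exact add_mem hx hy
    | smul r x _ hx =>
      intro m
      rw [AddMonoidAlgebra.coeff_smul_apply, mem_trivGrading]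
      exact (mem_trivGrading.1 (hx m)).imp_right fun h => by rw [h, smul_zero]
  · intro h
    rw [eq_sum_single f]
    refine sum_mem fun m _ => ?_
    rcases mem_trivGrading.1 (h m) with hm | hm
    · rw [sub_eq_zero.1 hm]
      exact single_mem_monAlgGrading m _
    · rw [hm, AddMonoidAlgebra.single_zero]
      exact zero_mem _

variable [DecidableEq P]

variable (R deg) in
/-- The homogeneous components of an element of a graded monoid algebra. -/
noncomputable def homComp (d : P) : AddMonoidAlgebra R Λ →+ AddMonoidAlgebra R Λ :=
  (AddMonoidAlgebra.coeffAddEquiv (R := R) (M := Λ)).symm.toAddMonoidHom.comp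
    ((Finsupp.filterAddHom fun m => deg m = d).comp
      (AddMonoidAlgebra.coeffAddEquiv (R := R) (M := Λ)).toAddMonoidHom)

theorem coeff_homComp (d : P) (f : AddMonoidAlgebra R Λ) (m : Λ) :
    (homComp R deg d f).coeff m = if deg m = d then f.coeff m else 0 :=
  Finsupp.filter_apply _ _ _

theorem homComp_single (d : P) (m : Λ) (x : R) :
    homComp R deg d (AddMonoidAlgebra.single m x) =
      if deg m = d then AddMonoidAlgebra.single m x else 0 := by
  classical
  ext n
  rw [coeff_homComp, AddMonoidAlgebra.coeff_single, Finsupp.single_apply]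
  by_cases hm : m = n
  · subst hm
    by_cases h : deg m = d <;> simp [h]
  · by_cases h : deg m = d <;> simp [h, hm]

theorem homComp_mem (d : P) (f : AddMonoidAlgebra R Λ) :
    homComp R deg d f ∈ monAlgGrading R deg d := by
  rw [mem_monAlgGrading_iff]
  intro m
  rw [coeff_homComp, mem_trivGrading]
  split_ifs with h
  · exact Or.inl (by rw [h, sub_self])
  · exact Or.inr rfl

theorem eq_zero_of_homComp {f : AddMonoidAlgebra R Λ} (h : ∀ d, homComp R deg d f = 0) :
    f = 0 := by
  ext m
  have := congrArg (fun g => g.coeff m) (h (deg m))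
  simpa [coeff_homComp] using this

variable {M : Type*} [AddCommGroup M] [Module R M]

theorem exists_components {ℳ : P → Submodule R M} (h : DirectSum.IsInternal ℳ) :
    ∃ π : P → M →+ M, ∀ d e, ∀ m ∈ ℳ d, π e m = if d = e then m else 0 := by
  let _ := h.chooseDecomposition
  refine ⟨fun e => (ℳ e).subtype.toAddMonoidHom.comp ((DFinsupp.evalAddMonoidHom e).comp
    (DirectSum.decomposeAddEquiv ℳ).toAddMonoidHom), fun d e m hm => ?_⟩
  change (DirectSum.decompose ℳ m e : M) = _
  split_ifs with hde
  · subst hde; exact DirectSum.decompose_of_mem_same ℳ hm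
  · exact DirectSum.decompose_of_mem_ne ℳ hm hde

variable [Module (AddMonoidAlgebra R Λ) M] [IsScalarTower R (AddMonoidAlgebra R Λ) M]
  {ℳ : P → Submodule R M}

theorem component_smul (hM : IsGradedModule (monAlgGrading R deg) ℳ) {π : P → M →+ M}
    (hπ : ∀ d e, ∀ m ∈ ℳ d, π e m = if d = e then m else 0) {b c e : P} {m : M} (hm : m ∈ ℳ b)
    (x : AddMonoidAlgebra R Λ) (he : e + b = c) : π c (x • m) = homComp R deg e x • m := by
  induction x using AddMonoidAlgebra.induction_linear with
  | zero => simp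
  | add x y hx hy => rw [add_smul, map_add, hx, hy, map_add, add_smul]
  | single n r =>
    rw [hπ _ _ _ (hM.smul_mem (single_mem_monAlgGrading n r) hm), homComp_single]
    by_cases h : deg n = e
    · rw [if_pos h, if_pos (by rw [h, he])]
    · rw [if_neg h, if_neg (fun h' => h (add_right_cancel (h'.trans he.symm))), zero_smul]

theorem homComp_mul {a c e : P} {u : AddMonoidAlgebra R Λ} (hu : u ∈ monAlgGrading R deg a)
    (x : AddMonoidAlgebra R Λ) (he : a + e = c) :
    homComp R deg c (u * x) = u * homComp R deg e x := by
  induction hu using Submodule.span_induction with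
  | zero => simp
  | add u v _ _ hu hv => rw [add_mul, map_add, hu, hv, add_mul]
  | smul r u _ hu =>
    rw [smul_mul_assoc, smul_mul_assoc, ← hu]
    ext m
    simp [coeff_homComp]
  | mem u hu =>
    obtain ⟨s, rfl, rfl⟩ := hu
    induction x using AddMonoidAlgebra.induction_linear with
    | zero => simp
    | add x y hx hy => rw [mul_add, map_add, hx, hy, map_add, mul_add]
    | single n r =>
      rw [AddMonoidAlgebra.single_mul_single, homComp_single, homComp_single, map_add, ← he]
      simp only [add_right_inj]
      split_ifs <;> simp [AddMonoidAlgebra.single_mul_single]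

end Components

section Extended

variable {R P Λ : Type*} [CommRing R] [AddCommGroup P] [AddCommMonoid Λ] {deg : Λ →+ P}
  [DecidableEq P] {M : Type*} [AddCommGroup M] [Module R M]
  [Module (AddMonoidAlgebra R Λ) M] [IsScalarTower R (AddMonoidAlgebra R Λ) M]
  {ℳ : P → Submodule R M}

theorem exists_homogeneous_generators (hM : DirectSum.IsInternal ℳ)
    [Module.Finite (AddMonoidAlgebra R Λ) M] :
    ∃ (k : ℕ) (d : Fin k → P) (m : Fin k → M), (∀ i, m i ∈ ℳ (d i)) ∧
      Submodule.span (AddMonoidAlgebra R Λ) (Set.range m) = ⊤ := by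
  classical
  let H : Set M := {x | ∃ d, x ∈ ℳ d}
  have hH : Submodule.span (AddMonoidAlgebra R Λ) H = ⊤ := by
    refine eq_top_iff.2 fun x _ => ?_
    have hx : x ∈ iSup ℳ := by rw [hM.submodule_iSup_eq_top]; trivial
    induction hx using Submodule.iSup_induction' with
    | mem i x hx => exact Submodule.subset_span ⟨i, hx⟩
    | zero => exact zero_mem _
    | add x y _ _ hx hy => exact add_mem (hx trivial) (hy trivial)
  have hfg : (Submodule.span (AddMonoidAlgebra R Λ) H).FG := by
    rw [hH]; exact Module.Finite.fg_top
  obtain ⟨s, hs, hsH⟩ := (Submodule.fg_span_iff_fg_span_finset_subset H).1 hfg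
  choose d hd using fun i : Fin s.card => hs (s.equivFin.symm i).2
  refine ⟨s.card, d, fun i => s.equivFin.symm i, hd, ?_⟩
  rw [← hH, hsH]
  congr 1
  ext x
  constructor
  · rintro ⟨i, rfl⟩
    exact (s.equivFin.symm i).2
  · intro hx
    exact ⟨s.equivFin ⟨x, hx⟩, by simp⟩

theorem exists_idempotent (hM : IsGradedModule (monAlgGrading R deg) ℳ)
    [Module.Projective (AddMonoidAlgebra R Λ) M] {k : ℕ} {d : Fin k → P} {m : Fin k → M}
    (hm : ∀ i, m i ∈ ℳ (d i)) (hspan : Submodule.span (AddMonoidAlgebra R Λ) (Set.range m) = ⊤) :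
    ∃ E : Matrix (Fin k) (Fin k) (AddMonoidAlgebra R Λ),
      HomMat (algGrading (trivGrading R P) deg) (fun i => -d i) (fun i => -d i) E ∧
      (∀ j, m j = ∑ i, E i j • m i) ∧
      ∀ u : Fin k → AddMonoidAlgebra R Λ, ∑ i, u i • m i = 0 → E.mulVec u = 0 := by
  classical
  obtain ⟨π, hπ⟩ := exists_components hM.is_internal
  let p : (Fin k → AddMonoidAlgebra R Λ) →ₗ[AddMonoidAlgebra R Λ] M :=
    Fintype.linearCombination _ m
  have hp : Function.Surjective p := by
    rw [← LinearMap.range_eq_top, ← hspan]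
    exact Fintype.range_linearCombination _ m
  obtain ⟨s, hs⟩ := Module.projective_lifting_property p LinearMap.id hp
  have hs' : ∀ x, ∑ i, s x i • m i = x := fun x => LinearMap.congr_fun hs x
  have hpi : ∀ (u : Fin k → AddMonoidAlgebra R Λ) c,
      π c (∑ i, u i • m i) = ∑ i, homComp R deg (c - d i) (u i) • m i := fun u c => by
    rw [map_sum]
    exact Finset.sum_congr rfl fun i _ =>
      component_smul hM hπ (hm i) (u i) (sub_add_cancel c (d i))
  refine ⟨fun i j => homComp R deg (d j - d i) (s (m j) i), fun i j => ?_, fun j => ?_,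
    fun u hu => funext fun i => eq_zero_of_homComp (deg := deg) fun e => ?_⟩
  · exact mem_congr (mem_monAlgGrading_iff.1 (homComp_mem _ _)) (by dsimp only; abel)
  · have := hpi (s (m j)) (d j)
    rw [hs', hπ _ _ _ (hm j), if_pos rfl] at this
    exact this
  · have h1 : ∑ j, homComp R deg (e + d i - d j) (u j) • m j = 0 := by
      rw [← hpi, hu, map_zero]
    have h2 : ∑ j, homComp R deg (e + d i - d j) (u j) * s (m j) i = 0 := by
      have := congrArg (fun x => s x i) h1
      simpa [map_sum, Finset.sum_apply] using this
    have h3 := congrArg (homComp R deg e) h2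
    rw [map_sum, map_zero] at h3
    rw [← h3]
    change homComp R deg e (∑ j, _ * u j) = _
    rw [map_sum]
    refine Finset.sum_congr rfl fun j _ => ?_
    rw [homComp_mul (homComp_mem _ _) (u j) (e := e + d i - d j) (by abel),
      homComp_mul (homComp_mem _ _) (s (m j) i) (e := d j - d i) (by abel), mul_comm]

theorem exists_homogeneous_basis (hM : IsGradedModule (monAlgGrading R deg) ℳ)
    [Module.Finite (AddMonoidAlgebra R Λ) M] [Module.Projective (AddMonoidAlgebra R Λ) M]
    (hfree : AllFree (algGrading (trivGrading R P) deg)) :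
    ∃ (k : ℕ) (b : Fin k → P) (v : Module.Basis (Fin k) (AddMonoidAlgebra R Λ) M),
      ∀ j, v j ∈ ℳ (b j) := by
  classical
  obtain ⟨k, d, m, hm, hspan⟩ := exists_homogeneous_generators (R := R) (Λ := Λ) hM.is_internal
  obtain ⟨E, hE, hmE, hEu⟩ := exists_idempotent hM hm hspan
  have hE2 : E * E = E := by
    have key : ∀ j, E.mulVec (fun i => E i j - (1 : Matrix _ _ _) i j) = 0 := fun j => by
      refine hEu _ ?_
      simp only [sub_smul, Finset.sum_sub_distrib]
      rw [← hmE j]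
      simp [Matrix.one_apply, ite_smul]
    have : E * (E - 1) = 0 := by
      ext1 i j
      exact congrFun (key j) i
    rwa [mul_sub, mul_one, sub_eq_zero] at this
  obtain ⟨l, b, X, Y, hX, hY, hXY, hYX⟩ := hfree _ _ _ hE hE2
  let v : Fin l → M := fun j => ∑ i, X i j • m i
  have hvm : ∀ j, ∑ i, Y i j • v i = m j := fun j => by
    rw [hmE j, ← hXY]
    simp only [v, Finset.smul_sum, smul_smul, Matrix.mul_apply, Finset.sum_smul]
    rw [Finset.sum_comm]
    simp only [mul_comm]
  have hli : LinearIndependent (AddMonoidAlgebra R Λ) v := by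
    rw [Fintype.linearIndependent_iff]
    intro g hg
    have h1 : ∑ i, X.mulVec g i • m i = 0 := by
      rw [← hg]
      simp only [v, Finset.smul_sum, smul_smul, Matrix.mulVec, dotProduct, Finset.sum_smul]
      rw [Finset.sum_comm]
      simp only [mul_comm]
    have h2 := congrArg Y.mulVec (hEu _ h1)
    rw [← hXY, Matrix.mulVec_mulVec, Matrix.mulVec_mulVec, Matrix.mulVec_zero,
      ← Matrix.mul_assoc Y X Y, hYX, Matrix.one_mul, hYX, Matrix.one_mulVec] at h2
    exact congrFun h2
  refine ⟨l, fun j => -b j, Module.Basis.mk hli ?_, fun j => ?_⟩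
  · rw [← hspan, Submodule.span_le]
    rintro _ ⟨j, rfl⟩
    rw [← hvm j]
    exact sum_mem fun i _ => Submodule.smul_mem _ _ (Submodule.subset_span ⟨i, rfl⟩)
  · rw [Module.Basis.mk_apply]
    refine sum_mem fun i _ => ?_
    have := hM.smul_mem (mem_monAlgGrading_iff.2 (hX i j)) (hm i)
    rwa [show -d i - b j + d i = -b j by abel] at this

end Extended

section Shift

variable {P : Type*} [AddCommGroup P] {k : ℕ}

/-- The grading of `R ^ k` for which the `j`-th basis vector has degree `b j`. -/
def basisGrading (R : Type*) [CommRing R] (b : Fin k → P) (d : P) :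
    Submodule R (Fin k → R) where
  carrier := {g | ∀ j, b j ≠ d → g j = 0}
  zero_mem' := fun _ _ => rfl
  add_mem' := fun {x y} hx hy j hj => by rw [Pi.add_apply, hx j hj, hy j hj, add_zero]
  smul_mem' := fun r x hx j hj => by rw [Pi.smul_apply, hx j hj, smul_zero]

variable {R : Type*} [CommRing R] {b : Fin k → P}

theorem single_mem_basisGrading (j : Fin k) (r : R) :
    Pi.single j r ∈ basisGrading R b (b j) := fun i hi => by
  rw [Pi.single_apply, if_neg fun h => hi (congrArg b h)]

theorem isInternal_basisGrading [DecidableEq P] :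
    DirectSum.IsInternal (basisGrading R b) := by
  have key : ∀ (x : DirectSum P fun d => basisGrading R b d) j,
      (DirectSum.coeAddMonoidHom (basisGrading R b) x) j = (x (b j) : Fin k → R) j := fun x j => by
    induction x using DirectSum.induction_on with
    | zero => simp
    | of d y =>
      rw [DirectSum.coeAddMonoidHom_of]
      by_cases h : d = b j
      · subst h; rw [DirectSum.of_eq_same]
      · rw [DirectSum.of_eq_of_ne _ _ _ (Ne.symm h), y.2 j (Ne.symm h)]; rfl
    | add x y hx hy =>
      rw [map_add, Pi.add_apply, hx, hy]; rfl
  constructor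
  · refine (injective_iff_map_eq_zero _).2 fun x hx => DFinsupp.ext fun d => Subtype.ext ?_
    funext j
    by_cases h : b j = d
    · subst h
      rw [← key, hx]; rfl
    · exact (x d).2 j h
  · intro g
    refine ⟨∑ j, DirectSum.of (fun d => basisGrading R b d) (b j)
      ⟨Pi.single j (g j), single_mem_basisGrading j _⟩, ?_⟩
    rw [map_sum]
    simp only [DirectSum.coeAddMonoidHom_of]
    exact Finset.univ_sum_single g

end Shift

section Extended

variable {R P : Type u} {Λ : Type} [CommRing R] [AddCommGroup P] [AddCommMonoid Λ] {deg : Λ →+ P}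
  [DecidableEq P] {M : Type u} [AddCommGroup M] [Module R M]
  [Module (AddMonoidAlgebra R Λ) M] [IsScalarTower R (AddMonoidAlgebra R Λ) M]
  {ℳ : P → Submodule R M}

theorem isGradedExtendedFrom (hM : IsGradedModule (monAlgGrading R deg) ℳ)
    [Module.Finite (AddMonoidAlgebra R Λ) M] [Module.Projective (AddMonoidAlgebra R Λ) M]
    (hfree : AllFree (algGrading (trivGrading R P) deg)) :
    IsGradedExtendedFrom R (monAlgGrading R deg) M ℳ := by
  obtain ⟨k, b, v, hv⟩ := exists_homogeneous_basis hM hfree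
  refine ⟨Fin k → R, inferInstance, inferInstance, basisGrading R b, isInternal_basisGrading,
    inferInstance, inferInstance, v.equivFun.trans
      (TensorProduct.piScalarRight R (AddMonoidAlgebra R Λ) (AddMonoidAlgebra R Λ) (Fin k)).symm,
    fun c m hm => ?_, fun c z hz => ?_⟩
  · obtain ⟨π, hπ⟩ := exists_components hM.is_internal
    have h1 : ∑ j, v.equivFun m j • v j = m := v.sum_equivFun m
    have h2 : ∑ j, homComp R deg (c - b j) (v.equivFun m j) • v j = m := by
      refine (Finset.sum_congr rfl fun j _ => (component_smul hM hπ (hv j) (v.equivFun m j)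
        (sub_add_cancel c (b j))).symm).trans ?_
      rw [← map_sum, h1, hπ c c m hm, if_pos rfl]
    have h3 : ∀ j, v.equivFun m j ∈ monAlgGrading R deg (c - b j) := fun j => by
      have : (fun j => homComp R deg (c - b j) (v.equivFun m j)) = v.equivFun m :=
        v.equivFun.symm_apply_eq.1 (by rw [v.equivFun_symm_apply]; exact h2)
      rw [← congrFun this j]
      exact homComp_mem _ _
    rw [LinearEquiv.trans_apply, ← Finset.univ_sum_single (v.equivFun m), map_sum]
    refine sum_mem fun j _ => ?_
    rw [TensorProduct.piScalarRight_symm_single]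
    exact Submodule.subset_span ⟨_, _, sub_add_cancel c (b j), _, h3 j, _,
      single_mem_basisGrading j 1, rfl⟩
  · induction hz using Submodule.span_induction with
    | zero => simp
    | add x y _ _ hx hy => rw [map_add]; exact add_mem hx hy
    | smul r x _ hx =>
      rw [← algebraMap_smul (AddMonoidAlgebra R Λ) r x, map_smul, algebraMap_smul]
      exact Submodule.smul_mem _ _ hx
    | mem z hz =>
      obtain ⟨a, d, rfl, x, hx, f, hf, rfl⟩ := hz
      rw [LinearEquiv.trans_symm, LinearEquiv.symm_symm, LinearEquiv.trans_apply,
        TensorProduct.piScalarRight_apply, TensorProduct.piScalarRightHom_tmul,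
        v.equivFun_symm_apply]
      refine sum_mem fun j _ => ?_
      by_cases h : b j = d
      · subst h
        exact hM.smul_mem (Submodule.smul_mem _ _ hx) (hv j)
      · rw [hf j h, zero_smul, zero_smul]
        exact zero_mem _

end Extended

end GradedProj

/-!
STATEMENT 3 (Theorem `Main-2`(2)):
Let `R` be a principal ideal domain, `P` a finitely generated abelian group, and let
`A = R[x_1,…,x_n, y_1^{±1},…,y_r^{±1}]` (realized as the monoid algebra
`R[ℕ^n ⊕ ℤ^r]`) be `P`-graded by letting `x_i` be homogeneous of degree `λ i`,
`y_j` homogeneous of degree `γ j` and `R` of degree `0`.  Then every finitely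
generated `P`-graded `A`-module which is projective as an `A`-module is isomorphic,
as a `P`-graded `A`-module, to `F ⊗_R A` for some `P`-graded `R`-module `F` which is
finitely generated and projective over `R`.
-/
theorem equivariant_bass_quillen_mixed_laurent_over_PID
    (R : Type u) [CommRing R] [IsDomain R] [IsPrincipalIdealRing R]
    (P : Type u) [AddCommGroup P] [AddGroup.FG P] [DecidableEq P]
    (n r : ℕ) (lam : Fin n → P) (gam : Fin r → P)
    (M : Type u) [AddCommGroup M] [Module R M]
    [Module (AddMonoidAlgebra R ((Fin n → ℕ) × (Fin r → ℤ))) M]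
    [IsScalarTower R (AddMonoidAlgebra R ((Fin n → ℕ) × (Fin r → ℤ))) M]
    (ℳ : P → Submodule R M)
    (hM : IsGradedModule
      (monAlgGrading R (fun m : (Fin n → ℕ) × (Fin r → ℤ) =>
        (∑ i, (m.1 i) • lam i) + ∑ j, (m.2 j) • gam j)) ℳ)
    (hfin : Module.Finite (AddMonoidAlgebra R ((Fin n → ℕ) × (Fin r → ℤ))) M)
    (hproj : Module.Projective (AddMonoidAlgebra R ((Fin n → ℕ) × (Fin r → ℤ))) M) :
    IsGradedExtendedFrom R
      (monAlgGrading R (fun m : (Fin n → ℕ) × (Fin r → ℤ) =>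
        (∑ i, (m.1 i) • lam i) + ∑ j, (m.2 j) • gam j)) M ℳ := by
  let deg : (Fin n → ℕ) × (Fin r → ℤ) →+ P :=
    { toFun := fun m => (∑ i, (m.1 i) • lam i) + ∑ j, (m.2 j) • gam j
      map_zero' := by simp
      map_add' := fun x y => by
        simp only [Prod.fst_add, Prod.snd_add, Pi.add_apply, add_smul, Finset.sum_add_distrib]
        abel }
  exact GradedProj.isGradedExtendedFrom (deg := deg) hM
    (GradedProj.MonoidFree.fin_nat_prod_fin_int n r (GradedProj.trivGrading R P)
      GradedProj.grPID_trivGrading deg)
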